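/- arXiv:1408.2635 — 3 statements merged into one kernel-verified Lean document; each statement's English description precedes it below -/
import Mathlib

section
/- Let A be a commutative Noetherian ring with Jacobson radical 𝒥, let I be an ideal of A[T] with I + 𝒥A[T] = A[T], and let n be a positive integer with dim(A/𝒥) ≤ n − 2. Let P be a finitely generated projective A-module of constant rank n with n ≥ dim A[T] − ht I + 2. Let φ : P[T] → A[T] be an A[T]-linear map with φ(P[T]) ⊆ I and φ(P[T]) + I² = I (so φ induces a surjection P[T] ↠ I/I²). If there exists an A(T)-linear map Φ₁ : P(T) → A(T) with image I·A(T) such that Φ₁(p) − φ(p) ∈ I²·A(T) for all p ∈ P[T], then there exists an A[T]-linear map Φ : P[T] → A[T] with Φ(P[T]) = I and Φ(p) − φ(p) ∈ I² for all p ∈ P[T]. -/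
open Polynomial

/-- The height of an ideal: the infimum of the heights of the primes containing it. -/
noncomputable def idealHeight {A : Type*} [CommRing A] (I : Ideal A) : ℕ∞ :=
  ⨅ (p : PrimeSpectrum A) (_ : I ≤ p.asIdeal), Order.height p

/-- The multiplicative set of monic polynomials; `A(T)` is the localization of `A[T]`
at this submonoid. -/
def monicSubmonoid (A : Type*) [CommRing A] : Submonoid A[X] where
  carrier := { f | f.Monic }
  one_mem' := Polynomial.monic_one
  mul_mem' := fun hf hg => hf.mul hg

section file1
namespace LiftAT

/-- image of a vector in the residue field -/
noncomputable def rv {R : Type*} [CommRing R] {ι : Type*} (p : PrimeSpectrum R) (v : ι → R) :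
    ι → p.asIdeal.ResidueField := fun i => algebraMap R p.asIdeal.ResidueField (v i)

noncomputable def sp {R : Type*} [CommRing R] {ι : Type*} (p : PrimeSpectrum R)
    (s : Set (ι → R)) : Submodule p.asIdeal.ResidueField (ι → p.asIdeal.ResidueField) :=
  Submodule.span _ (rv p '' s)

noncomputable def rk {R : Type*} [CommRing R] {ι : Type*} (p : PrimeSpectrum R)
    (s : Set (ι → R)) : ℕ := Module.finrank p.asIdeal.ResidueField (sp p s)

section
variable {R : Type*} [CommRing R] {ι : Type*}

lemma rv_add (p : PrimeSpectrum R) (v w : ι → R) : rv p (v + w) = rv p v + rv p w := by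
  ext i; simp [rv]

lemma rv_smul (p : PrimeSpectrum R) (b : R) (w : ι → R) :
    rv p (b • w) = (algebraMap R p.asIdeal.ResidueField b) • rv p w := by
  ext i; simp [rv]

lemma rv_eq_zero (p : PrimeSpectrum R) (v : ι → R) : rv p v = 0 ↔ ∀ i, v i ∈ p.asIdeal := by
  simp [rv, funext_iff, Ideal.algebraMap_residueField_eq_zero]

lemma rk_mono [Fintype ι] (p : PrimeSpectrum R) {s t : Set (ι → R)} (h : s ⊆ t) : rk p s ≤ rk p t :=
  Submodule.finrank_mono (Submodule.span_mono (Set.image_mono h))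

lemma exists_num (p : PrimeSpectrum R) {κ : Type*} [Finite κ]
    (f : κ → p.asIdeal.ResidueField) : ∃ (d : R) (g : κ → R), d ∉ p.asIdeal ∧
      ∀ k, algebraMap R p.asIdeal.ResidueField (g k) = algebraMap R _ d * f k := by
  obtain ⟨b, hb⟩ := IsLocalization.exist_integer_multiples_of_finite
    (nonZeroDivisors (R ⧸ p.asIdeal)) f
  choose g hg using hb
  obtain ⟨d, hd⟩ := Ideal.Quotient.mk_surjective (b : R ⧸ p.asIdeal)
  choose g' hg' using fun k => Ideal.Quotient.mk_surjective (g k)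
  refine ⟨d, g', ?_, fun k => ?_⟩
  · intro h
    have := nonZeroDivisors.coe_ne_zero b
    rw [← hd] at this
    exact this (Ideal.Quotient.eq_zero_iff_mem.2 h)
  · have := hg k
    rw [← hg', ← hd, Algebra.smul_def] at this
    exact this

lemma rk_open [Fintype ι] (p : PrimeSpectrum R) (s : Set (ι → R)) :
    ∃ d : R, d ∉ p.asIdeal ∧ ∀ p' : PrimeSpectrum R, d ∉ p'.asIdeal → rk p s ≤ rk p' s := by
  classical
  obtain ⟨b, hb, hbs, hli⟩ := exists_linearIndependent p.asIdeal.ResidueField (rv p '' s)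
  have hfin : b.Finite := hli.setFinite
  have : Fintype b := hfin.fintype
  have hrk : rk p s = Fintype.card b := by
    rw [rk, sp, ← hbs]
    rw [finrank_span_set_eq_card hli, Set.toFinset_card]
  choose v hv hvb using fun x : b => hb x.2
  let M : Matrix b ι R := Matrix.of v
  have hMrow : LinearIndependent p.asIdeal.ResidueField
      (M.map (algebraMap R p.asIdeal.ResidueField)).row := by
    have h : (M.map (algebraMap R p.asIdeal.ResidueField)).row = (Subtype.val : b → _) := by
      ext x i
      exact congrFun (hvb x) i
    rw [h]
    exact hli
  obtain ⟨V, hV⟩ := (Matrix.mulVec_surjective_iff_exists_right_inverse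
    (A := M.map (algebraMap R p.asIdeal.ResidueField))).1 (by
      have h1 : (M.map (algebraMap R p.asIdeal.ResidueField)).rank = Fintype.card b := by
        rw [Matrix.rank_eq_finrank_span_row, finrank_span_eq_card hMrow]
      have h2 : LinearMap.range (M.map (algebraMap R p.asIdeal.ResidueField)).mulVecLin = ⊤ := by
        apply Submodule.eq_top_of_finrank_eq
        rw [Module.finrank_fintype_fun_eq_card]
        exact h1
      exact LinearMap.range_eq_top.1 h2)
  obtain ⟨d, g, hd, hg⟩ := exists_num p (fun k : ι × b => V k.1 k.2)
  let W : Matrix ι b R := Matrix.of fun i j => g (i, j)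
  have hMW : (M * W).map (algebraMap R p.asIdeal.ResidueField)
      = (algebraMap R p.asIdeal.ResidueField d) • 1 := by
    rw [Matrix.map_mul, ← hV, ← Matrix.mul_smul]
    congr 1
    ext i j
    simpa [W] using hg (i, j)
  refine ⟨(M * W).det, ?_, fun p' hp' => ?_⟩
  · rw [← Ideal.algebraMap_residueField_eq_zero, RingHom.map_det]
    change ¬ ((M * W).map (algebraMap R p.asIdeal.ResidueField)).det = 0
    rw [hMW, Matrix.det_smul, Matrix.det_one, mul_one]
    apply pow_ne_zero
    rwa [Ne, Ideal.algebraMap_residueField_eq_zero]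
  · have hdet : ((M * W).map (algebraMap R p'.asIdeal.ResidueField)).det ≠ 0 := by
      rw [← Ideal.algebraMap_residueField_eq_zero, RingHom.map_det] at hp'
      exact hp' 
    rw [Matrix.map_mul] at hdet
    have h1 : (M.map (algebraMap R p'.asIdeal.ResidueField)).rank = Fintype.card b := by
      have h2 := Matrix.rank_of_isUnit _ ((Matrix.isUnit_iff_isUnit_det _).2 hdet.isUnit)
      have h3 := Matrix.rank_mul_le_left (M.map (algebraMap R p'.asIdeal.ResidueField))
        (W.map (algebraMap R p'.asIdeal.ResidueField))
      have h4 := Matrix.rank_le_card_height (M.map (algebraMap R p'.asIdeal.ResidueField))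
      omega
    rw [hrk, ← h1, Matrix.rank_eq_finrank_span_row]
    apply Submodule.finrank_mono
    apply Submodule.span_mono
    rintro _ ⟨x, rfl⟩
    exact ⟨v x, hv x, rfl⟩

lemma finite_minimal_closed [IsNoetherianRing R] (Z : Set (PrimeSpectrum R)) (hZ : IsClosed Z) :
    {p | Minimal (· ∈ Z) p}.Finite := by
  obtain ⟨I, rfl⟩ := (PrimeSpectrum.isClosed_iff_zeroLocus_ideal Z).1 hZ
  have := Ideal.finite_minimalPrimes_of_isNoetherianRing R I
  refine Set.Finite.of_finite_image (f := PrimeSpectrum.asIdeal) (this.subset ?_) ?_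
  · rintro _ ⟨p, hp, rfl⟩
    refine ⟨⟨p.2, by simpa using hp.1⟩, fun q hq hqp => ?_⟩
    exact hp.2 (y := ⟨q, hq.1⟩) (by simpa using hq.2) hqp
  · intro a _ b _ h
    exact PrimeSpectrum.ext h

lemma isClosed_rk_le [Fintype ι] (s : Set (ι → R)) (ρ : ℕ) :
    IsClosed {p : PrimeSpectrum R | rk p s ≤ ρ} := by
  rw [← isOpen_compl_iff, isOpen_iff_forall_mem_open]
  intro p hp
  obtain ⟨d, hd, h⟩ := rk_open p s
  refine ⟨PrimeSpectrum.basicOpen d, fun p' hp' => ?_, (PrimeSpectrum.basicOpen d).2, hd⟩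
  simp only [Set.mem_compl_iff, Set.mem_ofPred_eq, not_le] at hp ⊢
  exact hp.trans_le (h p' hp')

lemma rk_generize [Fintype ι] (s : Set (ι → R)) {p p' : PrimeSpectrum R} (h : p' ≤ p) :
    rk p s ≤ rk p' s := by
  obtain ⟨d, hd, h1⟩ := rk_open p s
  exact h1 p' fun h2 => hd (h h2)

lemma sp_insert (p : PrimeSpectrum R) (v : ι → R) (s : Set (ι → R)) :
    sp p (insert v s) = Submodule.span _ {rv p v} ⊔ sp p s := by
  rw [sp, Set.image_insert_eq, Submodule.span_insert, sp]

lemma sp_insert_of_mem (p : PrimeSpectrum R) {v : ι → R} {s : Set (ι → R)} (h : rv p v ∈ sp p s) :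
    sp p (insert v s) = sp p s := by
  rw [sp_insert, sup_eq_right, Submodule.span_singleton_le_iff_mem]; exact h

lemma rk_insert_le [Fintype ι] (p : PrimeSpectrum R) (v : ι → R) (s : Set (ι → R)) :
    rk p (insert v s) ≤ rk p s + 1 := by
  rw [rk, sp_insert, rk, add_comm]
  refine (Submodule.finrank_add_le_finrank_add_finrank _ _).trans ?_
  gcongr
  refine (finrank_span_le_card _).trans ?_
  simp

lemma mem_sp_of_rk [Fintype ι] (p : PrimeSpectrum R) (v : ι → R) (s : Set (ι → R))
    (h : rk p (insert v s) ≤ rk p s) : rv p v ∈ sp p s := by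
  have : sp p s = sp p (insert v s) :=
    Submodule.eq_of_le_of_finrank_le (Submodule.span_mono (Set.image_mono (Set.subset_insert _ _))) h
  rw [this]
  exact Submodule.subset_span ⟨v, by simp, rfl⟩

lemma avoid (𝔟 : Ideal R) (S : Finset (PrimeSpectrum R)) (hS : ∀ p ∈ S, ¬ 𝔟 ≤ p.asIdeal)
    (Bad : PrimeSpectrum R → R → Prop)
    (hinv : ∀ p ∈ S, ∀ b b', b - b' ∈ p.asIdeal → Bad p b → Bad p b')
    (hBad : ∀ p ∈ S, ∀ b b', Bad p b → Bad p b' → b - b' ∈ p.asIdeal) :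
    ∃ b ∈ 𝔟, ∀ p ∈ S, ¬ Bad p b := by
  classical
  induction S using Finset.strongInduction with
  | H S ih =>
    rcases S.eq_empty_or_nonempty with rfl | hne
    · exact ⟨0, 𝔟.zero_mem, by simp⟩
    obtain ⟨p, hp⟩ := S.exists_minimal hne
    have hpS := hp.1
    have hsub : S.erase p ⊆ S := Finset.erase_subset _ _
    obtain ⟨b, hb, h⟩ := ih (S.erase p) (Finset.erase_ssubset hpS) (fun q hq => hS q (hsub hq))
      (fun q hq => hinv q (hsub hq)) (fun q hq => hBad q (hsub hq))
    by_cases hbad : Bad p b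
    · have : ¬ 𝔟 * ∏ q ∈ S.erase p, q.asIdeal ≤ p.asIdeal := by
        rw [p.2.mul_le, p.2.prod_le]
        rintro (h1 | ⟨q, hq, h1⟩)
        · exact hS p hpS h1
        · have := hp.2 (hsub hq) h1
          exact (Finset.mem_erase.1 hq).1 (le_antisymm h1 this)
      obtain ⟨s, hs, hsp⟩ := SetLike.not_le_iff_exists.1 this
      have hs1 : s ∈ 𝔟 := (Ideal.mul_le_left : 𝔟 * _ ≤ 𝔟) hs
      have hs2 : ∀ q ∈ S.erase p, s ∈ q.asIdeal := by
        intro q hq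
        have h1 : ∏ q ∈ S.erase p, q.asIdeal ≤ q.asIdeal := by
          rw [← Finset.mul_prod_erase _ _ hq]
          exact Ideal.mul_le_left
        exact h1 ((Ideal.mul_le_right : 𝔟 * (∏ q ∈ S.erase p, q.asIdeal) ≤ _) hs)
      refine ⟨b + s, 𝔟.add_mem hb hs1, fun q hq hbq => ?_⟩
      by_cases hqp : q = p
      · subst hqp
        have := hBad q hq _ _ hbq hbad
        rw [add_sub_cancel_left] at this
        exact hsp this
      · have hq' := Finset.mem_erase.2 ⟨hqp, hq⟩
        exact h q hq' (hinv q hq _ _ (by simpa using hs2 q hq') hbq)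
    · refine ⟨b, hb, fun q hq => ?_⟩
      by_cases hqp : q = p
      · subst hqp; exact hbad
      · exact h q (Finset.mem_erase.2 ⟨hqp, hq⟩)

lemma EE_step [IsNoetherianRing R] [Fintype ι] (𝔟 : Ideal R) (r : ℕ) (t v : ι → R)
    (s : Set (ι → R))
    (H : ∀ p : PrimeSpectrum R, ¬ 𝔟 ≤ p.asIdeal → rv p t ∈ sp p (insert v s) →
      (r : ℕ∞) ≤ rk p (insert v s) + p.asIdeal.height) :
    ∃ b ∈ 𝔟, ∀ p : PrimeSpectrum R, ¬ 𝔟 ≤ p.asIdeal → rv p (t + b • v) ∈ sp p s →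
      (r : ℕ∞) ≤ rk p s + p.asIdeal.height := by
  classical
  let S : Set (PrimeSpectrum R) := {p | ¬ 𝔟 ≤ p.asIdeal ∧ rv p t ∈ sp p (insert v s) ∧
    (rk p (insert v s) : ℕ∞) + p.asIdeal.height = r}
  have hfin : S.Finite := by
    have : S ⊆ ⋃ ρ ∈ Finset.range (r + 1),
        {p | Minimal (· ∈ {p : PrimeSpectrum R | rk p (insert t (insert v s)) ≤ ρ}) p} := by
      rintro p ⟨h1, h2, h3⟩
      simp only [Set.mem_iUnion]
      refine ⟨rk p (insert v s), ?_, ?_, ?_⟩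
      · rw [Finset.mem_range, Nat.lt_succ_iff, ← Nat.cast_le (α := ℕ∞), ← h3]
        exact le_self_add
      · show rk p _ ≤ rk p _
        rw [rk, sp_insert_of_mem p h2, rk]
      · intro p' hp' hle
        by_contra hcon
        have hlt : p'.asIdeal < p.asIdeal := lt_of_le_not_ge hle hcon
        have h4 : rk p' (insert t (insert v s)) ≤ rk p (insert v s) := hp'
        have h5 := rk_generize (insert v s) hle
        have h6 := H p' (fun h => h1 (h.trans hle)) (mem_sp_of_rk p' t _ (h4.trans h5))
        have h7 : rk p' (insert v s) ≤ rk p (insert v s) :=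
          (rk_mono p' (Set.subset_insert _ _)).trans h4
        have h8 := Ideal.height_strict_mono_of_isPrime_of_isPrime hlt
        have h9 : (rk p (insert v s) : ℕ∞) + p.asIdeal.height ≤
            rk p (insert v s) + p'.asIdeal.height := by
          rw [h3]; refine h6.trans ?_; gcongr
        have h10 := (ENat.add_le_add_iff_left (ENat.natCast_ne_top _)).1 h9
        exact absurd h8 (not_lt.2 h10)
    refine Set.Finite.subset (Set.Finite.biUnion (Finset.finite_toSet _) fun ρ _ => ?_) this
    exact finite_minimal_closed _ (isClosed_rk_le _ _)
  obtain ⟨b, hb, h⟩ := avoid 𝔟 hfin.toFinset (fun p hp => ((hfin.mem_toFinset).1 hp).1)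
    (fun p b => rv p v ∉ sp p s ∧ rv p (t + b • v) ∈ sp p s)
    (by
      rintro p - b b' hbb ⟨h1, h2⟩
      refine ⟨h1, ?_⟩
      have : algebraMap R p.asIdeal.ResidueField b = algebraMap R p.asIdeal.ResidueField b' := by
        rw [← sub_eq_zero, ← map_sub]
        exact Ideal.algebraMap_residueField_eq_zero.2 hbb
      rw [rv_add, rv_smul, ← this, ← rv_smul, ← rv_add]; exact h2)
    (by
      rintro p - b b' ⟨h1, h2⟩ ⟨-, h3⟩
      by_contra hcon
      apply h1
      have h4 := Submodule.sub_mem _ h2 h3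
      rw [rv_add, rv_add, add_sub_add_left_eq_sub, rv_smul, rv_smul, ← sub_smul, ← map_sub] at h4
      rw [← Ideal.algebraMap_residueField_eq_zero] at hcon
      exact (Submodule.smul_mem_iff _ hcon).1 h4)
  refine ⟨b, hb, fun p hp hmem => ?_⟩
  have htmem : rv p t ∈ sp p (insert v s) := by
    have h1 : sp p s ≤ sp p (insert v s) :=
      Submodule.span_mono (Set.image_mono (Set.subset_insert _ _))
    have h2 : rv p v ∈ sp p (insert v s) := Submodule.subset_span ⟨v, by simp, rfl⟩
    have h3 := Submodule.sub_mem _ (h1 hmem) (Submodule.smul_mem _ (algebraMap R _ b) h2)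
    rwa [rv_add, rv_smul, add_sub_cancel_right] at h3
  have hr := H p hp htmem
  by_cases hv : rv p v ∈ sp p s
  · rw [rk, sp_insert_of_mem p hv] at hr
    exact hr
  by_cases hpS : p ∈ S
  · exact absurd ⟨hv, hmem⟩ (h p (hfin.mem_toFinset.2 hpS))
  · have h1 : (r : ℕ∞) < rk p (insert v s) + p.asIdeal.height :=
      lt_of_le_of_ne hr fun h => hpS ⟨hp, htmem, h.symm⟩
    have h2 := rk_insert_le p v s
    have h3 : (r : ℕ∞) + 1 ≤ rk p s + p.asIdeal.height + 1 := by
      refine (Order.add_one_le_of_lt h1).trans ?_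
      calc (rk p (insert v s) : ℕ∞) + p.asIdeal.height ≤ ((rk p s + 1 : ℕ) : ℕ∞) + p.asIdeal.height := by
            gcongr
        _ = _ := by push_cast; ring
    exact (ENat.add_le_add_iff_right ENat.one_ne_top).1 h3

lemma EE_iter [IsNoetherianRing R] [Fintype ι] (𝔟 : Ideal R) (r : ℕ) {κ : Type*} [DecidableEq κ]
    (ψ : κ → ι → R) (J : Finset κ) (t : ι → R)
    (H : ∀ p : PrimeSpectrum R, ¬ 𝔟 ≤ p.asIdeal → rv p t ∈ sp p (ψ '' J) →
      (r : ℕ∞) ≤ rk p (ψ '' J) + p.asIdeal.height) :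
    ∃ c : κ → R, (∀ j, c j ∈ 𝔟) ∧ ∀ p : PrimeSpectrum R, ¬ 𝔟 ≤ p.asIdeal →
      (∀ i, (t + ∑ j ∈ J, c j • ψ j) i ∈ p.asIdeal) → (r : ℕ∞) ≤ p.asIdeal.height := by
  induction J using Finset.induction generalizing t with
  | empty =>
    refine ⟨0, by simp, fun p hp h => ?_⟩
    have := H p hp (by
      have : rv p t = 0 := (rv_eq_zero p t).2 (by simpa using h)
      rw [this]; exact Submodule.zero_mem _)
    have h0 : rk p (ψ '' ((∅ : Finset κ) : Set κ)) = 0 := by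
      rw [Finset.coe_empty, Set.image_empty, rk, sp, Set.image_empty, Submodule.span_empty,
        finrank_bot]
    rw [h0] at this
    simpa using this
  | insert a J ha ih =>
    rw [Finset.coe_insert, Set.image_insert_eq] at H
    obtain ⟨b, hb, h⟩ := EE_step 𝔟 r t (ψ a) _ H
    obtain ⟨c, hc, h'⟩ := ih (t + b • ψ a) h
    refine ⟨Function.update c a b, fun j => ?_, fun p hp hm => h' p hp ?_⟩
    · by_cases hj : j = a
      · subst hj; simpa using hb
      · simpa [hj] using hc j
    · have : ∑ j ∈ J, Function.update c a b j • ψ j = ∑ j ∈ J, c j • ψ j := by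
        refine Finset.sum_congr rfl fun j hj => ?_
        rw [Function.update_of_ne (ne_of_mem_of_not_mem hj ha)]
      rw [Finset.sum_insert ha, this, Function.update_self, ← add_assoc] at hm
      exact hm

/-- rank condition at all primes, friendly to base change -/
def RankCond [Fintype ι] [DecidableEq ι] (e : Matrix ι ι R) (r : ℕ) : Prop :=
  ∀ p : PrimeSpectrum R, ∃ (U : Matrix (Fin r) ι R) (V : Matrix ι (Fin r) R),
    (U * e * V).det ∉ p.asIdeal

lemma RankCond.map [Fintype ι] [DecidableEq ι] {e : Matrix ι ι R} {r : ℕ} (h : RankCond e r)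
    {R' : Type*} [CommRing R'] (f : R →+* R') : RankCond (e.map f) r := by
  intro p
  obtain ⟨U, V, h⟩ := h (PrimeSpectrum.comap f p)
  refine ⟨U.map f, V.map f, fun h1 => h ?_⟩
  rw [← Matrix.map_mul, ← Matrix.map_mul] at h1
  rw [PrimeSpectrum.comap_asIdeal, Ideal.mem_comap, RingHom.map_det]
  exact h1

theorem EE [IsNoetherianRing R] [Fintype ι] [DecidableEq ι] (e : Matrix ι ι R) (r : ℕ)
    (he : RankCond e r) (x : ι → R) (𝔟 : Ideal R) :
    ∃ c : ι → R, (∀ j, c j ∈ 𝔟) ∧ ∀ p : PrimeSpectrum R, ¬ 𝔟 ≤ p.asIdeal →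
      (∀ i, (x + Matrix.vecMul c e) i ∈ p.asIdeal) → (r : ℕ∞) ≤ p.asIdeal.height := by
  obtain ⟨c, hc, h⟩ := EE_iter 𝔟 r (fun j => e j) Finset.univ x (by
    intro p _ _
    have : r ≤ rk p ((fun j => e j) '' (Finset.univ : Finset ι)) := by
      obtain ⟨U, V, hUV⟩ := he p
      rw [← Ideal.algebraMap_residueField_eq_zero, RingHom.map_det] at hUV
      have h2 := Matrix.rank_of_isUnit _ ((Matrix.isUnit_iff_isUnit_det _).2 (Ne.isUnit hUV))
      rw [RingHom.mapMatrix_apply, Matrix.map_mul, Matrix.map_mul, Fintype.card_fin] at h2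
      have h3 := (Matrix.rank_mul_le_left _ _).trans_eq' h2
      have h4 := (Matrix.rank_mul_le_right _ _).trans' h3
      refine h4.trans ?_
      rw [Matrix.rank_eq_finrank_span_row]
      apply Submodule.finrank_mono
      apply Submodule.span_mono
      rintro _ ⟨x, rfl⟩
      exact ⟨e x, ⟨x, by simp, rfl⟩, rfl⟩
    calc (r : ℕ∞) ≤ _ := Nat.cast_le.2 this
      _ ≤ _ := le_self_add)
  refine ⟨c, hc, fun p hp hm => h p hp fun i => ?_⟩
  have := hm i
  rw [Matrix.vecMul_eq_sum] at this
  exact this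
end
end LiftAT
end file1

section file2
namespace LiftAT

lemma dim_le_of_integral {A S D : Type*} [CommRing A] [CommRing S] [CommRing D] [Algebra A S]
    [Algebra A D] [Algebra.IsIntegral A S] [Algebra.IsIntegral A D]
    (h : ∀ a : A, algebraMap A S a = 0 → algebraMap A D a = 0) :
    ringKrullDim D ≤ ringKrullDim S := by
  refine iSup_le fun l => ?_
  let l' : LTSeries (PrimeSpectrum A) := l.map (PrimeSpectrum.comap (algebraMap A D))
    (fun p q hpq => by
      exact Ideal.IsIntegral.comap_lt_comap (R := A) (I := p.asIdeal) (J := q.asIdeal) hpq)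
  obtain ⟨Q, -, hQ, hQ'⟩ := Ideal.exists_ideal_over_prime_of_isIntegral (S := S)
    l'.head.asIdeal (⊥ : Ideal S) (by
      intro a ha
      have : algebraMap A S a = 0 := by simpa using ha
      have h2 := h a this
      show algebraMap A D a ∈ l.head.asIdeal
      rw [h2]; exact zero_mem _)
  have : Q.LiesOver l'.head.asIdeal := ⟨hQ'.symm⟩
  obtain ⟨L, hL, -⟩ := Ideal.exists_ltSeries_of_hasGoingUp l' Q
  refine le_iSup_of_le L ?_
  rw [hL]; rfl

lemma dim_quot_le {B : Type*} [CommRing B] (J : Ideal B) (δ m : ℕ)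
    (hδ : ringKrullDim B ≤ δ)
    (h : ∀ Q : Ideal B, Q.IsPrime → J ≤ Q → (δ : ℕ∞) ≤ m + Q.height) :
    ringKrullDim (B ⧸ J) ≤ m := by
  refine iSup_le fun l => ?_
  let l' : LTSeries (PrimeSpectrum B) := l.map (PrimeSpectrum.comap (Ideal.Quotient.mk J))
    (fun p q hpq => by
      refine lt_of_le_of_ne (Ideal.comap_mono hpq.le) fun heq => hpq.ne ?_
      exact PrimeSpectrum.comap_injective_of_surjective _ Ideal.Quotient.mk_surjective heq)
  have hne : Nonempty (PrimeSpectrum B) := ⟨l'.head⟩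
  have h1 : (Order.height l'.head + Order.coheight l'.head : ℕ∞) ≤ δ := by
    have h2 : ((Order.height l'.head + Order.coheight l'.head : ℕ∞) : WithBot ℕ∞)
        ≤ ringKrullDim B := by
      rw [ringKrullDim, Order.krullDim_eq_iSup_height_add_coheight_of_nonempty]
      exact WithBot.coe_le_coe.2 (le_iSup (fun a : PrimeSpectrum B =>
        Order.height a + Order.coheight a) l'.head)
    exact WithBot.coe_le_coe.1 (h2.trans hδ)
  have h3 : (l.length : ℕ∞) ≤ Order.coheight l'.head :=
    Order.length_le_coheight_head (p := l')
  have h4 := h l'.head.asIdeal l'.head.2 (by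
    intro b hb
    show Ideal.Quotient.mk J b ∈ l.head.asIdeal
    rw [Ideal.Quotient.eq_zero_iff_mem.2 hb]; exact zero_mem _)
  rw [PrimeSpectrum.height_eq_orderHeight] at h4
  have h5 : (l.length : ℕ∞) ≤ m := by
    generalize Order.height l'.head = a at *
    generalize Order.coheight l'.head = b at *
    have : a ≠ ⊤ := by rintro rfl; simp at h1
    have hb : b ≠ ⊤ := by rintro rfl; simp at h1
    lift a to ℕ using this
    lift b to ℕ using hb
    norm_cast at *
    omega
  exact_mod_cast h5

lemma nak {R : Type*} [CommRing R] (I : Ideal R) (v u : Ideal R) (hv : v.FG)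
    (h : v ≤ u ⊔ I * v) : ∃ s : R, s - 1 ∈ I ∧ ∀ b ∈ v, s * b ∈ u := by
  obtain ⟨s, hs, h'⟩ := Submodule.exists_sub_one_mem_and_smul_le_of_fg_of_le_sup
    (I := I) (N := u) (N' := v) (P := v) hv le_rfl h
  exact ⟨s, hs, fun b hb => h' (Submodule.smul_mem_pointwise_smul b s v hb)⟩
end LiftAT
end file2

section file3
open scoped TensorProduct
namespace LiftAT

lemma rankCond_of_rank {A Q : Type*} [CommRing A] [AddCommGroup Q] [Module A Q] [Module.Finite A Q]
    [Module.Projective A Q] {N r : ℕ} (π : (Fin N → A) →ₗ[A] Q) (σ : Q →ₗ[A] (Fin N → A))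
    (h : π ∘ₗ σ = LinearMap.id) (hr : ∀ p : PrimeSpectrum A, Module.rankAtStalk Q p = r) :
    RankCond (LinearMap.toMatrix' (σ ∘ₗ π)) r := by
  intro p
  let K := p.asIdeal.ResidueField
  have hfin : Module.finrank K (TensorProduct A K Q) = r := by
    rw [← hr p]
    exact Ideal.finrank_fiber_eq_rankAtStalk (M := Q) p.asIdeal
  let c : Module.Basis (Fin r) K (TensorProduct A K Q) := Module.finBasisOfFinrankEq K _ hfin
  let b := Algebra.TensorProduct.basis K (Pi.basisFun A (Fin N))
  let U := LinearMap.toMatrix b c (π.baseChange K)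
  let V := LinearMap.toMatrix c b (σ.baseChange K)
  have hUV : U * (LinearMap.toMatrix' (σ ∘ₗ π)).map (algebraMap A K) * V = 1 := by
    have h1 : (LinearMap.toMatrix' (σ ∘ₗ π)).map (algebraMap A K)
        = LinearMap.toMatrix b b ((σ ∘ₗ π).baseChange K) := by
      rw [LinearMap.toMatrix_baseChange]
      rfl
    rw [h1]
    simp only [U, V]
    rw [← LinearMap.toMatrix_comp, ← LinearMap.toMatrix_comp, ← LinearMap.baseChange_comp,
      ← LinearMap.baseChange_comp]
    have : (π ∘ₗ σ ∘ₗ π) ∘ₗ σ = LinearMap.id := by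
      rw [LinearMap.comp_assoc, LinearMap.comp_assoc, h, LinearMap.comp_id, h]
    rw [this, LinearMap.baseChange_id, LinearMap.toMatrix_id]
  obtain ⟨d, g, hd, hg⟩ := exists_num p (fun k : Fin r × Fin N => U k.1 k.2)
  obtain ⟨d', g', hd', hg'⟩ := exists_num p (fun k : Fin N × Fin r => V k.1 k.2)
  refine ⟨Matrix.of fun i j => g (i, j), Matrix.of fun i j => g' (i, j), ?_⟩
  rw [← Ideal.algebraMap_residueField_eq_zero, RingHom.map_det, RingHom.mapMatrix_apply,
    Matrix.map_mul, Matrix.map_mul]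
  have e1 : (Matrix.of fun i j => g (i, j)).map (algebraMap A K) = (algebraMap A K d) • U := by
    ext i j; simpa using hg (i, j)
  have e2 : (Matrix.of fun i j => g' (i, j)).map (algebraMap A K) = (algebraMap A K d') • V := by
    ext i j; simpa using hg' (i, j)
  rw [e1, e2, Matrix.smul_mul, Matrix.smul_mul, Matrix.mul_smul, hUV, Matrix.det_smul,
    Matrix.det_smul, Matrix.det_one, mul_one]
  rw [← Ideal.algebraMap_residueField_eq_zero] at hd hd'
  exact mul_ne_zero (pow_ne_zero _ hd) (pow_ne_zero _ hd')

lemma serre {A : Type*} [CommRing A] [IsNoetherianRing A] {N r : ℕ}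
    (e : Matrix (Fin N) (Fin N) A) (he : e * e = e) (hr : RankCond e r)
    (hdim : ringKrullDim (A ⧸ (Ideal.jacobson (⊥ : Ideal A))) < r) :
    ∃ ψ p : Fin N → A, Matrix.vecMul ψ e = ψ ∧ Matrix.mulVec e p = p ∧ dotProduct ψ p = 1 := by
  let 𝒥 := Ideal.jacobson (⊥ : Ideal A)
  let mk := Ideal.Quotient.mk 𝒥
  obtain ⟨c, -, hc⟩ := EE (e.map mk) r (hr.map mk) 0 ⊤
  choose c' hc' using fun i => Ideal.Quotient.mk_surjective (c i)
  let ψ := Matrix.vecMul c' e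
  have hψ : Ideal.span (Set.range ψ) = ⊤ := by
    have h1 : Ideal.span (Set.range ψ) ⊔ 𝒥 = ⊤ := by
      by_contra hne
      obtain ⟨m, hm, hle⟩ := Ideal.exists_le_maximal _ hne
      have hJm : 𝒥 ≤ m := le_sup_right.trans hle
      have hmp : (m.map mk).IsPrime :=
        Ideal.map_isPrime_of_surjective Ideal.Quotient.mk_surjective (by simpa [mk] using hJm)
      have := hc ⟨m.map mk, hmp⟩ (fun h => hmp.ne_top (top_le_iff.1 h)) (by
        intro i
        have h2 : (0 + Matrix.vecMul c (e.map mk)) i = mk (ψ i) := by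
          have : c = mk ∘ c' := by ext i; exact (hc' i).symm
          rw [zero_add, this, RingHom.map_vecMul]
        rw [h2]
        exact Ideal.mem_map_of_mem _ (hle (le_sup_left (a := Ideal.span (Set.range ψ))
          (Ideal.subset_span ⟨i, rfl⟩))))
      have h3 := Ideal.height_le_ringKrullDim_of_isPrime (I := m.map mk)
      have h4 : ((r : ℕ∞) : WithBot ℕ∞) ≤ _ := (WithBot.coe_le_coe.2 this).trans h3
      exact absurd hdim (not_lt.2 h4)
    by_contra hne
    obtain ⟨m, hm, hle⟩ := Ideal.exists_le_maximal _ hne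
    have : 𝒥 ≤ m := sInf_le ⟨bot_le, hm⟩
    exact hm.ne_top (top_le_iff.1 (h1 ▸ sup_le hle this))
  have h1 : (1 : A) ∈ Ideal.span (Set.range ψ) := hψ ▸ Submodule.mem_top
  obtain ⟨p, hp⟩ := (Submodule.mem_span_range_iff_exists_fun A).1 h1
  have hψe : Matrix.vecMul ψ e = ψ := by
    simp only [ψ]; rw [Matrix.vecMul_vecMul, he]
  refine ⟨ψ, Matrix.mulVec e p, hψe, by rw [Matrix.mulVec_mulVec, he], ?_⟩
  rw [Matrix.dotProduct_mulVec, hψe, ← hp]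
  simp [dotProduct, mul_comm]

/-- presentation of a f.g. projective module -/
lemma exists_pres (A Q : Type*) [CommRing A] [AddCommGroup Q] [Module A Q] [Module.Finite A Q]
    [Module.Projective A Q] : ∃ (N : ℕ) (π : (Fin N → A) →ₗ[A] Q) (σ : Q →ₗ[A] (Fin N → A)),
      π ∘ₗ σ = LinearMap.id := by
  obtain ⟨N, π, hπ⟩ := Module.Finite.exists_fin' A Q
  obtain ⟨σ, hσ⟩ := Module.projective_lifting_property π LinearMap.id hπ
  exact ⟨N, π, σ, hσ⟩

lemma toMatrix_idem {A Q : Type*} [CommRing A] [AddCommGroup Q] [Module A Q] {N : ℕ}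
    (π : (Fin N → A) →ₗ[A] Q) (σ : Q →ₗ[A] (Fin N → A))
    (h : π ∘ₗ σ = LinearMap.id) :
    LinearMap.toMatrix' (σ ∘ₗ π) * LinearMap.toMatrix' (σ ∘ₗ π) = LinearMap.toMatrix' (σ ∘ₗ π) := by
  rw [← LinearMap.toMatrix'_comp]
  congr 1
  rw [LinearMap.comp_assoc, ← LinearMap.comp_assoc π, h, LinearMap.id_comp]

lemma split_free {A P : Type*} [CommRing A] [IsNoetherianRing A] [AddCommGroup P] [Module A P]
    [Module.Finite A P] [Module.Projective A P] {r : ℕ}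
    (hr : ∀ p : PrimeSpectrum A, Module.rankAtStalk P p = r + 1)
    (hdim : ringKrullDim (A ⧸ (Ideal.jacobson (⊥ : Ideal A))) < (r + 1 : ℕ)) :
    ∃ Q : Submodule A P, Module.Finite A Q ∧ Module.Projective A Q ∧
      Nonempty (P ≃ₗ[A] Q × A) ∧ ∀ p : PrimeSpectrum A, Module.rankAtStalk Q p = r := by
  obtain ⟨N, π, σ, h⟩ := exists_pres A P
  obtain ⟨ψ, p, hψ, hp, hψp⟩ := serre _ (toMatrix_idem π σ h) (rankCond_of_rank π σ h hr) hdim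
  let f : P →ₗ[A] A := (Matrix.vecMulLinear (Matrix.of (fun i (_ : Unit) => ψ i))).comp σ |>
    (LinearMap.proj ()).comp
  have hf : f (π p) = 1 := by
    rw [← hψp]
    have : σ (π p) = p := by
      conv_rhs => rw [← hp]
      rw [LinearMap.toMatrix'_mulVec]; rfl
    simp [f, this, Matrix.vecMul, dotProduct, mul_comm]
  let Q := LinearMap.ker f
  obtain ⟨g, hg⟩ : ∃ g : P →ₗ[A] Q, ∀ y, (g y : P) = y - f y • π p :=
    ⟨LinearMap.codRestrict Q (LinearMap.id - f.smulRight (π p)) (by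
      intro y; simp [Q, hf]), fun _ => rfl⟩
  let E : P ≃ₗ[A] Q × A := LinearEquiv.ofLinearMap
    (LinearMap.prod g f)
    (LinearMap.coprod Q.subtype (LinearMap.toSpanSingleton A P (π p)))
    (by
      apply LinearMap.ext
      rintro ⟨⟨y, hy⟩, a⟩
      have hy : f y = 0 := hy
      ext <;> simp [hg, hy, hf])
    (by ext y; simp [hg])
  have hfin : Module.Finite A Q := inferInstance
  have hproj : Module.Projective A Q := Module.Projective.of_split
    (Q.subtype) ((LinearMap.fst A Q A) ∘ₗ E.toLinearMap) (by
      apply LinearMap.ext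
      rintro ⟨y, hy⟩
      have hy : f y = 0 := hy
      ext; simp [E, hg, hy])
  refine ⟨Q, hfin, hproj, ⟨E⟩, fun q => ?_⟩
  have h1 := hr q
  have : Nontrivial A := by
    by_contra hh
    rw [not_nontrivial_iff_subsingleton] at hh
    exact q.2.ne_top (Subsingleton.elim _ _)
  rw [Module.rankAtStalk_eq_of_equiv E, Module.rankAtStalk_prod, Pi.add_apply,
    Module.rankAtStalk_self] at h1
  simpa using h1

/-- Krull's height theorem for sections of `P[T]` -/
lemma height_le_rank {A P : Type*} [CommRing A] [IsNoetherianRing A] [AddCommGroup P] [Module A P]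
    [Module.Finite A P] [Module.Projective A P] {n : ℕ}
    (hr : ∀ p : PrimeSpectrum A, Module.rankAtStalk P p = n)
    (I : Ideal A[X]) (φ : TensorProduct A A[X] P →ₗ[A[X]] A[X])
    (hφ : LinearMap.range φ ≤ I) (hsurj : LinearMap.range φ ⊔ I ^ 2 = I)
    (Q : Ideal A[X]) (hQ : Q ∈ I.minimalPrimes) : Q.height ≤ n := by
  classical
  have hQp : Q.IsPrime := hQ.1.1
  let p : PrimeSpectrum A := PrimeSpectrum.comap C ⟨Q, hQp⟩
  let S := p.asIdeal.primeCompl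
  have hfree : Module.Free (Localization.AtPrime p.asIdeal) (LocalizedModule S P) :=
    Module.free_of_flat_of_isLocalRing
  let b : Module.Basis (Fin n) (Localization.AtPrime p.asIdeal) (LocalizedModule S P) :=
    Module.finBasisOfFinrankEq _ _ (hr p)
  have hx : ∀ j, ∃ (x : P) (s : S), LocalizedModule.mk x s = b j := fun j => by
    induction b j using LocalizedModule.induction_on with
    | h x s => exact ⟨x, s, rfl⟩
  choose x s hxs using hx
  have key : ∀ y : P, ∃ c ∉ p.asIdeal, c • y ∈ Submodule.span A (Set.range x) := by
    intro y
    have h1 : LocalizedModule.mkLinearMap S P y ∈ Submodule.localized' (Localization.AtPrime p.asIdeal)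
        S (LocalizedModule.mkLinearMap S P) (Submodule.span A (Set.range x)) := by
      have h2 : (⊤ : Submodule (Localization.AtPrime p.asIdeal) (LocalizedModule S P)) ≤
          Submodule.localized' (Localization.AtPrime p.asIdeal)
        S (LocalizedModule.mkLinearMap S P) (Submodule.span A (Set.range x)) := by
        rw [← b.span_eq, Submodule.span_le]
        rintro _ ⟨j, rfl⟩
        refine (Submodule.mem_localized' _ _ _ _ _).2 ⟨x j, Submodule.subset_span ⟨j, rfl⟩, s j, ?_⟩
        rw [← hxs j]; exact IsLocalizedModule.mk_eq_mk' (s j) (x j) |>.symm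
      exact h2 trivial
    obtain ⟨m, hm, t, ht⟩ := (Submodule.mem_localized' _ _ _ _ _).1 h1
    rw [IsLocalizedModule.mk'_eq_iff, Submonoid.smul_def, ← map_smul] at ht
    obtain ⟨c, hc⟩ := (IsLocalizedModule.eq_iff_exists S (LocalizedModule.mkLinearMap S P)).1 ht
    refine ⟨c * t, (c * t).2, ?_⟩
    rw [mul_smul]
    have hc' : (c : A) • m = (c : A) • (t : A) • y := hc
    rw [← hc']
    exact Submodule.smul_mem _ _ hm
  let F : Finset A[X] := Finset.univ.image fun j => φ (1 ⊗ₜ x j)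
  have hF : F.card ≤ n := by
    refine Finset.card_image_le.trans ?_
    simp
  refine (Ideal.height_le_card_of_mem_minimalPrimes_span_finset (s := F) ?_).trans
    (by exact_mod_cast hF)
  refine ⟨⟨hQp, ?_⟩, ?_⟩
  · rw [Ideal.span_le]
    intro z hz
    obtain ⟨j, -, rfl⟩ := Finset.mem_image.1 (Finset.mem_coe.1 hz)
    exact hQ.1.2 (hφ ⟨_, rfl⟩)
  · rintro Q' ⟨hQ'p, hQ'⟩ hle
    apply hQ.2 ⟨hQ'p, ?_⟩ hle
    have hrange : LinearMap.range φ ≤ Q' := by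
      rintro _ ⟨w, rfl⟩
      induction w using TensorProduct.induction_on with
      | zero => simp
      | add a b ha hb => rw [map_add]; exact Q'.add_mem ha hb
      | tmul f y =>
        have e1 : f ⊗ₜ[A] y = f • ((1 : A[X]) ⊗ₜ[A] y) := by simp [TensorProduct.smul_tmul']
        rw [e1, map_smul]
        apply Q'.mul_mem_left
        obtain ⟨c, hc, hcy⟩ := key y
        have h3 : ∀ z ∈ Submodule.span A (Set.range x), φ (1 ⊗ₜ z) ∈ Q' := by
          intro z hz
          induction hz using Submodule.span_induction with
          | mem z hz =>
            obtain ⟨j, rfl⟩ := hz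
            exact hQ' (Ideal.subset_span (Finset.mem_coe.2 (Finset.mem_image.2 ⟨j, by simp, rfl⟩)))
          | zero => simp
          | add a b _ _ ha hb => rw [TensorProduct.tmul_add, map_add]; exact Q'.add_mem ha hb
          | smul a z _ hz =>
            have e2 : (1 : A[X]) ⊗ₜ[A] (a • z) = (C a) • ((1 : A[X]) ⊗ₜ[A] z) := by
              rw [TensorProduct.tmul_smul, TensorProduct.smul_tmul', TensorProduct.smul_tmul',
                Algebra.smul_def, smul_eq_mul]; rfl
            rw [e2, map_smul]
            exact Q'.mul_mem_left _ hz
        have h4 := h3 _ hcy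
        have e2 : (1 : A[X]) ⊗ₜ[A] (c • y) = (C c) • ((1 : A[X]) ⊗ₜ[A] y) := by
          rw [TensorProduct.tmul_smul, TensorProduct.smul_tmul', TensorProduct.smul_tmul',
            Algebra.smul_def, smul_eq_mul]; rfl
        rw [e2, map_smul] at h4
        exact (hQ'p.mem_or_mem h4).resolve_left fun h5 => hc (hle h5)
    obtain ⟨a, ha, haI⟩ := nak I I (LinearMap.range φ) ((isNoetherianRing_iff_ideal_fg _).1 inferInstance I)
      (by rw [← pow_two]; exact hsurj.ge)
    intro i hi
    refine (hQ'p.mem_or_mem (hrange (haI i hi))).resolve_left fun h6 => ?_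
    have h7 : a - 1 ∈ Q := hQ.1.2 ha
    have h8 := Q.sub_mem (hle h6) h7
    rw [sub_sub_cancel] at h8
    exact hQp.ne_top ((Ideal.eq_top_iff_one _).2 h8)
end LiftAT
end file3

section file4
open scoped LaurentPolynomial
namespace LiftAT

section general
variable {R : Type*} [CommRing R]

lemma unif (W : Submonoid R) (v u : Ideal R) (hv : v.FG) (h : ∀ b ∈ v, ∃ w ∈ W, w * b ∈ u) :
    ∃ w ∈ W, ∀ b ∈ v, w * b ∈ u := by
  classical
  obtain ⟨s, rfl⟩ := hv
  suffices H : ∀ t ⊆ s, ∃ w ∈ W, ∀ b ∈ t, w * b ∈ u by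
    obtain ⟨w, hw, hb⟩ := H s subset_rfl
    refine ⟨w, hw, fun b hb' => ?_⟩
    induction hb' using Submodule.span_induction with
    | mem x hx => exact hb x hx
    | zero => simp
    | add x y _ _ hx hy => rw [mul_add]; exact u.add_mem hx hy
    | smul a x _ hx => rw [smul_eq_mul, mul_left_comm]; exact u.mul_mem_left _ hx
  intro t
  induction t using Finset.induction with
  | empty => exact fun _ => ⟨1, W.one_mem, by simp⟩
  | insert a t ha ih =>
    intro hsub
    obtain ⟨w, hw, hb⟩ := ih ((Finset.subset_insert _ _).trans hsub)
    obtain ⟨w', hw', hb'⟩ := h a (Ideal.subset_span (hsub (Finset.mem_insert_self _ _)))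
    refine ⟨w * w', W.mul_mem hw hw', fun b hbt => ?_⟩
    rcases Finset.mem_insert.1 hbt with rfl | hbt
    · rw [mul_assoc]; exact u.mul_mem_left _ hb'
    · rw [mul_right_comm]; exact u.mul_mem_right _ (hb b hbt)

/-- saturation of an ideal -/
def sat (W : Submonoid R) (u : Ideal R) : Ideal R where
  carrier := {b | ∃ w ∈ W, w * b ∈ u}
  add_mem' := by
    rintro a b ⟨w, hw, ha⟩ ⟨w', hw', hb⟩
    refine ⟨w * w', W.mul_mem hw hw', ?_⟩
    rw [mul_add]
    refine u.add_mem ?_ ?_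
    · rw [mul_right_comm]; exact u.mul_mem_right _ ha
    · rw [mul_assoc]; exact u.mul_mem_left _ hb
  zero_mem' := ⟨1, W.one_mem, by simp⟩
  smul_mem' := by
    rintro c b ⟨w, hw, hb⟩
    exact ⟨w, hw, by rw [smul_eq_mul, mul_left_comm]; exact u.mul_mem_left _ hb⟩

lemma mem_sat {W : Submonoid R} {u : Ideal R} {b : R} : b ∈ sat W u ↔ ∃ w ∈ W, w * b ∈ u := Iff.rfl

/-- ideal generated by a row and one more element -/
def spn {ι : Type*} (q : ι → R) (h : R) : Ideal R := Ideal.span (insert h (Set.range q))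

variable {ι : Type*}

lemma spn_le {q : ι → R} {h : R} {J : Ideal R} : spn q h ≤ J ↔ (∀ i, q i ∈ J) ∧ h ∈ J := by
  rw [spn, Ideal.span_le, Set.insert_subset_iff, and_comm, Set.range_subset_iff]; rfl

lemma q_mem (q : ι → R) (h : R) (i : ι) : q i ∈ spn q h :=
  Ideal.subset_span (Set.mem_insert_of_mem _ ⟨i, rfl⟩)

lemma h_mem (q : ι → R) (h : R) : h ∈ spn q h := Ideal.subset_span (Set.mem_insert _ _)

lemma map_spn {R' : Type*} [CommRing R'] (f : R →+* R') (q : ι → R) (h : R) :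
    (spn q h).map f = spn (fun i => f (q i)) (f h) := by
  rw [spn, Ideal.map_span, Set.image_insert_eq, ← Set.range_comp]; rfl

/-- row condition -/
def Row [Fintype ι] (e : Matrix ι ι R) (q : ι → R) : Prop := Matrix.vecMul q e = q

variable [Fintype ι] {e : Matrix ι ι R} {q q' : ι → R}
lemma Row.add (h : Row e q) (h' : Row e q') : Row e (q + q') := by
  rw [Row, Matrix.add_vecMul, h, h']
lemma Row.smul (h : Row e q) (c : R) : Row e (c • q) := by
  rw [Row, Matrix.smul_vecMul, h]
lemma Row.sub (h : Row e q) (h' : Row e q') : Row e (q - q') := by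
  rw [Row, Matrix.sub_vecMul, h, h']
lemma Row.map (h : Row e q) {R' : Type*} [CommRing R'] (f : R →+* R') :
    Row (e.map f) (fun i => f (q i)) := by
  ext i
  have := congrArg f (congrFun h i)
  rw [RingHom.map_vecMul] at this
  exact this
lemma Row.of_map {R' : Type*} [CommRing R'] (f : R →+* R') (hf : Function.Injective f)
    (h : Row (e.map f) (fun i => f (q i))) : Row e q := by
  ext i
  apply hf
  rw [RingHom.map_vecMul]
  exact congrFun h i
lemma Row.vecMul (he : e * e = e) (c : ι → R) : Row e (Matrix.vecMul c e) := by
  rw [Row, Matrix.vecMul_vecMul, he]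
lemma vecMul_mem {J : Ideal R} {c : ι → R} (hc : ∀ j, c j ∈ J) (e : Matrix ι ι R) (i : ι) :
    Matrix.vecMul c e i ∈ J :=
  J.sum_mem fun j _ => J.mul_mem_right _ (hc j)
end general

section S
variable {A : Type*} [CommRing A]

/-- polynomials with constant coefficient one -/
def S1 (A : Type*) [CommRing A] : Submonoid A[X] where
  carrier := {s | s.coeff 0 = 1}
  mul_mem' := by
    intro a b ha hb
    simp only [Set.mem_ofPred_eq] at *
    rw [mul_coeff_zero, ha, hb, one_mul]
  one_mem' := by simp

lemma mem_S1 {s : A[X]} : s ∈ S1 A ↔ s.coeff 0 = 1 := Iff.rfl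

lemma mem_S1_iff {s : A[X]} : s ∈ S1 A ↔ s - 1 ∈ Ideal.span {(X : A[X])} := by
  rw [Ideal.mem_span_singleton, X_dvd_iff, coeff_sub, mem_S1]
  simp [sub_eq_zero]

lemma S1_exists {s : A[X]} (hs : s ∈ S1 A) : ∃ t, s = 1 + X * t := by
  rw [mem_S1_iff, Ideal.mem_span_singleton] at hs
  obtain ⟨t, ht⟩ := hs
  exact ⟨t, by rw [← ht]; ring⟩

lemma S1_inv {s : A[X]} (hs : s ∈ S1 A) (E : ℕ) : ∃ s' ρ, s' ∈ S1 A ∧ s * s' = 1 + X ^ E * ρ := by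
  obtain ⟨t, rfl⟩ := S1_exists hs
  rcases Nat.eq_zero_or_pos E with rfl | hE
  · exact ⟨1, X * t, (S1 A).one_mem, by ring⟩
  refine ⟨∑ i ∈ Finset.range E, (-(X * t)) ^ i, -(-t) ^ E, ?_, ?_⟩
  · rw [mem_S1, finsetSum_coeff, Finset.sum_eq_single 0]
    · simp
    · intro b _ hb
      rw [coeff_zero_eq_eval_zero]; simp [hb]
    · simp; omega
  · have := mul_neg_geom_sum (-(X * t)) E
    rw [sub_neg_eq_add] at this
    rw [this]
    have : -(X * t) = X * (-t) := by ring
    rw [this, mul_pow]; ring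

lemma S1_coprime {s : A[X]} (hs : s ∈ S1 A) (E : ℕ) : ∃ a b, a * s + b * X ^ E = 1 := by
  obtain ⟨s', ρ, -, h⟩ := S1_inv hs E
  exact ⟨s', -ρ, by rw [mul_comm s', h]; ring⟩

lemma mem_of_coprime {s b : A[X]} (hs : s ∈ S1 A) {E : ℕ} {J : Ideal A[X]} (h1 : s * b ∈ J)
    (h2 : X ^ E * b ∈ J) : b ∈ J := by
  obtain ⟨c, d, h⟩ := S1_coprime hs E
  have : b = c * (s * b) + d * (X ^ E * b) := by linear_combination (-b) * h
  rw [this]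
  exact J.add_mem (J.mul_mem_left _ h1) (J.mul_mem_left _ h2)

lemma nak0 [IsNoetherianRing A] (v u : Ideal A[X]) (h : v ≤ u ⊔ Ideal.span {X} * v) :
    ∃ s ∈ S1 A, ∀ b ∈ v, s * b ∈ u := by
  obtain ⟨s, hs, h'⟩ := nak (Ideal.span {X}) v u
    ((isNoetherianRing_iff_ideal_fg _).1 inferInstance v) h
  exact ⟨s, mem_S1_iff.2 hs, h'⟩

lemma le_of_S1 {v u : Ideal A[X]} (h : ∀ b ∈ v, ∃ s ∈ S1 A, s * b ∈ u ⊔ Ideal.span {X} * v) :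
    v ≤ u ⊔ Ideal.span {X} * v := by
  intro b hb
  obtain ⟨s, hs, h1⟩ := h b hb
  obtain ⟨t, rfl⟩ := S1_exists hs
  have : b = (1 + X * t) * b - X * (t * b) := by ring
  rw [this]
  refine Ideal.sub_mem _ h1 (Ideal.mem_sup_right (Ideal.mul_mem_mul
    (Ideal.mem_span_singleton_self _) (v.mul_mem_left _ hb)))
end S

section Laurent
variable {A : Type*} [CommRing A]

/-- the embedding `X ↦ T⁻¹` -/
noncomputable def kp (A : Type*) [CommRing A] : A[X] →+* A[T;T⁻¹] :=
  (LaurentPolynomial.invert (R := A)).toRingEquiv.toRingHom.comp toLaurent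

noncomputable abbrev kk (A : Type*) [CommRing A] : A[X] →+* A[T;T⁻¹] := toLaurent

open LaurentPolynomial

lemma kp_apply (f : A[X]) : kp A f = invert (toLaurent f) := rfl

lemma kp_C (a : A) : kp A (Polynomial.C a) = LaurentPolynomial.C a := by simp [kp_apply]
lemma kk_C (a : A) : kk A (Polynomial.C a) = LaurentPolynomial.C a := by simp
lemma kk_X : kk A X = T 1 := by simp
lemma kp_X : kp A X = T (-1) := by simp [kp_apply]
lemma kk_Xpow (n : ℕ) : kk A (X ^ n) = T n := by simp
lemma kp_Xpow (n : ℕ) : kp A (X ^ n) = T (-n) := by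
  rw [kp_apply, toLaurent_X_pow, invert_T]
lemma kp_inj : Function.Injective (kp A) := by
  intro a b h
  exact toLaurent_injective ((LaurentPolynomial.invert (R := A)).injective h)
lemma kk_inj : Function.Injective (kk A) := toLaurent_injective

lemma halg : algebraMap A[X] A[T;T⁻¹] = kk A := RingHom.ext algebraMap_eq_toLaurent

lemma kk_mem_map {J : Ideal A[X]} {b : A[X]} : kk A b ∈ J.map (kk A) ↔ ∃ P : ℕ, X ^ P * b ∈ J := by
  have h := IsLocalization.algebraMap_mem_map_algebraMap_iff (Submonoid.powers (X : A[X]))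
    (A[T;T⁻¹]) J b
  rw [halg] at h
  rw [h]
  constructor
  · rintro ⟨_, ⟨P, rfl⟩, hb⟩; exact ⟨P, hb⟩
  · rintro ⟨P, hb⟩; exact ⟨_, ⟨P, rfl⟩, hb⟩

lemma map_kp (J : Ideal A[X]) : J.map (kp A) =
    (J.map (kk A)).map (LaurentPolynomial.invert (R := A)).toRingEquiv := by
  rw [kp]; exact (Ideal.map_map _ _).symm

lemma kp_mem_map {J : Ideal A[X]} {b : A[X]} : kp A b ∈ J.map (kp A) ↔ ∃ P : ℕ, X ^ P * b ∈ J := by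
  rw [← kk_mem_map, map_kp]
  constructor
  · intro h
    obtain ⟨y, hy, hyb⟩ := (Ideal.mem_map_iff_of_surjective _
      (LaurentPolynomial.invert (R := A)).toRingEquiv.surjective).1 h
    have : y = kk A b := (LaurentPolynomial.invert (R := A)).injective hyb
    rwa [← this]
  · intro h
    exact Ideal.mem_map_of_mem _ h

lemma kk_lift {ι : Type*} [Finite ι] (y : ι → A[T;T⁻¹]) :
    ∃ P0 : ℕ, ∀ P ≥ P0, ∃ b : ι → A[X], ∀ i, kk A (b i) = T P * y i := by
  choose n f hf using fun i => exists_T_pow (y i)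
  have := Fintype.ofFinite ι
  refine ⟨∑ i, n i, fun P hP => ⟨fun i => X ^ (P - n i) * f i, fun i => ?_⟩⟩
  have h1 : n i ≤ P := (Finset.single_le_sum (fun _ _ => Nat.zero_le _) (Finset.mem_univ i)).trans hP
  rw [map_mul, kk_Xpow]
  change _ * toLaurent (f i) = _
  rw [hf, mul_left_comm, ← T_add, mul_comm]
  congr 2
  omega

lemma kp_lift {ι : Type*} [Finite ι] (y : ι → A[T;T⁻¹]) :
    ∃ P0 : ℕ, ∀ P ≥ P0, ∃ b : ι → A[X], ∀ i, kp A (b i) = T (-(P : ℤ)) * y i := by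
  obtain ⟨P0, h⟩ := kk_lift (fun i => invert (y i))
  refine ⟨P0, fun P hP => ?_⟩
  obtain ⟨b, hb⟩ := h P hP
  refine ⟨b, fun i => ?_⟩
  rw [kp_apply]
  change invert (kk A (b i)) = _
  rw [hb, map_mul, invert_T]
  congr 1
  exact involutive_invert _

lemma kp_reverse (f : A[X]) : kk A f.reverse = kp A f * T f.natDegree := toLaurent_reverse f

lemma kp_reverse' (f : A[X]) : kp A f.reverse = kk A f * T (-(f.natDegree : ℤ)) := by
  rw [kp_apply, toLaurent_reverse, map_mul, invert_T]
  congr 1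
  exact involutive_invert _

lemma map_comap_kk (J : Ideal A[T;T⁻¹]) : (J.comap (kk A)).map (kk A) = J := by
  have := IsLocalization.map_under (Submonoid.powers (X : A[X])) (A[T;T⁻¹]) J
  rwa [Ideal.under, halg] at this

lemma reverse_S1 {f : A[X]} (hf : f.Monic) : f.reverse ∈ S1 A := by
  rw [mem_S1, coeff_zero_reverse]; exact hf

/-- transport of heights -/
lemma height_trans {I : Ideal A[X]} {η : ℕ∞} (hη : ∀ Q : Ideal A[X], Q.IsPrime → I ≤ Q → η ≤ Q.height)
    (Q : Ideal A[X]) (hQ : Q.IsPrime) (hX : X ∉ Q) (hI : (I.map (kp A)).comap (kk A) ≤ Q) :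
    η ≤ Q.height := by
  have hdis : Disjoint ((Submonoid.powers (X : A[X])) : Set A[X]) (Q : Set A[X]) := by
    rw [Set.disjoint_left]
    rintro _ ⟨P, rfl⟩ h
    exact hX (hQ.mem_of_pow_mem _ h)
  have hp := IsLocalization.isPrime_of_isPrime_disjoint _ (A[T;T⁻¹]) Q hQ hdis
  have hc := IsLocalization.under_map_of_isPrime_disjoint _ (A[T;T⁻¹]) hQ hdis
  rw [halg] at hp
  rw [Ideal.under, halg] at hc
  have h1 := IsLocalization.height_under (Submonoid.powers (X : A[X])) (Q.map (kk A))
  rw [Ideal.under, halg, hc] at h1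
  let Q2 := (Q.map (kk A)).comap (LaurentPolynomial.invert (R := A)).toRingEquiv
  have h2 : Q2.height = (Q.map (kk A)).height := RingEquiv.height_comap _ _
  have h3 := IsLocalization.height_under (Submonoid.powers (X : A[X])) Q2
  rw [Ideal.under, halg] at h3
  rw [h1, ← h2, ← h3]
  have hp2 : Q2.IsPrime := Ideal.comap_isPrime _ _
  refine hη _ (Ideal.comap_isPrime _ _) ?_
  have h4 : I.map (kp A) ≤ Q.map (kk A) := by
    rw [← map_comap_kk (I.map (kp A))]
    exact Ideal.map_mono hI
  have h5 := Ideal.map_le_iff_le_comap.1 h4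
  exact h5

end Laurent
end LiftAT
end file4

section file5
open scoped LaurentPolynomial
namespace LiftAT

section step1
variable {A : Type*} [CommRing A]
open LaurentPolynomial

lemma T_mul_mem {J : Ideal A[T;T⁻¹]} {y : A[T;T⁻¹]} (n : ℤ) (h : T n * y ∈ J) : y ∈ J := by
  have := J.mul_mem_left (T (-n)) h
  rwa [← mul_assoc, ← T_add, neg_add_cancel, T_zero, one_mul] at this

lemma step1 [IsNoetherianRing A] {κ : Type*} [Finite κ] (I : Ideal A[X]) (x a : κ → A[X]) (f g : A[X])
    (hf : f.Monic) (hgm : g.Monic) (hx : ∀ k, x k ∈ I) (ha : ∀ k, a k - f * x k ∈ I ^ 2)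
    (hg : ∀ b ∈ I, g * b ∈ Ideal.span (Set.range a)) :
    ∃ (M M1 : ℕ) (b : κ → A[X]) (s1 : A[X]) (c d : A[T;T⁻¹]),
      (∀ k, kk A (b k) = c * kp A (a k) + d * kp A (x k)) ∧
      (∀ k, kk A (b k) - T M * kp A (x k) ∈ (I.map (kp A)) ^ 2) ∧
      s1 ∈ S1 A ∧ ∀ β ∈ (I.map (kp A)).comap (kk A), s1 * (X ^ M1 * β) ∈ Ideal.span (Set.range b) := by
  set IL := I.map (kp A) with hIL
  set Ib := IL.comap (kk A) with hIb
  obtain ⟨P1, h1⟩ := kk_lift (fun k => kp A (a k))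
  obtain ⟨P2, h2⟩ := kk_lift (fun k => kp A (x k))
  obtain ⟨ahat, hahat⟩ := h1 (max P1 P2) (le_max_left _ _)
  obtain ⟨xhat, hxhat⟩ := h2 (max P1 P2) (le_max_right _ _)
  set P := max P1 P2
  have hxI : ∀ k, xhat k ∈ Ib := fun k => by
    rw [hIb, Ideal.mem_comap, hxhat]
    exact Ideal.mul_mem_left _ _ (Ideal.mem_map_of_mem _ (hx k))
  have hM2 : ∃ M2 : ℕ, ∀ β ∈ Ib, X ^ M2 * (g.reverse * β) ∈ Ideal.span (Set.range ahat) := by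
    have key : ∀ b ∈ Ideal.span {g.reverse} * Ib, ∃ w ∈ Submonoid.powers (X : A[X]),
        w * b ∈ Ideal.span (Set.range ahat) := by
      intro b hb
      obtain ⟨β, hβ, rfl⟩ := Ideal.mem_span_singleton_mul.1 hb
      have h3 : kp A g * kk A β ∈ (Ideal.span (Set.range a)).map (kp A) := by
        have h4 : Ideal.span {g} * I ≤ Ideal.span (Set.range a) := by
          intro y hy
          obtain ⟨z, hz, rfl⟩ := Ideal.mem_span_singleton_mul.1 hy
          exact hg z hz
        have h5 := Ideal.map_mono (f := kp A) h4
        rw [Ideal.map_mul] at h5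
        exact h5 (Ideal.mul_mem_mul (Ideal.mem_map_of_mem _ (Ideal.mem_span_singleton_self _)) hβ)
      have h6 : (Ideal.span (Set.range a)).map (kp A) ≤ (Ideal.span (Set.range ahat)).map (kk A) := by
        rw [Ideal.map_le_iff_le_comap, Ideal.span_le]
        rintro _ ⟨k, rfl⟩
        change kp A (a k) ∈ Ideal.map (kk A) (Ideal.span (Set.range ahat))
        refine T_mul_mem (P : ℤ) ?_
        rw [← hahat]
        exact Ideal.mem_map_of_mem _ (Ideal.subset_span ⟨k, rfl⟩)
      have h7 : kk A (g.reverse * β) ∈ (Ideal.span (Set.range ahat)).map (kk A) := by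
        rw [map_mul, kp_reverse, mul_right_comm]
        exact Ideal.mul_mem_right _ _ (h6 h3)
      obtain ⟨p, hp⟩ := kk_mem_map.1 h7
      exact ⟨_, ⟨p, rfl⟩, hp⟩
    obtain ⟨_, ⟨M2, rfl⟩, h⟩ := unif _ _ _ ((isNoetherianRing_iff_ideal_fg _).1 inferInstance _) key
    exact ⟨M2, fun β hβ => h _ (Ideal.mul_mem_mul (Ideal.mem_span_singleton_self _) hβ)⟩
  obtain ⟨M2, hM2⟩ := hM2
  set mf := f.natDegree
  obtain ⟨s', ρ, hs', hss⟩ := S1_inv (reverse_S1 hf) (mf + M2 + 1)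
  have hssL := congrArg (kk A) hss
  rw [map_mul, map_add, map_mul, kp_reverse, map_one] at hssL
  set b : κ → A[X] := fun k => X ^ mf * s' * ahat k - X ^ (mf + M2 + 1) * ρ * xhat k with hb
  have hbk : ∀ k, kk A (b k) = (T mf * kk A s' * T P) * kp A (a k) +
      (- kk A (X ^ (mf + M2 + 1)) * kk A ρ * T P) * kp A (x k) := by
    intro k
    simp only [hb, map_sub, map_mul, hahat, hxhat, kk_Xpow]
    ring
  have hv : Ideal.span {X ^ (mf + M2)} * Ib ≤
      Ideal.span (Set.range b) ⊔ Ideal.span {X} * (Ideal.span {X ^ (mf + M2)} * Ib) := by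
    apply le_of_S1
    intro y hy
    obtain ⟨β, hβ, rfl⟩ := Ideal.mem_span_singleton_mul.1 hy
    refine ⟨s' * g.reverse, (S1 A).mul_mem hs' (reverse_S1 hgm), ?_⟩
    have key : ∀ y ∈ Ideal.span (Set.range ahat), X ^ mf * s' * y ∈
        Ideal.span (Set.range b) ⊔ Ideal.span {X} * (Ideal.span {X ^ (mf + M2)} * Ib) := by
      intro y hy
      induction hy using Submodule.span_induction with
      | mem x hx =>
        obtain ⟨k, rfl⟩ := hx
        have : X ^ mf * s' * ahat k = b k + X * (X ^ (mf + M2) * (ρ * xhat k)) := by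
          simp only [hb]; ring
        rw [this]
        refine Ideal.add_mem _ (Ideal.mem_sup_left (Ideal.subset_span ⟨k, rfl⟩))
          (Ideal.mem_sup_right (Ideal.mul_mem_mul (Ideal.mem_span_singleton_self _)
            (Ideal.mul_mem_mul (Ideal.mem_span_singleton_self _) (Ib.mul_mem_left _ (hxI k)))))
      | zero => simp
      | add x y _ _ hx hy => rw [mul_add]; exact Ideal.add_mem _ hx hy
      | smul a x _ hx => rw [smul_eq_mul, mul_left_comm (X ^ mf * s')]; exact Ideal.mul_mem_left _ _ hx
    have h8 := key _ (hM2 β hβ)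
    convert h8 using 1
    ring
  obtain ⟨s1, hs1, hs1'⟩ := nak0 _ _ hv
  refine ⟨P, mf + M2, b, s1, _, _, hbk, ?_, hs1, fun β hβ => hs1' _
    (Ideal.mul_mem_mul (Ideal.mem_span_singleton_self _) hβ)⟩
  intro k
  have : kk A (b k) - T P * kp A (x k) = T P * T mf * kk A s' * kp A (a k - f * x k) := by
    rw [hbk, map_sub, map_mul]
    linear_combination (T P * kp A (x k)) * hssL
  rw [this, hIL, ← Ideal.map_pow]
  exact Ideal.mul_mem_left _ _ (Ideal.mem_map_of_mem _ (ha k))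

end step1

section step23
variable {A : Type*} [CommRing A]

lemma pow_sat {J : Ideal A[X]} (hX : ∀ b, X * b ∈ J → b ∈ J) (n : ℕ) (b : A[X]) (h : X ^ n * b ∈ J) :
    b ∈ J := by
  induction n with
  | zero => simpa using h
  | succ n ih => exact ih (hX _ (by rwa [← mul_assoc, ← pow_succ']))

lemma spn_congr {R ι : Type*} [CommRing R] {q q2 : ι → R} {h : R} (hq : ∀ i, q2 i - q i ∈ Ideal.span {h}) :
    spn q h ≤ spn q2 h := by
  rw [spn_le]
  refine ⟨fun i => ?_, h_mem _ _⟩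
  have : q i = q2 i - (q2 i - q i) := by ring
  rw [this]
  exact Ideal.sub_mem _ (q_mem _ _ _) ((Ideal.span_singleton_le_iff_mem _).2 (h_mem q2 h) (hq i))

lemma step23 [IsNoetherianRing A] {ι : Type*} [Fintype ι] [DecidableEq ι] (e : Matrix ι ι A) (he : e * e = e) (m δ η : ℕ)
    (hr : RankCond e (m + 1)) (hδ : ringKrullDim A[X] ≤ δ) (hδη : δ ≤ m + η) (hηm : η ≤ m + 2)
    (Ib : Ideal A[X]) (hIb : ∀ Q : Ideal A[X], Q.IsPrime → X ∉ Q → Ib ≤ Q → (η : ℕ∞) ≤ Q.height)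
    (hsat : ∀ b, X * b ∈ Ib → b ∈ Ib) (q : ι → A[X]) (h s1 : A[X]) (M1 : ℕ) (hq : Row (e.map C) q)
    (hqI : spn q h ≤ Ib) (hs1 : s1 ∈ S1 A) (hM1 : ∀ β ∈ Ib, s1 * (X ^ M1 * β) ∈ spn q h) :
    ∃ (q2 : ι → A[X]) (N' M' : ℕ) (J' J1 : Ideal A[X]), Row (e.map C) q2 ∧ (∀ i, q2 i - q i ∈ Ib ^ 2) ∧
      J' ≤ J1 ∧ J1 ≤ Ib ∧ (∀ i, q2 i ∈ J') ∧ X ^ N' * h ∈ J' ∧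
      (∀ β ∈ J', ∃ s ∈ S1 A, s * β ∈ spn q2 (X ^ N' * h)) ∧ (∀ β ∈ Ib, X ^ M' * β ∈ J') ∧
      ringKrullDim (A[X] ⧸ J1) ≤ m := by
  have heC : e.map C * e.map C = e.map (C : A →+* A[X]) := by rw [← Matrix.map_mul, he]
  obtain ⟨c, hc, hH⟩ := EE (e.map (C : A →+* A[X])) (m + 1) (hr.map C) q (Ideal.span {h} * Ib ^ 2)
  set q2 := q + Matrix.vecMul c (e.map C) with hq2
  have hdiff : ∀ i, q2 i - q i ∈ Ideal.span {h} * Ib ^ 2 := by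
    intro i
    rw [hq2, Pi.add_apply, add_sub_cancel_left]
    exact vecMul_mem hc _ i
  have hd1 : ∀ i, q2 i - q i ∈ Ideal.span {h} := fun i => Ideal.mul_le_left (hdiff i)
  have hd2 : ∀ i, q2 i - q i ∈ Ib ^ 2 := fun i => Ideal.mul_le_right (hdiff i)
  have hle := spn_congr hd1
  have hq2I : ∀ i, q2 i ∈ Ib := by
    intro i
    have : q2 i = q i + (q2 i - q i) := by ring
    rw [this]
    exact Ib.add_mem (hqI (q_mem _ _ i)) (Ideal.pow_le_self two_ne_zero (hd2 i))
  have hhI : h ∈ Ib := hqI (h_mem _ _)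
  have hH' : ∀ Q : Ideal A[X], Q.IsPrime → X ∉ Q → (∀ s ∈ S1 A, s ∉ Q) → (∀ i, q2 i ∈ Q) →
      ((m + 1 : ℕ) : ℕ∞) ≤ Q.height ∨ (η : ℕ∞) ≤ Q.height := by
    intro Q hQ hX hS hqQ
    by_cases hb : Ideal.span {h} * Ib ^ 2 ≤ Q
    · right
      refine hIb Q hQ hX ?_
      rcases hQ.mul_le.1 hb with h1 | h1
      · have h2 : spn q2 h ≤ Q := spn_le.2 ⟨hqQ, (Ideal.span_singleton_le_iff_mem _).1 h1⟩
        intro β hβ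
        have h3 := h2 (hle (hM1 β hβ))
        exact ((hQ.mem_or_mem ((hQ.mem_or_mem h3).resolve_left (hS _ hs1))).resolve_left
          (fun h => hX (hQ.mem_of_pow_mem _ h)))
      · exact hQ.le_of_pow_le h1
    · exact Or.inl (hH ⟨Q, hQ⟩ hb hqQ)
  set W : Submonoid A[X] := S1 A ⊔ Submonoid.powers X
  set sq : Ideal A[X] := Ideal.span (Set.range q2)
  set 𝔮 : Ideal A[X] := Ib ⊓ sat W sq
  have hN : ∃ N' : ℕ, ∀ β ∈ 𝔮, X ^ N' * β ∈ sat (S1 A) sq := by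
    obtain ⟨_, ⟨N', rfl⟩, h⟩ := unif (Submonoid.powers (X : A[X])) 𝔮 (sat (S1 A) sq)
      ((isNoetherianRing_iff_ideal_fg _).1 inferInstance _) (by
        rintro b ⟨-, w, hw, hb⟩
        obtain ⟨s, hs, x, hx, rfl⟩ := Submonoid.mem_sup.1 hw
        exact ⟨x, hx, s, hs, by rwa [← mul_assoc]⟩)
    exact ⟨N', h⟩
  obtain ⟨N', hN'⟩ := hN
  set J' : Ideal A[X] := Ib ⊓ sat (S1 A) (spn q2 (X ^ N' * h))
  set J1 : Ideal A[X] := Submodule.comap (LinearMap.mulLeft A[X] (X ^ N' : A[X])) J'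
  have hJ1 : ∀ b, b ∈ J1 ↔ X ^ N' * b ∈ J' := fun b => Iff.rfl
  have hqJ : ∀ i, q2 i ∈ J' := fun i => ⟨hq2I i, 1, (S1 A).one_mem, by rw [one_mul]; exact q_mem _ _ i⟩
  have hM' : ∀ β ∈ Ib, X ^ (M1 + N') * β ∈ J' := by
    intro β hβ
    refine ⟨Ib.mul_mem_left _ hβ, s1, hs1, ?_⟩
    have : s1 * (X ^ (M1 + N') * β) = X ^ N' * (s1 * (X ^ M1 * β)) := by ring
    rw [this]
    have h1 := hle (hM1 β hβ)
    generalize s1 * (X ^ M1 * β) = y at h1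
    rw [spn] at h1
    induction h1 using Submodule.span_induction with
    | mem x hx =>
      rcases hx with rfl | ⟨i, rfl⟩
      · exact h_mem _ _
      · exact Ideal.mul_mem_left _ _ (q_mem _ _ _)
    | zero => simp
    | add x y _ _ hx hy => rw [mul_add]; exact Ideal.add_mem _ hx hy
    | smul a x _ hx => rw [smul_eq_mul, mul_left_comm]; exact Ideal.mul_mem_left _ _ hx
  have hqJ1 : 𝔮 ≤ J1 := by
    intro β hβ
    refine ⟨Ib.mul_mem_left _ hβ.1, ?_⟩
    obtain ⟨s, hs, h1⟩ := hN' β hβ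
    refine ⟨s, hs, ?_⟩
    refine (Ideal.span_le.2 ?_ : sq ≤ _) h1
    rintro _ ⟨i, rfl⟩
    exact q_mem _ _ i
  have hqX : ∀ b, X * b ∈ 𝔮 → b ∈ 𝔮 := by
    rintro b ⟨h1, w, hw, h2⟩
    refine ⟨hsat _ h1, w * X, W.mul_mem hw (Submonoid.mem_sup_right ⟨1, by simp⟩), ?_⟩
    rwa [mul_assoc]
  refine ⟨q2, N', M1 + N', J', J1, hq.add (Row.vecMul heC c), hd2, ?_, ?_, hqJ, ?_, ?_, hM', ?_⟩
  · intro b hb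
    exact J'.mul_mem_left _ hb
  · intro b hb
    exact pow_sat hsat N' b hb.1
  · exact ⟨Ib.mul_mem_left _ hhI, 1, (S1 A).one_mem, by rw [one_mul]; exact h_mem _ _⟩
  · intro β hβ
    exact hβ.2
  · refine dim_quot_le J1 δ m hδ ?_
    intro Q hQ hJQ
    by_cases hX : X ∈ Q
    · obtain ⟨Q', hQ'm, hQ'Q⟩ := Ideal.exists_minimalPrimes_le (hqJ1.trans hJQ)
      have hQ' : Q'.IsPrime := hQ'm.1.1
      have hX' : X ∉ Q' := by
        intro hXQ'
        have h1 : (X : A[X]) ∈ ⋃ p ∈ 𝔮.minimalPrimes, (p : Set A[X]) := Set.mem_biUnion hQ'm hXQ'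
        rw [Ideal.iUnion_minimalPrimes] at h1
        obtain ⟨y, hy, hXy⟩ := h1
        obtain ⟨k, hk⟩ := hXy
        rw [mul_pow] at hk
        exact hy ⟨k, pow_sat hqX _ _ hk⟩
      have hS : ∀ s ∈ S1 A, s ∉ Q' := by
        intro s hs hsQ
        obtain ⟨t, rfl⟩ := S1_exists hs
        refine hQ.ne_top ((Ideal.eq_top_iff_one _).2 ?_)
        have := Q.sub_mem (hQ'Q hsQ) (Q.mul_mem_right t hX)
        simpa using this
      have hlt : Q' < Q := lt_of_le_of_ne hQ'Q (fun h => hX' (h ▸ hX))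
      have h2 : Q'.height + 1 ≤ Q.height := Ideal.height_add_one_le_of_lt_of_isPrime hlt
      have hqQ' : ∀ i, q2 i ∈ Q' := fun i => hQ'm.1.2
        ⟨hq2I i, 1, W.one_mem, by rw [one_mul]; exact Ideal.subset_span ⟨i, rfl⟩⟩
      rcases hH' Q' hQ' hX' hS hqQ' with h3 | h3
      · have h4 : ((m + 2 : ℕ) : ℕ∞) ≤ Q.height := by
          refine le_trans ?_ h2
          have := add_le_add_left h3 1
          refine le_trans (le_of_eq ?_) this
          push_cast; ring
        calc (δ : ℕ∞) ≤ ((m + (m + 2) : ℕ) : ℕ∞) := by exact_mod_cast (by omega)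
          _ = m + ((m + 2 : ℕ) : ℕ∞) := by push_cast; ring
          _ ≤ _ := by gcongr
      · calc (δ : ℕ∞) ≤ ((m + η : ℕ) : ℕ∞) := by exact_mod_cast hδη
          _ = m + (η : ℕ∞) := by push_cast; ring
          _ ≤ _ := by gcongr; exact h3.trans (le_trans le_self_add h2)
    · have h3 : (η : ℕ∞) ≤ Q.height := by
        refine hIb Q hQ hX fun β hβ => ?_
        have : X ^ (M1 + N') * β ∈ Q := hJQ (J'.mul_mem_left _ (hM' β hβ))
        exact (hQ.mem_or_mem this).resolve_left (fun h => hX (hQ.mem_of_pow_mem _ h))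
      calc (δ : ℕ∞) ≤ ((m + η : ℕ) : ℕ∞) := by exact_mod_cast hδη
          _ = m + (η : ℕ∞) := by push_cast; ring
          _ ≤ _ := by gcongr
end step23
end LiftAT
end file5

section file6
open scoped LaurentPolynomial
namespace LiftAT

section step4
variable {A : Type*} [CommRing A]

lemma int_quot {J : Ideal A[X]} {g : A[X]} (hg : g.Monic) (hJ : g ∈ J) : Module.Finite A (A[X] ⧸ J) := by
  have h1 : Module.Finite A (A[X] ⧸ Ideal.span {g}) := hg.finite_quotient
  have h2 : Ideal.span {g} ≤ J := (Ideal.span_singleton_le_iff_mem _).2 hJ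
  exact Module.Finite.of_surjective (Ideal.Quotient.factorₐ A h2).toLinearMap
    (Ideal.Quotient.factor_surjective h2)

lemma nakA [IsNoetherianRing A] (U J : Ideal A[X]) (K : Ideal A) (g : A[X]) (hg : g.Monic) (hgU : g ∈ U)
    (h : J ≤ U ⊔ K.map C * J) : ∃ k ∈ K, ∀ b ∈ J, C (1 + k) * b ∈ U := by
  have := int_quot hg hgU
  set N : Submodule A (A[X] ⧸ U) := Submodule.map (Ideal.Quotient.mkₐ A U).toLinearMap
    (J.restrictScalars A)
  have hN : N ≤ K • N := by
    rintro _ ⟨b, hb, rfl⟩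
    have key : ∀ r ∈ K.map (C : A →+* A[X]), ∀ j ∈ J, Ideal.Quotient.mkₐ A U (r * j) ∈ K • N := by
      intro r hr
      rw [Ideal.map] at hr
      induction hr using Submodule.span_induction with
      | mem x hx =>
        obtain ⟨k, hk, rfl⟩ := hx
        intro j hj
        rw [← smul_eq_C_mul, map_smul]
        exact Submodule.smul_mem_smul hk ⟨j, hj, rfl⟩
      | zero => simp
      | add x y _ _ hx hy =>
        intro j hj
        rw [add_mul, map_add]
        exact Submodule.add_mem _ (hx j hj) (hy j hj)
      | smul a x _ hx =>
        intro j hj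
        rw [smul_eq_mul, mul_right_comm, mul_comm]
        rw [mul_comm a j]
        exact hx _ (J.mul_mem_right _ hj)
    obtain ⟨u, hu, y, hy, rfl⟩ := Submodule.mem_sup.1 (h hb)
    have h1 : Ideal.Quotient.mkₐ A U u = 0 := Ideal.Quotient.eq_zero_iff_mem.2 hu
    change Ideal.Quotient.mkₐ A U (u + y) ∈ K • N
    rw [map_add, h1, zero_add]
    exact Submodule.mul_induction_on hy key (fun x y hx hy => by
      rw [map_add]; exact Submodule.add_mem _ hx hy)
  obtain ⟨r, hr, h2⟩ := Submodule.exists_sub_one_mem_and_smul_eq_zero_of_fg_of_le_smul K N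
    (IsNoetherian.noetherian N) hN
  refine ⟨r - 1, hr, fun b hb => ?_⟩
  have h3 := h2 _ ⟨b, hb, rfl⟩
  rw [add_sub_cancel, ← smul_eq_C_mul]
  refine Ideal.Quotient.eq_zero_iff_mem.1 ?_
  exact h3

lemma step4 [IsNoetherianRing A] [Nontrivial A] {ι : Type*} [Fintype ι] [DecidableEq ι] (e : Matrix ι ι A) (he : e * e = e)
    (m : ℕ) (hr : RankCond e (m + 1)) (J' J1 : Ideal A[X]) (hJJ : J' ≤ J1)
    (hdim : ringKrullDim (A[X] ⧸ J1) ≤ m) (q : ι → A[X]) (t g0 : A[X]) (E0 : ℕ)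
    (hq : Row (e.map C) q) (hqJ : ∀ i, q i ∈ J') (htJ : t ∈ J') (hg0 : g0.Monic) (hg0J : g0 ∈ J')
    (hS : ∀ β ∈ J', ∃ s ∈ S1 A, s * β ∈ spn q t)
    (hP : ∀ β ∈ J', ∃ P : ℕ, X ^ P * β ∈ spn q t ⊔ J' ^ 2) :
    ∃ (q' : ι → A[X]) (h' : A[X]) (k : A), Row (e.map C) q' ∧ (∀ i, q' i - q i ∈ J' ^ 2) ∧
      h' - t ∈ J' ^ 2 ∧ h'.Monic ∧ E0 ≤ h'.natDegree ∧ C k ∈ J1 ∧ 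
      ∀ β ∈ J', C (1 + k) * β ∈ spn q' h' := by
  have heC : e.map C * e.map C = e.map (C : A →+* A[X]) := by rw [← Matrix.map_mul, he]
  set E := E0 + t.natDegree + 1 with hE
  have hbig : (X ^ E * g0 ^ 2).Monic := (monic_X_pow E).mul (hg0.pow 2)
  have hbigd : (X ^ E * g0 ^ 2).natDegree = E + (g0 ^ 2).natDegree := by
    rw [(monic_X_pow E).natDegree_mul (hg0.pow 2), natDegree_X_pow]
  set h' := t + X ^ E * g0 ^ 2 with hh'
  have hlt : t.natDegree < (X ^ E * g0 ^ 2).natDegree := by omega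
  have hm' : h'.Monic := hbig.add_of_right (degree_lt_degree hlt)
  have hd' : E0 ≤ h'.natDegree := by
    rw [hh', natDegree_add_eq_right_of_natDegree_lt hlt]; omega
  have hh'X : X ^ E * g0 ^ 2 ∈ Ideal.span {X} * J' ^ 2 := by
    refine Ideal.mul_mem_mul ?_ (Ideal.pow_mem_pow hg0J 2)
    rw [Ideal.mem_span_singleton]
    exact dvd_pow_self X (by omega)
  set K : Ideal A := J1.comap C with hK
  set D : Ideal A[X] := K.map C ⊔ Ideal.span {h'} with hD
  have hD2 : ringKrullDim (A[X] ⧸ D) ≤ m := by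
    have i1 : Module.Finite A (A[X] ⧸ J1) := int_quot hg0 (hJJ hg0J)
    have i2 : Module.Finite A (A[X] ⧸ D) := int_quot hm' (Ideal.mem_sup_right (Ideal.mem_span_singleton_self _))
    refine le_trans (dim_le_of_integral (A := A) ?_) hdim
    intro a ha
    have h1 : C a ∈ J1 := Ideal.Quotient.eq_zero_iff_mem.1 ha
    refine Ideal.Quotient.eq_zero_iff_mem.2 (Ideal.mem_sup_left (Ideal.mem_map_of_mem _ ?_))
    exact h1
  set mk := Ideal.Quotient.mk D with hmk
  have hsurj : Function.Surjective mk := Ideal.Quotient.mk_surjective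
  obtain ⟨cb, hcb, hH⟩ := EE ((e.map (C : A →+* A[X])).map mk) (m + 1) ((hr.map C).map mk)
    (fun i => mk (q i)) ((Ideal.span {X} * J' ^ 2).map mk)
  have hlift : ∀ j, ∃ c ∈ Ideal.span {X} * J' ^ 2, mk c = cb j := fun j => by
    obtain ⟨c, hc, h⟩ := (Ideal.mem_map_iff_of_surjective _ hsurj).1 (hcb j)
    exact ⟨c, hc, h⟩
  choose c hc hccb using hlift
  set q' := q + Matrix.vecMul c (e.map C) with hq'
  have hd : ∀ i, q' i - q i ∈ Ideal.span {X} * J' ^ 2 := by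
    intro i
    rw [hq', Pi.add_apply, add_sub_cancel_left]
    exact vecMul_mem hc _ i
  have hprime : ∀ Q : Ideal A[X], Q.IsPrime → K.map C ≤ Q → h' ∈ Q → (∀ i, q' i ∈ Q) → X ∈ Q ∨ J' ≤ Q := by
    intro Q hQ h1 h2 h3
    have hDQ : D ≤ Q := sup_le h1 ((Ideal.span_singleton_le_iff_mem _).2 h2)
    have hker : RingHom.ker mk ≤ Q := by rw [hmk, Ideal.mk_ker]; exact hDQ
    have hQb : (Q.map mk).IsPrime := Ideal.map_isPrime_of_surjective hsurj hker
    by_cases hb : (Ideal.span {X} * J' ^ 2).map mk ≤ Q.map mk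
    · have h4 := Ideal.map_le_iff_le_comap.1 hb
      rw [Ideal.comap_map_of_surjective' mk hsurj, sup_eq_left.2 hker] at h4
      rcases hQ.mul_le.1 h4 with h5 | h5
      · exact Or.inl ((Ideal.span_singleton_le_iff_mem _).1 h5)
      · exact Or.inr (hQ.le_of_pow_le h5)
    · exfalso
      have h5 := hH ⟨Q.map mk, hQb⟩ hb (fun i => by
        have : mk (q' i) ∈ Q.map mk := Ideal.mem_map_of_mem _ (h3 i)
        rw [hq', Pi.add_apply, map_add, RingHom.map_vecMul] at this
        have hcc : (mk ∘ c) = cb := funext hccb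
        rw [hcc] at this
        exact this)
      have h6 : (((m + 1 : ℕ) : ℕ∞) : WithBot ℕ∞) ≤ m :=
        ((WithBot.coe_le_coe.2 h5).trans (Ideal.height_le_ringKrullDim_of_isPrime)).trans hD2
      have h7 : ((m + 1 : ℕ) : ℕ∞) ≤ (m : ℕ∞) := WithBot.coe_le_coe.1 h6
      have h8 : m + 1 ≤ m := by exact_mod_cast h7
      omega
  set U := spn q' h' with hU
  have hle2 : Ideal.span {X} * J' ^ 2 ≤ J' ^ 2 := Ideal.mul_le_right
  have hle1 : J' ^ 2 ≤ J' := Ideal.pow_le_self two_ne_zero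
  have hUJ : U ≤ J' := by
    refine spn_le.2 ⟨fun i => ?_, J'.add_mem htJ (hle1 (hle2 hh'X))⟩
    have : q' i = q i + (q' i - q i) := by ring
    rw [this]
    exact J'.add_mem (hqJ i) (hle1 (hle2 (hd i)))
  have hsub : spn q t ≤ U ⊔ Ideal.span {X} * J' ^ 2 := by
    refine spn_le.2 ⟨fun i => ?_, ?_⟩
    · have : q i = q' i - (q' i - q i) := by ring
      rw [this]
      exact Ideal.sub_mem _ (Ideal.mem_sup_left (q_mem _ _ i)) (Ideal.mem_sup_right (hd i))
    · have : t = h' - X ^ E * g0 ^ 2 := by rw [hh']; ring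
      rw [this]
      exact Ideal.sub_mem _ (Ideal.mem_sup_left (h_mem _ _)) (Ideal.mem_sup_right hh'X)
  have h4b : J' ≤ U ⊔ Ideal.span {X} * J' := by
    refine le_of_S1 fun β hβ => ?_
    obtain ⟨s, hs, h1⟩ := hS β hβ
    exact ⟨s, hs, (hsub.trans (sup_le_sup_left (Ideal.mul_mono_right hle1) _)) h1⟩
  obtain ⟨s2, hs2, hs2J⟩ := nak0 _ _ h4b
  have h4d : J' ≤ U ⊔ J' * J' := by
    intro β hβ
    obtain ⟨P, h1⟩ := hP β hβ
    refine mem_of_coprime hs2 (Ideal.mem_sup_left (hs2J β hβ)) (E := P) ?_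
    rw [← sq]
    refine (sup_le (hsub.trans (sup_le_sup_left hle2 _)) le_sup_right) h1
  obtain ⟨s3, hs3, hs3J⟩ := nak J' J' U ((isNoetherianRing_iff_ideal_fg _).1 inferInstance _) h4d
  have h4e : J' ≤ U ⊔ K.map C * J' := by
    let c0 : Ideal A[X] := Submodule.colon (U ⊔ K.map C * J') (J' : Set A[X])
    have hc0 : ∀ r, r ∈ c0 ↔ ∀ b ∈ J', r * b ∈ U ⊔ K.map C * J' := fun r => by
      simp only [c0, Submodule.mem_colon, smul_eq_mul, SetLike.mem_coe]
    by_cases htop : c0 = ⊤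
    · have h1 : (1 : A[X]) ∈ c0 := htop ▸ Submodule.mem_top
      intro b hb
      simpa using (hc0 1).1 h1 b hb
    · exfalso
      obtain ⟨Q, hQ, hcQ⟩ := Ideal.exists_le_maximal c0 htop
      have hQp := hQ.isPrime
      have hUc : U ≤ c0 := fun u hu => (hc0 u).2 fun b _ => Ideal.mem_sup_left (U.mul_mem_right _ hu)
      have hKc : K.map C ≤ c0 := fun u hu => (hc0 u).2 fun b hb => Ideal.mem_sup_right
        (Ideal.mul_mem_mul hu hb)
      rcases hprime Q hQp (hKc.trans hcQ) (hcQ (hUc (h_mem _ _))) (fun i => hcQ (hUc (q_mem _ _ i)))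
        with h1 | h1
      · have h2 : s2 ∈ Q := hcQ ((hc0 s2).2 fun b hb => Ideal.mem_sup_left (hs2J b hb))
        obtain ⟨t, rfl⟩ := S1_exists hs2
        refine hQp.ne_top ((Ideal.eq_top_iff_one _).2 ?_)
        have := Q.sub_mem h2 (Q.mul_mem_right t h1)
        simpa using this
      · have h2 : s3 ∈ Q := hcQ ((hc0 s3).2 fun b hb => Ideal.mem_sup_left (hs3J b hb))
        refine hQp.ne_top ((Ideal.eq_top_iff_one _).2 ?_)
        have := Q.sub_mem h2 (h1 hs3)
        simpa using this
  obtain ⟨k, hk, hkU⟩ := nakA U J' K h' hm' (h_mem _ _) h4e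
  refine ⟨q', h', k, hq.add (Row.vecMul heC c), fun i => hle2 (hd i), ?_, hm', hd', hk, hkU⟩
  rw [hh', add_sub_cancel_left]
  exact hle2 hh'X
end step4
end LiftAT
end file6

section file7
open scoped LaurentPolynomial
namespace LiftAT

section step5
variable {A : Type*} [CommRing A]
open LaurentPolynomial

lemma map_C_kp {ι : Type*} (e : Matrix ι ι A) :
    (e.map (Polynomial.C : A →+* A[X])).map (kp A) = e.map (LaurentPolynomial.C : A →+* A[T;T⁻¹]) := by
  ext1 i j; simp only [Matrix.map_apply, kp_C]
lemma map_C_kk {ι : Type*} (e : Matrix ι ι A) :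
    (e.map (Polynomial.C : A →+* A[X])).map (kk A) = e.map (LaurentPolynomial.C : A →+* A[T;T⁻¹]) := by
  ext1 i j; simp only [Matrix.map_apply, kk_C]

lemma kp_mem_of {J : Ideal A[X]} {s b : A[X]} (hs : s ∈ S1 A) (hsb : s * b ∈ J)
    (h : kp A b ∈ J.map (kp A)) : b ∈ J := by
  obtain ⟨P, hP⟩ := kp_mem_map.1 h
  exact mem_of_coprime hs hsb hP

lemma step5 {ι : Type*} [Fintype ι] (e : Matrix ι ι A) (ψ1 p1 : ι → A)
    (hψ : Row e ψ1) (hψp : dotProduct ψ1 p1 = 1) (I : Ideal A[X]) (s : A[X]) (hs : s ∈ S1 A)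
    (hsI : s ∈ I ^ 2) (xq : ι → A[X]) (xh : A[X])
    (uq : ι → A[T;T⁻¹]) (uh : A[T;T⁻¹]) (k : A) (r0 : A[X]) (c : ℕ) (hr0 : r0 ∈ S1 A)
    (hrow : Row (e.map LaurentPolynomial.C) uq)
    (hq : ∀ i, uq i - kp A (xq i) ∈ (I.map (kp A)) ^ 2) (hh : uh - kp A xh ∈ (I.map (kp A)) ^ 2)
    (hu : ∀ y ∈ I.map (kp A), LaurentPolynomial.C (1 + k) * y ∈ spn uq uh)
    (hur : T (-(c : ℤ)) * uh = kp A r0) :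
    ∃ (zq : ι → A[X]) (zh : A[X]), Row (e.map Polynomial.C) zq ∧ (∀ i, zq i - xq i ∈ I ^ 2) ∧
      zh - xh ∈ I ^ 2 ∧ (∃ r1 ∈ S1 A, r1 ∈ spn zq zh) ∧
      ∀ b ∈ I, Polynomial.C (1 + k) * b ∈ spn zq zh := by
  set IL := I.map (kp A) with hIL
  set ψ : ι → A[T;T⁻¹] := fun i => LaurentPolynomial.C (ψ1 i) with hψdef
  set p : ι → A[T;T⁻¹] := fun i => LaurentPolynomial.C (p1 i) with hpdef
  have hψrow : Row (e.map LaurentPolynomial.C) ψ := hψ.map _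
  have hdot : dotProduct ψ p = 1 := by
    have := congrArg (LaurentPolynomial.C : A →+* A[T;T⁻¹]) hψp
    rw [RingHom.map_dotProduct, map_one] at this
    exact this
  have hsL : kp A s ∈ IL ^ 2 := by
    rw [hIL, ← Ideal.map_pow]; exact Ideal.mem_map_of_mem _ hsI
  set α := dotProduct uq p with hα
  obtain ⟨P0, hP0⟩ := kp_lift (fun _ : Unit => 1 - α)
  obtain ⟨b0, hb0⟩ := hP0 P0 le_rfl
  obtain ⟨r', ρ, -, hr'⟩ := S1_inv ((S1 A).mul_mem hs hr0) (P0 + 1)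
  have hr'L := congrArg (kp A) hr'
  simp only [map_mul, map_add, map_one] at hr'L
  set w := (1 + kp A (X ^ (P0 + 1)) * kp A ρ) * (1 - α) with hw
  have hwI : w ∈ IL ^ 2 := by
    rw [hw, ← hr'L]
    exact Ideal.mul_mem_right _ _ (Ideal.mul_mem_right _ _ (Ideal.mul_mem_right _ _ hsL))
  have hwu : w ∈ Ideal.span {uh} := by
    rw [hw, ← hr'L, ← hur]
    rw [Ideal.mem_span_singleton]
    exact ⟨kp A s * T (-(c : ℤ)) * kp A r' * (1 - α), by ring⟩
  set uA := uq + w • ψ with huA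
  have huArow : Row (e.map LaurentPolynomial.C) uA := hrow.add (hψrow.smul w)
  set r1 : A[X] := 1 + X * (ρ * b0 ()) with hr1
  have hr1S : r1 ∈ S1 A := by rw [mem_S1, hr1]; simp
  have hαA : dotProduct uA p = kp A r1 := by
    rw [huA, add_dotProduct, smul_dotProduct, hdot, ← hα, hr1, map_add, map_mul, map_mul, hb0, hw,
      kp_Xpow, map_one, kp_X, smul_eq_mul, mul_one]
    have : (T (-((P0 + 1 : ℕ) : ℤ)) : A[T;T⁻¹]) = T (-1) * T (-(P0 : ℤ)) := by
      rw [← T_add]; congr 1; push_cast; ring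
    rw [this]; ring
  set u' := uA - kp A r1 • ψ with hu'
  have hu'row : Row (e.map LaurentPolynomial.C) u' := huArow.sub (hψrow.smul _)
  have hu'p : dotProduct u' p = 0 := by
    rw [hu', sub_dotProduct, smul_dotProduct, hdot, hαA]; simp
  obtain ⟨P1, hP1⟩ := kp_lift u'
  obtain ⟨P2, hP2⟩ := kp_lift (fun _ : Unit => uh)
  set E := max P1 P2
  obtain ⟨bq, hbq⟩ := hP1 E (le_max_left _ _)
  obtain ⟨bh, hbh⟩ := hP2 E (le_max_right _ _)
  obtain ⟨r2, ρ', -, hr2⟩ := S1_inv ((S1 A).mul_mem hs hr1S) E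
  have hr2L := congrArg (kp A) hr2
  simp only [map_mul, map_add, map_one] at hr2L
  rw [kp_Xpow] at hr2L
  set zq : ι → A[X] := fun i => r1 * Polynomial.C (ψ1 i) - ρ' * bq i with hzq
  set zh : A[X] := - (ρ' * bh ()) with hzh
  have hzqL : ∀ i, kp A (zq i) = kp A r1 * ψ i - kp A ρ' * (T (-(E : ℤ)) * u' i) := by
    intro i; simp only [hzq, map_sub, map_mul, kp_C, hbq, hψdef]
  have hzhL : kp A zh = - (kp A ρ' * (T (-(E : ℤ)) * uh)) := by
    simp only [hzh, map_neg, map_mul, hbh]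
  have hu'i : ∀ i, u' i = uA i - kp A r1 * ψ i := fun i => by rw [hu']; rfl
  have hzq2 : ∀ i, kp A (zq i) = uA i - kp A s * kp A r1 * kp A r2 * u' i := by
    intro i
    rw [hzqL]
    linear_combination (hu'i i) + u' i * hr2L
  have hzh2 : kp A zh = uh - kp A s * kp A r1 * kp A r2 * uh := by
    rw [hzhL]
    linear_combination uh * hr2L
  have hback : ∀ b, kp A b ∈ IL ^ 2 → b ∈ I ^ 2 := by
    intro b hb
    rw [hIL, ← Ideal.map_pow] at hb
    exact kp_mem_of hs (Ideal.mul_mem_right _ _ hsI) hb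
  have hr1z : r1 ∈ spn zq zh := by
    have h1 : dotProduct zq (fun i => Polynomial.C (p1 i)) = r1 := by
      apply kp_inj
      rw [RingHom.map_dotProduct]
      have h2 : (kp A ∘ zq) = kp A r1 • ψ - (kp A ρ' * T (-(E : ℤ))) • u' := by
        ext1 i
        simp only [Function.comp_apply, hzqL, Pi.sub_apply, Pi.smul_apply, smul_eq_mul]
        ring
      have h3 : (kp A ∘ fun i => Polynomial.C (p1 i)) = p := by
        ext1 i; simp only [Function.comp_apply, kp_C, hpdef]
      rw [h2, h3, sub_dotProduct, smul_dotProduct, smul_dotProduct, hdot, hu'p]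
      simp
    rw [← h1]
    exact Ideal.sum_mem _ fun i _ => Ideal.mul_mem_right _ _ (q_mem _ _ i)
  refine ⟨zq, zh, ?_, ?_, ?_, ⟨r1, hr1S, hr1z⟩, ?_⟩
  · apply Row.of_map (kp A) kp_inj
    rw [map_C_kp]
    have h2 : (fun i => kp A (zq i)) = kp A r1 • ψ - (kp A ρ' * T (-(E : ℤ))) • u' := by
      ext1 i
      simp only [hzqL, Pi.sub_apply, Pi.smul_apply, smul_eq_mul]
      ring
    rw [h2]
    exact (hψrow.smul _).sub (hu'row.smul _)
  · intro i
    apply hback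
    have : kp A (zq i - xq i) = (uq i - kp A (xq i)) + w * ψ i - kp A s * (kp A r1 * kp A r2 * u' i) := by
      rw [map_sub, hzq2]
      have : uA i = uq i + w * ψ i := rfl
      rw [this]; ring
    rw [this]
    exact Ideal.sub_mem _ (Ideal.add_mem _ (hq i) (Ideal.mul_mem_right _ _ hwI))
      (Ideal.mul_mem_right _ _ hsL)
  · apply hback
    have : kp A (zh - xh) = (uh - kp A xh) - kp A s * (kp A r1 * kp A r2 * uh) := by
      rw [map_sub, hzh2]; ring
    rw [this]
    exact Ideal.sub_mem _ hh (Ideal.mul_mem_right _ _ hsL)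
  · intro b hb
    refine kp_mem_of hr1S (Ideal.mul_mem_right _ _ hr1z) ?_
    have h1 := hu (kp A b) (Ideal.mem_map_of_mem _ hb)
    rw [map_mul, kp_C]
    have hZ : kp A r1 ∈ (spn zq zh).map (kp A) := Ideal.mem_map_of_mem _ hr1z
    have h2 : spn uq uh ≤ spn uA uh := spn_congr fun i => by
      have : uA i - uq i = w * ψ i := by rw [huA]; simp
      rw [this]
      exact Ideal.mul_mem_right _ _ hwu
    have h3 : spn uA uh ≤ (spn zq zh).map (kp A) := by
      refine spn_le.2 ⟨fun i => ?_, ?_⟩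
      · have : uA i = kp A (zq i) + kp A r1 * (kp A s * kp A r2 * u' i) := by rw [hzq2]; ring
        rw [this]
        exact Ideal.add_mem _ (Ideal.mem_map_of_mem _ (q_mem _ _ i)) (Ideal.mul_mem_right _ _ hZ)
      · have : uh = kp A zh + kp A r1 * (kp A s * kp A r2 * uh) := by rw [hzh2]; ring
        rw [this]
        exact Ideal.add_mem _ (Ideal.mem_map_of_mem _ (h_mem _ _)) (Ideal.mul_mem_right _ _ hZ)
    exact h3 (h2 h1)

end step5

section step6
variable {A : Type*} [CommRing A]

lemma step6 {ι : Type*} [Fintype ι] (e : Matrix ι ι A) (I : Ideal A[X]) (xq : ι → A[X]) (xh : A[X])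
    (hx : spn xq xh ≤ I) (zq : ι → A[X]) (zh : A[X]) (k : A) (hk : C k ∈ I) (hrow : Row (e.map C) zq)
    (hzq : ∀ i, zq i - xq i ∈ I ^ 2) (hzh : zh - xh ∈ I ^ 2) (r1 : A[X]) (hr1 : r1 ∈ S1 A)
    (hr1z : r1 ∈ spn zq zh) (hkz : ∀ b ∈ I, C (1 + k) * b ∈ spn zq zh) :
    ∃ (yq : ι → A[X]) (yh : A[X]), Row (e.map C) yq ∧ (∀ i, yq i - xq i ∈ I ^ 2) ∧
      yh - xh ∈ I ^ 2 ∧ spn yq yh = I := by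
  let θ : A[X] →+* A[X] := compRingHom (C (1 - k ^ 2) * X)
  have hθC : ∀ a, θ (C a) = C a := fun a => by simp [θ]
  have hθX : θ X = C (1 - k ^ 2) * X := by simp [θ]
  have hθ : ∀ f, ∃ g, f - θ f = C k ^ 2 * g := by
    intro f
    have h1 := sub_dvd_eval_sub X (C (1 - k ^ 2) * X) (f.map C)
    obtain ⟨g, hg⟩ := h1
    refine ⟨X * g, ?_⟩
    have h2 : eval X (f.map C) = f := by rw [eval_map]; exact eval₂_C_X
    have h3 : eval (C (1 - k ^ 2) * X) (f.map C) = θ f := by rw [eval_map]; rfl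
    rw [h2, h3] at hg
    rw [hg, C_sub, C_pow, C_1]; ring
  have hk2 : C k ^ 2 ∈ I ^ 2 := Ideal.pow_mem_pow hk 2
  have hsq : I ^ 2 ≤ I := Ideal.pow_le_self two_ne_zero
  have hz : ∀ f, θ f - f ∈ I ^ 2 := fun f => by
    obtain ⟨g, hg⟩ := hθ f
    have : θ f - f = - (C k ^ 2 * g) := by rw [← hg]; ring
    rw [this]
    exact neg_mem (Ideal.mul_mem_right _ _ hk2)
  set Y := spn (fun i => θ (zq i)) (θ zh) with hY
  have hYmap : Y = (spn zq zh).map θ := (map_spn _ _ _).symm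
  have hyq : ∀ i, θ (zq i) - xq i ∈ I ^ 2 := fun i => by
    have : θ (zq i) - xq i = (θ (zq i) - zq i) + (zq i - xq i) := by ring
    rw [this]; exact Ideal.add_mem _ (hz _) (hzq i)
  have hyh : θ zh - xh ∈ I ^ 2 := by
    have : θ zh - xh = (θ zh - zh) + (zh - xh) := by ring
    rw [this]; exact Ideal.add_mem _ (hz _) hzh
  refine ⟨fun i => θ (zq i), θ zh, ?_, hyq, hyh, le_antisymm ?_ ?_⟩
  · have h1 := hrow.map θ
    have h2 : (e.map C).map θ = e.map (C : A →+* A[X]) := by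
      ext1 i j; simp only [Matrix.map_apply, hθC]
    rwa [h2] at h1
  · refine spn_le.2 ⟨fun i => ?_, ?_⟩
    · have : θ (zq i) = (θ (zq i) - xq i) + xq i := by ring
      rw [this]; exact I.add_mem (hsq (hyq i)) (hx (q_mem _ _ i))
    · have : θ zh = (θ zh - xh) + xh := by ring
      rw [this]; exact I.add_mem (hsq hyh) (hx (h_mem _ _))
  · have hkY : C k ∈ Y := by
      have h1 : C (1 + k) * C k ∈ Y := by
        rw [hYmap]
        have := Ideal.mem_map_of_mem θ (hkz _ hk)
        rwa [map_mul, hθC, hθC] at this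
      have h2 : θ r1 ∈ Y := by rw [hYmap]; exact Ideal.mem_map_of_mem θ hr1z
      obtain ⟨t, rfl⟩ := S1_exists hr1
      rw [map_add, map_one, map_mul, hθX] at h2
      have : C k = C k * (1 + C (1 - k ^ 2) * X * θ t) - (C (1 + k) * C k) * (C (1 - k) * X * θ t) := by
        simp only [C_sub, C_add, C_pow, C_1]; ring
      rw [this]
      exact Y.sub_mem (Y.mul_mem_left _ h2) (Y.mul_mem_right _ h1)
    have hzY : ∀ f, θ f ∈ Y → f ∈ Y := by
      intro f hf
      obtain ⟨g, hg⟩ := hθ f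
      have : f = θ f + C k * (C k * g) := by linear_combination hg
      rw [this]
      exact Y.add_mem hf (Y.mul_mem_right _ hkY)
    have hZY : spn zq zh ≤ Y := spn_le.2 ⟨fun i => hzY _ (q_mem (fun i => θ (zq i)) _ i), hzY _ (h_mem _ _)⟩
    intro b hb
    have : b = C (1 + k) * b - C k * b := by simp only [C_add, C_1]; ring
    rw [this]
    exact Y.sub_mem (hZY (hkz b hb)) (Y.mul_mem_right _ hkY)
end step6
end LiftAT
end file7

section file8
open scoped LaurentPolynomial
namespace LiftAT
section core
variable {A : Type*} [CommRing A]
open LaurentPolynomial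

lemma span_mul_map {R R' : Type*} [CommRing R] [CommRing R'] (f : R →+* R') (I J : Ideal R) (g : R)
    (h : ∀ b ∈ I, g * b ∈ J) (y : R') (hy : y ∈ I.map f) : f g * y ∈ J.map f := by
  have h4 : Ideal.span {g} * I ≤ J := by
    intro y hy
    obtain ⟨z, hz, rfl⟩ := Ideal.mem_span_singleton_mul.1 hy
    exact h z hz
  have h5 := Ideal.map_mono (f := f) h4
  rw [Ideal.map_mul] at h5
  exact h5 (Ideal.mul_mem_mul (Ideal.mem_map_of_mem _ (Ideal.mem_span_singleton_self _)) hy)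

theorem core [IsNoetherianRing A] [Nontrivial A] {ι : Type*} [Fintype ι] [DecidableEq ι]
    (e : Matrix ι ι A) (he : e * e = e) (m δ η : ℕ)
    (hr : RankCond e (m + 1)) (hδ : ringKrullDim A[X] ≤ δ) (hδη : δ ≤ m + η) (hηm : η ≤ m + 2)
    (ψ1 p1 : ι → A) (hψ : Row e ψ1) (hψp : dotProduct ψ1 p1 = 1) (I : Ideal A[X])
    (hη : ∀ Q : Ideal A[X], Q.IsPrime → I ≤ Q → (η : ℕ∞) ≤ Q.height)
    (s : A[X]) (hs : s ∈ S1 A) (hsI : s ∈ I) (xq aq : ι → A[X]) (xh ah : A[X])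
    (hxrow : Row (e.map Polynomial.C) xq) (harow : Row (e.map Polynomial.C) aq)
    (hx : spn xq xh ⊔ I ^ 2 = I) (f g : A[X]) (hf : f.Monic) (hg : g.Monic)
    (haq : ∀ i, aq i - f * xq i ∈ I ^ 2) (hah : ah - f * xh ∈ I ^ 2)
    (hgI : ∀ b ∈ I, g * b ∈ spn aq ah) :
    ∃ (yq : ι → A[X]) (yh : A[X]), Row (e.map Polynomial.C) yq ∧ (∀ i, yq i - xq i ∈ I ^ 2) ∧
      yh - xh ∈ I ^ 2 ∧ spn yq yh = I := by
  have hxI : spn xq xh ≤ I := le_trans le_sup_left hx.le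
  have hspan : ∀ (v : ι → A[X]) (w : A[X]), Ideal.span (Set.range (fun o : Option ι => o.elim w v)) = spn v w := by
    intro v w
    rw [spn]; congr 1
    ext y; constructor
    · rintro ⟨_ | i, rfl⟩
      · exact Set.mem_insert _ _
      · exact Set.mem_insert_of_mem _ ⟨i, rfl⟩
    · rintro (rfl | ⟨i, rfl⟩)
      · exact ⟨none, rfl⟩
      · exact ⟨some i, rfl⟩
  obtain ⟨M, M1, b, s1, cL, dL, hb, hbx, hs1, hM1⟩ := step1 I (fun o : Option ι => o.elim xh xq)
    (fun o => o.elim ah aq) f g hf hg (by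
      rintro (_ | i)
      · exact hxI (h_mem _ _)
      · exact hxI (q_mem _ _ i)) (by
      rintro (_ | i)
      · exact hah
      · exact haq i) (by intro β hβ; rw [hspan]; exact hgI β hβ)
  obtain ⟨q, hq⟩ : ∃ q : ι → A[X], q = fun i => b (some i) := ⟨_, rfl⟩
  obtain ⟨h, hh⟩ : ∃ h : A[X], h = b none := ⟨_, rfl⟩
  have hbe : b = fun o : Option ι => o.elim h q := by
    ext1 o; rcases o with _ | i
    · exact hh.symm
    · rw [hq]; rfl
  rw [hbe, hspan] at hM1
  set IL := I.map (kp A) with hIL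
  set Ib := IL.comap (kk A) with hIb
  have hIbm : Ib.map (kk A) = IL := map_comap_kk _
  have hqx : ∀ i, kk A (q i) - T M * kp A (xq i) ∈ IL ^ 2 := fun i => by
    have := hbx (some i); rwa [hbe] at this
  have hhx : kk A h - T M * kp A xh ∈ IL ^ 2 := by
    have := hbx none; rwa [hbe] at this
  have hqrow : Row (e.map Polynomial.C) q := by
    apply Row.of_map (kk A) kk_inj
    rw [map_C_kk]
    have h1 : (fun i => kk A (q i)) = cL • (fun i => kp A (aq i)) + dL • (fun i => kp A (xq i)) := by
      ext1 i
      rw [hq]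
      exact hb (some i)
    have h2 := harow.map (kp A)
    have h3 := hxrow.map (kp A)
    rw [map_C_kp] at h2 h3
    rw [h1]
    exact (h2.smul _).add (h3.smul _)
  have hIL2 : IL ^ 2 ≤ IL := Ideal.pow_le_self two_ne_zero
  have hqI : spn q h ≤ Ib := by
    refine spn_le.2 ⟨fun i => ?_, ?_⟩
    · have : kk A (q i) = (kk A (q i) - T M * kp A (xq i)) + T M * kp A (xq i) := by ring
      rw [hIb, Ideal.mem_comap, this]
      exact IL.add_mem (hIL2 (hqx i)) (IL.mul_mem_left _ (Ideal.mem_map_of_mem _ (hxI (q_mem _ _ i))))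
    · have : kk A h = (kk A h - T M * kp A xh) + T M * kp A xh := by ring
      rw [hIb, Ideal.mem_comap, this]
      exact IL.add_mem (hIL2 hhx) (IL.mul_mem_left _ (Ideal.mem_map_of_mem _ (hxI (h_mem _ _))))
  have hsat : ∀ b, X * b ∈ Ib → b ∈ Ib := by
    intro b hb
    rw [hIb, Ideal.mem_comap, map_mul, kk_X] at hb
    exact T_mul_mem 1 hb
  obtain ⟨q2, N', M', J', J1, hq2row, hq2q, hJJ, hJ1, hq2J, htJ, hSJ, hM', hdim⟩ :=
    step23 e he m δ η hr hδ hδη hηm Ib (fun Q hQ hX hI => height_trans hη Q hQ hX hI) hsat q h s1 M1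
      hqrow hqI hs1 hM1
  have hJm : J'.map (kk A) = IL := by
    apply le_antisymm
    · rw [← hIbm]; exact Ideal.map_mono (hJJ.trans hJ1)
    · rw [← hIbm, Ideal.map_le_iff_le_comap]
      intro β hβ
      rw [Ideal.mem_comap]
      apply T_mul_mem (M' : ℤ)
      rw [← kk_Xpow, ← map_mul]
      exact Ideal.mem_map_of_mem _ (hM' β hβ)
  have hg1 : s.reverse.Monic := by
    rw [Monic, reverse_leadingCoeff, trailingCoeff_eq_coeff_zero]
    · exact hs
    · rw [mem_S1.1 hs]; exact one_ne_zero
  have hg1I : s.reverse ∈ Ib := by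
    rw [hIb, Ideal.mem_comap, kp_reverse]
    exact IL.mul_mem_right _ (Ideal.mem_map_of_mem _ hsI)
  have hkksq : ∀ y, y ∈ Ib ^ 2 → kk A y ∈ IL ^ 2 := by
    intro y hy
    rw [← hIbm, ← Ideal.map_pow]
    exact Ideal.mem_map_of_mem _ hy
  have hq2x : ∀ i, kk A (q2 i) - T M * kp A (xq i) ∈ IL ^ 2 := fun i => by
    have : kk A (q2 i) - T M * kp A (xq i) = kk A (q2 i - q i) + (kk A (q i) - T M * kp A (xq i)) := by
      rw [map_sub]; ring
    rw [this]
    exact Ideal.add_mem _ (hkksq _ (hq2q i)) (hqx i)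
  have hPJ : ∀ β ∈ J', ∃ P : ℕ, X ^ P * β ∈ spn q2 (X ^ N' * h) ⊔ J' ^ 2 := by
    intro β hβ
    rw [← kk_mem_map, Ideal.map_sup, Ideal.map_pow, hJm]
    have h1 : kk A β ∈ IL := by rw [← hJm]; exact Ideal.mem_map_of_mem _ hβ
    have h2 : IL = (spn xq xh).map (kp A) ⊔ IL ^ 2 := by
      rw [hIL, ← Ideal.map_pow, ← Ideal.map_sup, hx]
    rw [h2] at h1
    refine (sup_le ?_ le_sup_right : _ ≤ (spn q2 (X ^ N' * h)).map (kk A) ⊔ IL ^ 2) h1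
    rw [map_spn]
    refine spn_le.2 ⟨fun i => ?_, ?_⟩
    · apply T_mul_mem (M : ℤ)
      have : T M * kp A (xq i) = kk A (q2 i) - (kk A (q2 i) - T M * kp A (xq i)) := by ring
      rw [this]
      exact Ideal.sub_mem _ (Ideal.mem_sup_left (Ideal.mem_map_of_mem _ (q_mem _ _ i)))
        (Ideal.mem_sup_right (hq2x i))
    · apply T_mul_mem (M : ℤ)
      apply T_mul_mem (N' : ℤ)
      have : T N' * (T M * kp A xh) = kk A (X ^ N' * h) - T N' * (kk A h - T M * kp A xh) := by
        rw [map_mul, kk_Xpow]; ring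
      rw [this]
      exact Ideal.sub_mem _ (Ideal.mem_sup_left (Ideal.mem_map_of_mem _ (h_mem _ _)))
        (Ideal.mem_sup_right (Ideal.mul_mem_left _ _ hhx))
  obtain ⟨q', h', k, hq'row, hq'q, hh't, hh'm, hdeg, hkJ, hkU⟩ := step4 e he m hr J' J1 hJJ hdim q2
    (X ^ N' * h) (X ^ M' * s.reverse) (M + N') hq2row hq2J htJ ((monic_X_pow M').mul hg1)
    (hM' _ hg1I) hSJ hPJ
  have hkI : Polynomial.C k ∈ I := by
    have h1 : kk A (Polynomial.C k) ∈ IL := hJ1 hkJ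
    rw [kk_C, ← kp_C] at h1
    exact kp_mem_of hs (I.mul_mem_right _ hsI) h1
  have hkksq' : ∀ y, y ∈ J' ^ 2 → kk A y ∈ IL ^ 2 := by
    intro y hy
    rw [← hJm, ← Ideal.map_pow]
    exact Ideal.mem_map_of_mem _ hy
  have hTT : ∀ n : ℤ, (T (-n) * T n : A[T;T⁻¹]) = 1 := fun n => by
    rw [← T_add, neg_add_cancel, T_zero]
  have hTMN : (T (-((M + N' : ℕ) : ℤ)) : A[T;T⁻¹]) = T (-(M : ℤ)) * T (-(N' : ℤ)) := by
    rw [← T_add]; congr 1; push_cast; ring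
  obtain ⟨zq, zh, hzrow, hzq, hzh, ⟨r1, hr1, hr1z⟩, hkz⟩ := step5 e ψ1 p1 hψ hψp I (s ^ 2)
    ((S1 A).pow_mem hs 2) (Ideal.pow_mem_pow hsI 2) xq xh
    ((T (-(M : ℤ)) : A[T;T⁻¹]) • fun i => kk A (q' i)) (T (-((M + N' : ℕ) : ℤ)) * kk A h') k h'.reverse
    (h'.natDegree - (M + N')) (reverse_S1 hh'm) (by
      have := hq'row.map (kk A)
      rw [map_C_kk] at this
      exact this.smul _) (by
      intro i
      have : ((T (-(M : ℤ)) : A[T;T⁻¹]) • fun i => kk A (q' i)) i - kp A (xq i) =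
          T (-(M : ℤ)) * (kk A (q' i - q2 i) + (kk A (q2 i) - T M * kp A (xq i))) := by
        rw [Pi.smul_apply, smul_eq_mul, map_sub]
        linear_combination (kp A (xq i)) * (hTT M)
      rw [this]
      exact Ideal.mul_mem_left _ _ (Ideal.add_mem _ (hkksq' _ (hq'q i)) (hq2x i))) (by
      have : T (-((M + N' : ℕ) : ℤ)) * kk A h' - kp A xh =
          T (-((M + N' : ℕ) : ℤ)) * kk A (h' - X ^ N' * h) +
            T (-(M : ℤ)) * (kk A h - T M * kp A xh) := by
        rw [map_sub, map_mul, kk_Xpow, hTMN]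
        linear_combination (kp A xh) * (hTT M) + (T (-(M : ℤ)) * kk A h) * hTT N'
      rw [this]
      exact Ideal.add_mem _ (Ideal.mul_mem_left _ _ (hkksq' _ hh't)) (Ideal.mul_mem_left _ _ hhx)) (by
      intro y hy
      rw [← hIL, ← hJm] at hy
      have h1 := span_mul_map (kk A) J' (spn q' h') _ hkU y hy
      rw [kk_C, map_spn] at h1
      refine (spn_le.2 ⟨fun i => ?_, ?_⟩ : spn (fun i => kk A (q' i)) (kk A h') ≤ _) h1
      · apply T_mul_mem (-(M : ℤ))
        exact q_mem ((T (-(M : ℤ)) : A[T;T⁻¹]) • fun i => kk A (q' i)) _ i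
      · apply T_mul_mem (-((M + N' : ℕ) : ℤ))
        exact h_mem _ _) (by
      rw [kp_reverse', ← mul_assoc, ← T_add, mul_comm]
      congr 2
      rw [Nat.cast_sub hdeg]; push_cast; ring)
  exact step6 e I xq xh hxI zq zh k hkI hzrow hzq hzh r1 hr1 hr1z hkz
end core
end LiftAT
end file8

section file9
open scoped TensorProduct
namespace LiftAT
section final
variable {A : Type*} [CommRing A]

lemma gens {P : Type*} [AddCommGroup P] [Module A P] (Q : Submodule A P) (E : P ≃ₗ[A] Q × A) {N : ℕ}
    (π : (Fin N → A) →ₗ[A] Q) (σ : Q →ₗ[A] (Fin N → A)) (h : π ∘ₗ σ = LinearMap.id) :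
    ∃ (gq : Fin N → A[X] ⊗[A] P) (gh : A[X] ⊗[A] P),
      Submodule.span A[X] (insert gh (Set.range gq)) = ⊤ ∧
      (∀ j, gq j = ∑ i, C (LinearMap.toMatrix' (σ ∘ₗ π) i j) • gq i) ∧
      ∀ (zq : Fin N → A[X]) (zh : A[X]), Row ((LinearMap.toMatrix' (σ ∘ₗ π)).map C) zq →
        ∃ Φ : A[X] ⊗[A] P →ₗ[A[X]] A[X], (∀ j, Φ (gq j) = zq j) ∧ Φ gh = zh := by
  have hπσ : ∀ x, π (σ x) = x := fun x => LinearMap.congr_fun h x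
  have hsum : ∀ v : Fin N → A, π v = ∑ i, v i • π (Pi.single i 1) := by
    intro v
    conv_lhs => rw [pi_eq_sum_univ' v]
    simp only [map_sum, map_smul]
  let ι1 : Q →ₗ[A] P := E.symm.toLinearMap ∘ₗ LinearMap.inl A Q A
  let gq : Fin N → A[X] ⊗[A] P := fun i => 1 ⊗ₜ ι1 (π (Pi.single i 1))
  let gh : A[X] ⊗[A] P := 1 ⊗ₜ E.symm (0, 1)
  have hιsum : ∀ v : Fin N → A, (1 : A[X]) ⊗ₜ[A] ι1 (π v) = ∑ i, C (v i) • gq i := by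
    intro v
    rw [hsum, map_sum, TensorProduct.tmul_sum]
    refine Finset.sum_congr rfl fun i _ => ?_
    rw [map_smul, ← TensorProduct.smul_tmul, TensorProduct.smul_tmul', smul_eq_C_mul, smul_eq_mul]
  refine ⟨gq, gh, ?_, ?_, ?_⟩
  · rw [eq_top_iff]
    intro x _
    induction x using TensorProduct.induction_on with
    | zero => exact Submodule.zero_mem _
    | add x y hx hy => exact Submodule.add_mem _ (hx trivial) (hy trivial)
    | tmul f p =>
      have h1 : p = ι1 (E p).1 + (E p).2 • E.symm (0, 1) := by
        apply E.injective
        rw [map_add, map_smul, E.apply_symm_apply]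
        simp only [ι1, LinearMap.comp_apply, LinearEquiv.coe_coe, E.apply_symm_apply]
        ext <;> simp
      have h2 : f ⊗ₜ[A] p = f • ((1 : A[X]) ⊗ₜ[A] p) := by
        rw [TensorProduct.smul_tmul', smul_eq_mul, mul_one]
      rw [h2]
      apply Submodule.smul_mem
      rw [h1, TensorProduct.tmul_add]
      apply Submodule.add_mem
      · rw [← hπσ (E p).1, hιsum]
        exact Submodule.sum_mem _ fun i _ => Submodule.smul_mem _ _
          (Submodule.subset_span (Set.mem_insert_of_mem _ ⟨i, rfl⟩))
      · rw [← TensorProduct.smul_tmul]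
        have h3 : ((E p).2 • (1 : A[X])) ⊗ₜ[A] (E.symm (0, 1)) = C (E p).2 • gh := by
          rw [TensorProduct.smul_tmul', smul_eq_C_mul, smul_eq_mul]
        rw [h3]
        exact Submodule.smul_mem _ _ (Submodule.subset_span (Set.mem_insert _ _))
  · intro j
    have h1 := hιsum (σ (π (Pi.single j 1)))
    rw [hπσ] at h1
    simp only [LinearMap.toMatrix'_apply]
    exact h1
  · intro zq zh hz
    let Φ0 : P →ₗ[A] A[X] :=
      ((Fintype.linearCombination A zq) ∘ₗ σ ∘ₗ LinearMap.fst A Q A +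
        (LinearMap.toSpanSingleton A A[X] zh) ∘ₗ LinearMap.snd A Q A) ∘ₗ E.toLinearMap
    refine ⟨LinearMap.liftBaseChange A[X] Φ0, fun j => ?_, ?_⟩
    · have h1 := congrFun hz j
      rw [← h1]
      simp only [gq, ι1, LinearMap.liftBaseChange_tmul, one_smul, Φ0, LinearMap.comp_apply, LinearEquiv.coe_coe,
        E.apply_symm_apply, LinearMap.add_apply, LinearMap.inl_apply, LinearMap.fst_apply, LinearMap.snd_apply,
        map_zero, add_zero, Fintype.linearCombination_apply, Matrix.vecMul, dotProduct, Matrix.map_apply,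
        LinearMap.toMatrix'_apply]
      refine Finset.sum_congr rfl fun i _ => ?_
      rw [smul_eq_C_mul, mul_comm]
    · simp [gh, Φ0]

lemma exists_S1 (I : Ideal A[X])
    (hIjac : I ⊔ Ideal.map (C : A →+* A[X]) (Ideal.jacobson (⊥ : Ideal A)) = ⊤) :
    ∃ s ∈ S1 A, s ∈ I := by
  have h1 : (1 : A[X]) ∈ I ⊔ Ideal.map (C : A →+* A[X]) (Ideal.jacobson (⊥ : Ideal A)) :=
    hIjac ▸ Submodule.mem_top
  obtain ⟨i, hi, j, hj, hij⟩ := Submodule.mem_sup.1 h1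
  have hj0 := (Ideal.mem_map_C_iff.1 hj) 0
  have hi0 : i.coeff 0 = - j.coeff 0 * 1 + 1 := by
    have := congrArg (fun p => coeff p 0) hij
    simp only [coeff_add, coeff_one_zero] at this
    linear_combination this
  have hu : IsUnit (i.coeff 0) := by
    rw [hi0]
    exact Ideal.mem_jacobson_bot.1 (neg_mem hj0) 1
  obtain ⟨u, hu⟩ := hu
  refine ⟨C (↑u⁻¹ : A) * i, ?_, I.mul_mem_left _ hi⟩
  rw [mem_S1, coeff_C_mul, ← hu, Units.inv_mul]

lemma extract (W : Submonoid A[X]) (hWm : ∀ f ∈ W, f.Monic) {M : Type*} [AddCommGroup M] [Module A[X] M] [IsNoetherianRing A] {N : ℕ} (e : Matrix (Fin N) (Fin N) A)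
    (gq : Fin N → M) (gh : M) (hspan : Submodule.span A[X] (insert gh (Set.range gq)) = ⊤)
    (hge : ∀ j, gq j = ∑ i, C (e i j) • gq i)
    (I : Ideal A[X]) (φ : M →ₗ[A[X]] A[X])
    (Φ₁ : LocalizedModule W M
            →ₗ[Localization W] Localization W)
    (hΦ₁range : LinearMap.range Φ₁
      = Ideal.map (algebraMap A[X] (Localization W)) I)
    (hΦ₁lift : ∀ p : M,
      Φ₁ (LocalizedModule.mkLinearMap W M p)
          - algebraMap A[X] (Localization W) (φ p)
        ∈ Ideal.map (algebraMap A[X] (Localization W)) (I ^ 2)) :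
    ∃ (aq : Fin N → A[X]) (ah f g : A[X]), Row (e.map C) aq ∧ f.Monic ∧ g.Monic ∧
      (∀ i, aq i - f * φ (gq i) ∈ I ^ 2) ∧ ah - f * φ gh ∈ I ^ 2 ∧ ∀ b ∈ I, g * b ∈ spn aq ah := by
  have hinj : Function.Injective (algebraMap A[X] (Localization W)) := IsLocalization.injective (M := W) (Localization W)
    (fun f hf => (hWm f hf).mem_nonZeroDivisors)
  let Ψ : M →ₗ[A[X]] (Localization W) := (Φ₁.restrictScalars A[X]) ∘ₗ LocalizedModule.mkLinearMap W M
  have hΨ : ∀ p, Ψ p = Φ₁ (LocalizedModule.mkLinearMap W M p) := fun p => rfl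
  obtain ⟨⟨b, hbW⟩, hb⟩ := IsLocalization.exist_integer_multiples_of_finite W
    (fun o : Option (Fin N) => Ψ (o.elim gh gq))
  choose a0 ha0 using hb
  simp only at ha0
  obtain ⟨w, hw, hwu⟩ := unif W
    (Ideal.span (Set.range fun o : Option (Fin N) => a0 o - b * φ (o.elim gh gq))) (I ^ 2)
    ((isNoetherianRing_iff_ideal_fg _).1 inferInstance _) (by
      intro y hy
      have h1 : algebraMap A[X] (Localization W) y ∈ (I ^ 2).map (algebraMap A[X] (Localization W)) := by
        have h2 : Ideal.span (Set.range fun o : Option (Fin N) => a0 o - b * φ (o.elim gh gq)) ≤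
            ((I ^ 2).map (algebraMap A[X] (Localization W))).comap (algebraMap A[X] (Localization W)) := by
          rw [Ideal.span_le]
          rintro _ ⟨o, rfl⟩
          change algebraMap A[X] (Localization W) (a0 o - b * φ (o.elim gh gq)) ∈ (I ^ 2).map (algebraMap A[X] (Localization W))
          have h3 := Ideal.mul_mem_left _ (algebraMap A[X] (Localization W) b) (hΦ₁lift (o.elim gh gq))
          rw [map_sub, map_mul, ha0, Algebra.smul_def, hΨ, ← mul_sub]
          exact h3
        exact h2 hy
      exact (IsLocalization.algebraMap_mem_map_algebraMap_iff W (Localization W) _ _).1 h1)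
  have hwo : ∀ o : Option (Fin N), w * (a0 o - b * φ (o.elim gh gq)) ∈ I ^ 2 := fun o =>
    hwu _ (Ideal.subset_span ⟨o, rfl⟩)
  have hA : ∀ o : Option (Fin N), algebraMap A[X] (Localization W) (w * a0 o) = (w * b) • Ψ (o.elim gh gq) := by
    intro o
    rw [map_mul, ha0, mul_smul, Algebra.smul_def w]
  set aq : Fin N → A[X] := fun i => w * a0 (some i) with haq
  set ah : A[X] := w * a0 none with hah
  have hspn : ∀ x : M, ∃ y ∈ spn aq ah, algebraMap A[X] (Localization W) y = (w * b) • Ψ x := by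
    have h1 : (⊤ : Submodule A[X] M) ≤ Submodule.comap ((w * b) • Ψ)
        (Submodule.map (Algebra.linearMap A[X] (Localization W)) (spn aq ah)) := by
      rw [← hspan, Submodule.span_le]
      rintro _ (rfl | ⟨i, rfl⟩)
      · exact ⟨ah, h_mem _ _, hA none⟩
      · exact ⟨aq i, q_mem _ _ i, hA (some i)⟩
    intro x
    obtain ⟨y, hy, hyx⟩ := h1 (Submodule.mem_top (x := x))
    exact ⟨y, hy, hyx⟩
  obtain ⟨g, hg, hgI⟩ := unif W I (spn aq ah) ((isNoetherianRing_iff_ideal_fg _).1 inferInstance _) (by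
    intro i hi
    have h1 : algebraMap A[X] (Localization W) i ∈ LinearMap.range Φ₁ := by
      rw [hΦ₁range]; exact Ideal.mem_map_of_mem _ hi
    obtain ⟨z, hz⟩ := h1
    induction z using LocalizedModule.induction_on with
    | h m s =>
      obtain ⟨y, hy, hyx⟩ := hspn m
      refine ⟨w * b * s, W.mul_mem (W.mul_mem hw hbW) s.2, ?_⟩
      have h2 : algebraMap A[X] (Localization W) s * algebraMap A[X] (Localization W) i = Ψ m := by
        rw [hΨ, ← hz, ← smul_eq_mul, ← map_smul, algebraMap_smul, LocalizedModule.smul'_mk,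
          LocalizedModule.mkLinearMap_apply]
        congr 1
        exact LocalizedModule.mk_cancel s m
      have h3 : w * b * s * i = y := by
        apply hinj
        rw [hyx, ← h2, Algebra.smul_def, map_mul, map_mul _ (w * b), mul_assoc]
      rw [h3]; exact hy)
  refine ⟨aq, ah, w * b, g, ?_, hWm _ (W.mul_mem hw hbW), hWm _ hg, fun i => ?_, ?_, hgI⟩
  · apply Row.of_map (algebraMap A[X] (Localization W)) hinj
    ext j
    have h1 : (fun i => algebraMap A[X] (Localization W) (aq i)) = fun i => (w * b) • Ψ (gq i) := by
      ext1 i; exact hA (some i)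
    rw [h1]
    have h2 : algebraMap A[X] (Localization W) (aq j) = (w * b) • Ψ (gq j) := hA (some j)
    conv_rhs => rw [h2, hge j]
    simp only [map_sum, map_smul, Matrix.vecMul, dotProduct, Matrix.map_apply, Finset.smul_sum]
    refine Finset.sum_congr rfl fun i _ => ?_
    simp only [Algebra.smul_def]
    ring
  · have := hwo (some i)
    convert this using 1
    simp only [haq, Option.elim]; ring
  · have := hwo none
    convert this using 1
    simp only [hah, Option.elim]; ring

end final
end LiftAT
end file9

namespace LiftAT
lemma num1 {R : Type*} [CommRing R] [Nontrivial R] {n : ℕ} (h : ringKrullDim R + 2 ≤ (n : WithBot ℕ∞)) :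
    ∃ m : ℕ, n = m + 2 ∧ ringKrullDim R ≤ m := by
  have h0 : (0 : WithBot ℕ∞) ≤ ringKrullDim R := ringKrullDim_nonneg_of_nontrivial
  obtain ⟨d, hd⟩ := WithBot.ne_bot_iff_exists.1 (ne_bot_of_le_ne_bot (by simp) h0)
  rw [← hd] at h ⊢
  have h1 : d + 2 ≤ (n : ℕ∞) := WithBot.coe_le_coe.1 h
  have hdt : d ≠ ⊤ := by rintro rfl; simp at h1
  obtain ⟨d, rfl⟩ := ENat.ne_top_iff_exists.1 hdt
  have h2 : d + 2 ≤ n := by exact_mod_cast h1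
  have h3 : (d : ℕ∞) ≤ ((n - 2 : ℕ) : ℕ∞) := by exact_mod_cast (by omega : d ≤ n - 2)
  exact ⟨n - 2, by omega, WithBot.coe_le_coe.2 h3⟩

lemma num2 {R : Type*} [CommRing R] [Nontrivial R] {m : ℕ} {t : ℕ∞}
    (h : ringKrullDim R + 2 ≤ ((m + 2 : ℕ) : WithBot ℕ∞) + ((t : ℕ∞) : WithBot ℕ∞)) (ht : t ≤ (m + 2 : ℕ)) :
    ∃ δ η : ℕ, t = η ∧ ringKrullDim R ≤ δ ∧ δ ≤ m + η ∧ η ≤ m + 2 := by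
  have h0 : (0 : WithBot ℕ∞) ≤ ringKrullDim R := ringKrullDim_nonneg_of_nontrivial
  obtain ⟨d, hd⟩ := WithBot.ne_bot_iff_exists.1 (ne_bot_of_le_ne_bot (by simp) h0)
  obtain ⟨η, rfl⟩ := ENat.ne_top_iff_exists.1 (ne_top_of_le_ne_top (ENat.natCast_ne_top _) ht)
  rw [← hd] at h ⊢
  have h0 : d + 2 ≤ ((m + 2 : ℕ) : ℕ∞) + (η : ℕ∞) := WithBot.coe_le_coe.1 h
  have h1 : d + 2 ≤ ((m + 2 + η : ℕ) : ℕ∞) := by rw [Nat.cast_add]; exact h0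
  have hdt : d ≠ ⊤ := by rintro rfl; simp at h1
  obtain ⟨d, rfl⟩ := ENat.ne_top_iff_exists.1 hdt
  have h2 : d + 2 ≤ m + 2 + η := by exact_mod_cast h1
  exact ⟨d, η, rfl, le_rfl, by omega, by exact_mod_cast ht⟩
end LiftAT

/-- Let `A` be Noetherian with Jacobson radical `𝒥`, `I ⊆ A[T]` an ideal with
`I + 𝒥A[T] = A[T]`, `n ≥ 1` with `dim (A/𝒥) ≤ n - 2`, and `P` a finitely generated
projective `A`-module of constant rank `n ≥ dim A[T] - ht I + 2`.  If a surjection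
`φ : P[T] ↠ I/I²` lifts over `A(T)` to a surjection `Φ₁ : P(T) ↠ I·A(T)`, then `φ`
lifts to a surjection `Φ : P[T] ↠ I`. -/
theorem lift_from_AT {A : Type*} [CommRing A] [IsNoetherianRing A]
    {P : Type*} [AddCommGroup P] [Module A P] [Module.Finite A P] [Module.Projective A P]
    (n : ℕ) (hpos : 0 < n)
    (hrank : ∀ p : PrimeSpectrum A, Module.rankAtStalk P p = n)
    (I : Ideal A[X])
    (hIjac : I ⊔ Ideal.map (Polynomial.C : A →+* A[X]) (Ideal.jacobson (⊥ : Ideal A)) = ⊤)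
    (hjacdim : ringKrullDim (A ⧸ Ideal.jacobson (⊥ : Ideal A)) + 2 ≤ (n : WithBot ℕ∞))
    (hht : ringKrullDim A[X] + 2 ≤ (n : WithBot ℕ∞) + ((idealHeight I : ℕ∞) : WithBot ℕ∞))
    (φ : TensorProduct A A[X] P →ₗ[A[X]] A[X])
    (hφ : LinearMap.range φ ≤ I)
    (hsurj : LinearMap.range φ ⊔ I ^ 2 = I)
    (Φ₁ : LocalizedModule (monicSubmonoid A) (TensorProduct A A[X] P)
            →ₗ[Localization (monicSubmonoid A)] Localization (monicSubmonoid A))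
    (hΦ₁range : LinearMap.range Φ₁
      = Ideal.map (algebraMap A[X] (Localization (monicSubmonoid A))) I)
    (hΦ₁lift : ∀ p : TensorProduct A A[X] P,
      Φ₁ (LocalizedModule.mkLinearMap (monicSubmonoid A) (TensorProduct A A[X] P) p)
          - algebraMap A[X] (Localization (monicSubmonoid A)) (φ p)
        ∈ Ideal.map (algebraMap A[X] (Localization (monicSubmonoid A))) (I ^ 2)) :
    ∃ Φ : TensorProduct A A[X] P →ₗ[A[X]] A[X],
      LinearMap.range Φ = I ∧ ∀ p : TensorProduct A A[X] P, Φ p - φ p ∈ I ^ 2 := by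
  classical
  rcases subsingleton_or_nontrivial A with hA | hA
  · have : Subsingleton A[X] := inferInstance
    exact ⟨0, Subsingleton.elim _ _, fun p => by
      rw [Subsingleton.elim ((0 : TensorProduct A A[X] P →ₗ[A[X]] A[X]) p - φ p) 0]; exact Ideal.zero_mem _⟩
  have hJtop : Ideal.jacobson (⊥ : Ideal A) ≠ ⊤ := by
    rw [Ne, Ideal.jacobson_eq_top_iff]; exact bot_ne_top
  have hnt : Nontrivial (A ⧸ Ideal.jacobson (⊥ : Ideal A)) := Ideal.Quotient.nontrivial_iff.2 hJtop
  obtain ⟨m, rfl, hm⟩ : ∃ m : ℕ, n = m + 2 ∧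
      ringKrullDim (A ⧸ Ideal.jacobson (⊥ : Ideal A)) ≤ m := LiftAT.num1 hjacdim
  have hlt1 : ringKrullDim (A ⧸ Ideal.jacobson (⊥ : Ideal A)) < (m + 1 : ℕ) :=
    lt_of_le_of_lt hm (by exact_mod_cast Nat.lt_succ_self m)
  have hlt2 : ringKrullDim (A ⧸ Ideal.jacobson (⊥ : Ideal A)) < (m + 1 + 1 : ℕ) :=
    lt_of_le_of_lt hm (by exact_mod_cast (by omega : m < m + 1 + 1))
  obtain ⟨Q, hQf, hQp, ⟨E⟩, hQr⟩ := LiftAT.split_free (r := m + 1) hrank hlt2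
  obtain ⟨N, π, σ, hπσ⟩ := LiftAT.exists_pres A Q
  obtain ⟨gq, gh, hspan, hge, hbuild⟩ := LiftAT.gens Q E π σ hπσ
  set e := LinearMap.toMatrix' (σ ∘ₗ π) with he
  have hee : e * e = e := LiftAT.toMatrix_idem π σ hπσ
  have hr : LiftAT.RankCond e (m + 1) := LiftAT.rankCond_of_rank π σ hπσ hQr
  have hrange : ∀ Ψ : TensorProduct A A[X] P →ₗ[A[X]] A[X],
      LinearMap.range Ψ = LiftAT.spn (fun i => Ψ (gq i)) (Ψ gh) := by
    intro Ψ
    rw [LinearMap.range_eq_map, ← hspan, Submodule.map_span, Set.image_insert_eq, ← Set.range_comp]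
    rfl
  by_cases hI : I = ⊤
  · obtain ⟨Φ, -, h2⟩ := hbuild 0 1 (by rw [LiftAT.Row, Matrix.zero_vecMul])
    refine ⟨Φ, ?_, fun p => ?_⟩
    · rw [hrange, hI, h2, Ideal.eq_top_iff_one]
      exact LiftAT.h_mem _ _
    · rw [hI, Ideal.top_pow]; exact Submodule.mem_top
  obtain ⟨ψ1, p1, hψ, -, hψp⟩ := LiftAT.serre e hee hr hlt1
  obtain ⟨s, hs, hsI⟩ := LiftAT.exists_S1 I hIjac
  obtain ⟨Mx, hMx, hIMx⟩ := Ideal.exists_le_maximal I hI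
  obtain ⟨Q0, hQ0, -⟩ := Ideal.exists_minimalPrimes_le (J := Mx) hIMx
  have hQ0h := LiftAT.height_le_rank hrank I φ hφ hsurj Q0 hQ0
  have hQ0p : Q0.IsPrime := hQ0.1.1
  have hhle : ∀ Q : Ideal A[X], Q.IsPrime → I ≤ Q → idealHeight I ≤ Q.height := by
    intro Q hQ hIQ
    have h1 : idealHeight I ≤ Order.height (⟨Q, hQ⟩ : PrimeSpectrum A[X]) := by
      unfold idealHeight
      exact iInf₂_le (⟨Q, hQ⟩ : PrimeSpectrum A[X]) hIQ
    rwa [← PrimeSpectrum.height_eq_orderHeight] at h1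
  obtain ⟨δ, η, hη, hδ, hδη, hηm⟩ := LiftAT.num2 hht ((hhle Q0 hQ0p hQ0.1.2).trans hQ0h)
  obtain ⟨aq, ah, f, g, harow, hf, hg, haq, hah, hgI⟩ :=
    LiftAT.extract (monicSubmonoid A) (fun _ h => h) e gq gh hspan hge I φ Φ₁ hΦ₁range hΦ₁lift
  have hxrow : LiftAT.Row (e.map C) (fun i => φ (gq i)) := by
    funext j
    conv_rhs => rw [hge j]
    simp only [map_sum, map_smul, Matrix.vecMul, dotProduct, Matrix.map_apply, smul_eq_mul]
    exact Finset.sum_congr rfl fun i _ => mul_comm _ _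
  obtain ⟨yq, yh, hyrow, hyq, hyh, hyI⟩ := LiftAT.core e hee m δ η hr hδ hδη hηm ψ1 p1 hψ hψp I
    (fun Q hQ hIQ => hη ▸ hhle Q hQ hIQ) s hs hsI (fun i => φ (gq i)) aq (φ gh) ah hxrow harow
    (by rw [← hrange]; exact hsurj) f g hf hg haq hah hgI
  obtain ⟨Φ, hΦq, hΦh⟩ := hbuild yq yh hyrow
  refine ⟨Φ, ?_, ?_⟩
  · rw [hrange, hΦh, funext hΦq, hyI]
  · have h1 : (⊤ : Submodule A[X] (TensorProduct A A[X] P)) ≤ Submodule.comap (Φ - φ) (I ^ 2) := by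
      rw [← hspan, Submodule.span_le]
      rintro x (hx | ⟨i, rfl⟩)
      · rw [hx]
        change Φ gh - φ gh ∈ I ^ 2
        rw [hΦh]; exact hyh
      · change Φ (gq i) - φ (gq i) ∈ I ^ 2
        rw [hΦq]; exact hyq i
    exact fun p => h1 (Submodule.mem_top (x := p))
end

section
/- Serre's splitting theorem: Let A be a commutative Noetherian ring with Jacobson radical 𝒥(A), and let P be a finitely generated projective A-module of constant rank n with n > dim(A/𝒥(A)). Then P ≅ Q ⊕ A for some A-module Q; equivalently, P has a unimodular element. -/
open TensorProduct in
/-- The fibre dimension of `M` at `q`. -/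
noncomputable def fibDim {A : Type*} [CommRing A] (M : Type*) [AddCommGroup M] [Module A M]
    (q : PrimeSpectrum A) : ℕ :=
  Module.finrank q.asIdeal.ResidueField (q.asIdeal.ResidueField ⊗[A] M)

open TensorProduct in
/-- The value of `x` in the fibre of `M` at `q` is zero. -/
def FibZero {A : Type*} [CommRing A] {M : Type*} [AddCommGroup M] [Module A M]
    (q : PrimeSpectrum A) (x : M) : Prop :=
  (1 : q.asIdeal.ResidueField) ⊗ₜ[A] x = 0

open TensorProduct in
lemma ker_baseChange_mkQ_span {A : Type*} [CommRing A] {M : Type*} [AddCommGroup M] [Module A M]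
    (K : Type*) [Field K] [Algebra A K] (p : M) :
    LinearMap.ker ((Submodule.span A {p}).mkQ.baseChange K) =
      Submodule.span K {(1 : K) ⊗ₜ[A] p} := by
  apply le_antisymm
  · intro x hx
    have hex : Function.Exact (LinearMap.toSpanSingleton A M p) (Submodule.span A {p}).mkQ := by
      rw [LinearMap.exact_iff, Submodule.ker_mkQ, LinearMap.range_toSpanSingleton]
    have h2 := lTensor_exact K hex (Submodule.mkQ_surjective _)
    obtain ⟨y, hy⟩ := (h2 x).1 hx
    rw [← hy]
    clear hy hx
    induction y using TensorProduct.induction_on with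
    | zero => simp
    | tmul k r =>
      rw [LinearMap.lTensor_tmul, LinearMap.toSpanSingleton_apply, Submodule.mem_span_singleton]
      refine ⟨r • k, ?_⟩
      rw [TensorProduct.smul_tmul', smul_eq_mul, mul_one, TensorProduct.smul_tmul]
    | add a b ha hb => rw [map_add]; exact Submodule.add_mem _ ha hb
  · rw [Submodule.span_le, Set.singleton_subset_iff]
    have : (Submodule.span A {p}).mkQ p = 0 := by
      simp [Submodule.mem_span_singleton_self]
    simp only [SetLike.mem_coe, LinearMap.mem_ker, LinearMap.baseChange_tmul, this, tmul_zero]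

section
variable {A : Type*} [CommRing A] {M : Type*} [AddCommGroup M] [Module A M]

open TensorProduct in
lemma fibDim_quot_add [Module.Finite A M] (p : M) (q : PrimeSpectrum A) :
    fibDim (M ⧸ Submodule.span A {p}) q +
      Module.finrank q.asIdeal.ResidueField
        (Submodule.span q.asIdeal.ResidueField
          {(1 : q.asIdeal.ResidueField) ⊗ₜ[A] p}) = fibDim M q := by
  have h := LinearMap.finrank_range_add_finrank_ker
    ((Submodule.span A {p}).mkQ.baseChange q.asIdeal.ResidueField)
  rw [ker_baseChange_mkQ_span, LinearMap.range_eq_top.2, finrank_top] at h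
  · exact h
  · exact LinearMap.lTensor_surjective _ (Submodule.mkQ_surjective _)

lemma fibDim_quot_of_zero [Module.Finite A M] {p : M} {q : PrimeSpectrum A} (h : FibZero q p) :
    fibDim (M ⧸ Submodule.span A {p}) q = fibDim M q := by
  have := fibDim_quot_add p q
  rw [show _ = _ from h, Submodule.span_singleton_eq_bot.2 rfl, finrank_bot] at this
  simpa using this

lemma fibDim_quot_of_ne [Module.Finite A M] {p : M} {q : PrimeSpectrum A} (h : ¬ FibZero q p) :
    fibDim (M ⧸ Submodule.span A {p}) q + 1 = fibDim M q := by
  have := fibDim_quot_add p q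
  rwa [finrank_span_singleton h] at this

lemma fibDim_le [Module.Finite A M] (p : M) (q : PrimeSpectrum A) :
    fibDim M q ≤ fibDim (M ⧸ Submodule.span A {p}) q + 1 := by
  by_cases h : FibZero q p
  · rw [fibDim_quot_of_zero h]; omega
  · rw [fibDim_quot_of_ne h]

open TensorProduct in
lemma fibZero_mkQ {x : M} {q : PrimeSpectrum A} (N : Submodule A M) (h : FibZero q x) :
    FibZero q (N.mkQ x) := by
  have h' : (1 : q.asIdeal.ResidueField) ⊗ₜ[A] x = 0 := h
  have := congrArg (N.mkQ.baseChange q.asIdeal.ResidueField) h'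
  simpa [FibZero] using this

lemma exists_not_fibZero {q : PrimeSpectrum A} (h : fibDim M q ≠ 0) : ∃ p : M, ¬ FibZero q p := by
  by_contra! hc
  apply h
  have : Subsingleton (TensorProduct A q.asIdeal.ResidueField M) := by
    refine subsingleton_of_forall_eq 0 fun y => ?_
    induction y using TensorProduct.induction_on with
    | zero => rfl
    | tmul k r =>
      have h1 : TensorProduct.tmul A (1 : q.asIdeal.ResidueField) r = 0 := hc r
      have := congrArg (fun z => k • z) h1
      simpa [TensorProduct.smul_tmul'] using this
    | add a b ha hb => rw [ha, hb, add_zero]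
  exact Module.finrank_zero_of_subsingleton
end

lemma fibDim_semicont {A : Type*} [CommRing A] (k : ℕ) :
    ∀ (M : Type*) [AddCommGroup M] [Module A M] [Module.Finite A M] (q0 : PrimeSpectrum A),
    fibDim M q0 = k → ∃ f ∉ q0.asIdeal, ∀ q : PrimeSpectrum A, f ∉ q.asIdeal → fibDim M q ≤ k := by
  induction k with
  | zero =>
    intro M _ _ _ q0 h
    have h1 : q0 ∉ Module.support A M := by
      rw [Module.mem_support_iff_nontrivial_residueField_tensorProduct,
        not_nontrivial_iff_subsingleton]
      exact Module.finrank_zero_iff.1 h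
    rw [Module.mem_support_iff_of_finite, SetLike.not_le_iff_exists] at h1
    obtain ⟨f, hf, hf0⟩ := h1
    refine ⟨f, hf0, fun q hq => ?_⟩
    have h2 : q ∉ Module.support A M := by
      rw [Module.mem_support_iff_of_finite]
      exact fun hle => hq (hle hf)
    rw [Module.mem_support_iff_nontrivial_residueField_tensorProduct,
        not_nontrivial_iff_subsingleton] at h2
    exact (Module.finrank_zero_of_subsingleton).le
  | succ k ih =>
    intro M _ _ _ q0 h
    obtain ⟨p, hp⟩ := exists_not_fibZero (M := M) (q := q0) (by omega)
    obtain ⟨f, hf, hfq⟩ := ih (M ⧸ Submodule.span A {p}) q0 (by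
      have := fibDim_quot_of_ne hp; omega)
    exact ⟨f, hf, fun q hq => (fibDim_le p q).trans (by have := hfq q hq; omega)⟩

lemma fibDim_mono {A : Type*} [CommRing A] (M : Type*) [AddCommGroup M] [Module A M]
    [Module.Finite A M] {q0 q : PrimeSpectrum A} (h : q0 ≤ q) : fibDim M q0 ≤ fibDim M q := by
  obtain ⟨f, hf, hfq⟩ := fibDim_semicont _ M q rfl
  exact hfq q0 fun hh => hf (h hh)

/-- An infinite set of primes containing `J` accumulates at some prime containing `J`. -/
lemma exists_accum {A : Type*} [CommRing A] [IsNoetherianRing A] (J : Ideal A)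
    (T : Set (PrimeSpectrum A)) (hT : T.Infinite) (hJ : ∀ q ∈ T, J ≤ q.asIdeal) :
    ∃ q0 : PrimeSpectrum A, J ≤ q0.asIdeal ∧ ∀ f ∉ q0.asIdeal,
      ∃ q ∈ T, q0 < q ∧ f ∉ q.asIdeal := by
  let S : Set (Ideal A) := {I | J ≤ I ∧ {q ∈ T | I ≤ q.asIdeal}.Infinite}
  have hS : S.Nonempty := ⟨J, le_rfl, by
    convert hT using 1
    ext q; exact ⟨fun h => h.1, fun h => ⟨h, hJ q h⟩⟩⟩
  obtain ⟨(I : Ideal A), hI, hmax⟩ := set_has_maximal_iff_noetherian.2 (inferInstance : IsNoetherian A A) S hS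
  have key : ∀ a ∉ I, {q ∈ T | I ≤ q.asIdeal ∧ a ∈ q.asIdeal}.Finite := by
    intro a ha
    by_contra hc
    refine hmax (I ⊔ Ideal.span {a}) ⟨hI.1.trans le_sup_left, ?_⟩ ?_
    · intro hfin
      refine hc (hfin.subset ?_)
      rintro q ⟨hq, hIq, haq⟩
      exact ⟨hq, sup_le hIq ((Ideal.span_singleton_le_iff_mem _).2 haq)⟩
    · refine lt_of_le_of_ne le_sup_left fun h => ha ?_
      rw [h]
      exact Ideal.mem_sup_right (Ideal.mem_span_singleton_self a)
  have hprime : Ideal.IsPrime I := by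
    refine Ideal.isPrime_iff.2 ⟨?_, ?_⟩
    · rintro rfl
      apply hI.2
      convert Set.finite_empty
      ext q
      simp only [Set.mem_ofPred_eq, top_le_iff, Set.mem_empty_iff_false, iff_false, not_and]
      exact fun _ => q.isPrime.ne_top
    · intro a b hab
      by_contra! hc
      refine hI.2 (((key a hc.1).union (key b hc.2)).subset ?_)
      rintro q ⟨hq, hIq⟩
      rcases q.isPrime.mem_or_mem (hIq hab) with h | h
      · exact Or.inl ⟨hq, hIq, h⟩
      · exact Or.inr ⟨hq, hIq, h⟩
  refine ⟨⟨I, hprime⟩, hI.1, fun f hf => ?_⟩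
  obtain ⟨q, ⟨hq, hIq⟩, hn⟩ := (hI.2.sdiff ((key f hf).union (Set.finite_singleton ⟨I, hprime⟩))).nonempty
  simp only [Set.mem_union, Set.mem_ofPred_eq, Set.mem_singleton_iff, not_or] at hn
  refine ⟨q, hq, lt_of_le_of_ne hIq (Ne.symm hn.2), fun h => hn.1 ⟨hq, hIq, h⟩⟩

/-- Avoiding one coset for each of finitely many primes. -/
lemma avoid_cosets {A : Type*} [CommRing A] (B : PrimeSpectrum A → Set A)
    (T : Finset (PrimeSpectrum A))
    (h1 : ∀ q ∈ T, ∀ a, ∀ x ∈ q.asIdeal, a + x ∈ B q → a ∈ B q)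
    (h2 : ∀ q ∈ T, ∀ a x, a ∈ B q → a + x ∈ B q → x ∈ q.asIdeal) :
    ∃ a, ∀ q ∈ T, a ∉ B q := by
  classical
  induction T using Finset.strongInduction with
  | H T ih =>
    rcases T.eq_empty_or_nonempty with rfl | hne
    · exact ⟨0, by simp⟩
    obtain ⟨q, hq⟩ := T.exists_minimal hne
    obtain ⟨a, ha⟩ := ih (T.erase q) (Finset.erase_ssubset hq.1)
      (fun q' h => h1 q' (Finset.mem_of_mem_erase h)) (fun q' h => h2 q' (Finset.mem_of_mem_erase h))
    by_cases haq : a ∈ B q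
    · have hx : ∃ x, (∀ q' ∈ T.erase q, x ∈ q'.asIdeal) ∧ x ∉ q.asIdeal := by
        have : ¬ ((T.erase q).inf fun q' => q'.asIdeal) ≤ q.asIdeal := by
          rw [q.isPrime.inf_le']
          rintro ⟨q', hq', hle⟩
          exact (Finset.ne_of_mem_erase hq')
            (le_antisymm hle (hq.2 (Finset.mem_of_mem_erase hq') hle))
        obtain ⟨x, hx, hxq⟩ := SetLike.not_le_iff_exists.1 this
        refine ⟨x, fun q' hq' => (Finset.inf_le (f := fun q' : PrimeSpectrum A => q'.asIdeal) hq') hx, hxq⟩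
      obtain ⟨x, hx, hxq⟩ := hx
      refine ⟨a + x, fun q' hq' hB => ?_⟩
      by_cases h : q' = q
      · subst h
        exact hxq (h2 _ hq' a x haq hB)
      · have hm : q' ∈ T.erase q := Finset.mem_erase.2 ⟨h, hq'⟩
        exact ha q' hm (h1 q' hq' a x (hx q' hm) hB)
    · refine ⟨a, fun q' hq' => ?_⟩
      by_cases h : q' = q
      · rwa [h]
      · exact ha q' (Finset.mem_erase.2 ⟨h, hq'⟩)

/-- The codimension condition. -/
def GoodSec {A : Type*} [CommRing A] (J : Ideal A) (n : ℕ) {M : Type*} [AddCommGroup M]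
    [Module A M] (s : M) : Prop :=
  ∀ q : PrimeSpectrum A, J ≤ q.asIdeal → FibZero q s →
    Order.coheight q + (fibDim M q : ℕ∞) < (n : ℕ∞)

lemma fibZero_smul_iff {A : Type*} [CommRing A] {M : Type*} [AddCommGroup M] [Module A M]
    {q : PrimeSpectrum A} {p : M} (hp : ¬ FibZero q p) (x : A) :
    FibZero q (x • p) ↔ x ∈ q.asIdeal := by
  unfold FibZero at *
  rw [TensorProduct.tmul_smul, ← algebraMap_smul q.asIdeal.ResidueField x, smul_eq_zero,
    or_iff_left hp, Ideal.algebraMap_residueField_eq_zero]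

lemma FibZero.add {A : Type*} [CommRing A] {M : Type*} [AddCommGroup M] [Module A M]
    {q : PrimeSpectrum A} {x y : M} (hx : FibZero q x) (hy : FibZero q y) : FibZero q (x + y) := by
  unfold FibZero at *
  rw [TensorProduct.tmul_add, hx, hy, add_zero]

lemma FibZero.sub {A : Type*} [CommRing A] {M : Type*} [AddCommGroup M] [Module A M]
    {q : PrimeSpectrum A} {x y : M} (hx : FibZero q x) (hy : FibZero q y) : FibZero q (x - y) := by
  unfold FibZero at *
  rw [TensorProduct.tmul_sub, hx, hy, sub_zero]

/-- Finiteness of the set of critical primes. -/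
lemma critical_finite {A : Type*} [CommRing A] [IsNoetherianRing A] (J : Ideal A) (n : ℕ)
    {M : Type*} [AddCommGroup M] [Module A M] [Module.Finite A M] (s : M) (hs : GoodSec J n s) :
    {q : PrimeSpectrum A | J ≤ q.asIdeal ∧ FibZero q s ∧
      (n : ℕ∞) ≤ Order.coheight q + (fibDim M q : ℕ∞) + 1}.Finite := by
  by_contra hc
  obtain ⟨q0, hJ0, hacc⟩ := exists_accum J _ hc (fun q hq => hq.1)
  obtain ⟨f, hf, hfq⟩ := fibDim_semicont _ M q0 rfl
  obtain ⟨g, hg, hgq⟩ := fibDim_semicont _ (M ⧸ Submodule.span A {s}) q0 rfl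
  obtain ⟨q, ⟨hJq, hzq, hdq⟩, hlt, hfgq⟩ := hacc (f * g)
    (fun h => (q0.isPrime.mem_or_mem h).elim hf hg)
  have hf' := hfq q fun h => hfgq (Ideal.mul_mem_right _ _ h)
  have hg' := hgq q fun h => hfgq (Ideal.mul_mem_left _ _ h)
  have hmono := fibDim_mono M hlt.le
  have hz0 : FibZero q0 s := by
    by_contra hne
    have e1 := fibDim_quot_of_ne hne
    have e2 := fibDim_quot_of_zero hzq
    omega
  have h0 := hs q0 hJ0 hz0
  have hco := Order.coheight_add_one_le hlt
  refine absurd h0 (not_lt.2 (hdq.trans ?_))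
  calc Order.coheight q + (fibDim M q : ℕ∞) + 1
      = Order.coheight q + 1 + (fibDim M q : ℕ∞) := by ring
    _ ≤ _ := by gcongr

lemma goodSec_lift {A : Type*} [CommRing A] [IsNoetherianRing A] (J : Ideal A) (n : ℕ)
    {M : Type*} [AddCommGroup M] [Module A M] [Module.Finite A M] (p : M)
    (h : ∃ s : M ⧸ Submodule.span A {p}, GoodSec J n s) : ∃ s : M, GoodSec J n s := by
  obtain ⟨s, hs⟩ := h
  obtain ⟨s0, rfl⟩ := Submodule.mkQ_surjective _ s
  have hfin0 := critical_finite J n _ hs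
  have hfin := hfin0.subset
    (t := {q | q ∈ {q : PrimeSpectrum A | J ≤ q.asIdeal ∧
      FibZero q ((Submodule.span A {p}).mkQ s0) ∧
      (n : ℕ∞) ≤ Order.coheight q + (fibDim (M ⧸ Submodule.span A {p}) q : ℕ∞) + 1} ∧
      ¬ FibZero q p}) (fun q hq => hq.1)
  obtain ⟨a, ha⟩ := avoid_cosets (fun q => {a | FibZero q (s0 + a • p)}) hfin.toFinset (by
      intro q hq a x hx hB
      have hp : ¬ FibZero q p := ((Set.Finite.mem_toFinset _).1 hq).2
      have := FibZero.sub hB ((fibZero_smul_iff hp x).2 hx)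
      simpa [add_smul, add_sub_assoc] using this) (by
      intro q hq a x hB hB'
      have hp : ¬ FibZero q p := ((Set.Finite.mem_toFinset _).1 hq).2
      have := FibZero.sub hB' hB
      rw [← fibZero_smul_iff hp x]
      simpa [add_smul] using this)
  refine ⟨s0 + a • p, fun q hJq hz => ?_⟩
  have hbar : FibZero q ((Submodule.span A {p}).mkQ s0) := by
    have := fibZero_mkQ (Submodule.span A {p}) hz
    have hp0 : (Submodule.span A {p}).mkQ p = 0 := by
      simp [Submodule.mem_span_singleton_self]
    rwa [map_add, map_smul, hp0, smul_zero, add_zero] at this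
  have hlt := hs q hJq hbar
  by_cases hp : FibZero q p
  · rwa [← fibDim_quot_of_zero hp]
  · rw [← fibDim_quot_of_ne hp]
    by_contra hcon
    refine ha q ((Set.Finite.mem_toFinset _).2 ⟨⟨hJq, hbar, ?_⟩, hp⟩) hz
    rw [not_lt] at hcon
    push_cast at hcon
    rwa [← add_assoc] at hcon

lemma exists_goodSec {A : Type*} [CommRing A] [IsNoetherianRing A] (J : Ideal A) (n : ℕ)
    (hJ : ∀ q : PrimeSpectrum A, J ≤ q.asIdeal → Order.coheight q < (n : ℕ∞)) (m : ℕ) :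
    ∀ (M : Type*) [AddCommGroup M] [Module A M] (g : Fin m → M),
      Submodule.span A (Set.range g) = ⊤ → ∃ s : M, GoodSec J n s := by
  induction m with
  | zero =>
    intro M _ _ g hg
    have : Subsingleton M := by
      rw [← Submodule.subsingleton_iff A, ← subsingleton_iff_bot_eq_top, ← hg]
      simp
    refine ⟨0, fun q hq _ => ?_⟩
    have : fibDim M q = 0 := Module.finrank_zero_of_subsingleton
    simpa [this] using hJ q hq
  | succ m ih =>
    intro M _ _ g hg
    have : Module.Finite A M := ⟨⟨(Set.finite_range g).toFinset, by simpa using hg⟩⟩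
    refine goodSec_lift J n (g 0) (ih _ (fun i => (Submodule.span A {g 0}).mkQ (g i.succ)) ?_)
    have h1 : Submodule.map (Submodule.span A {g 0}).mkQ (Submodule.span A (Set.range g)) = ⊤ := by
      rw [hg, Submodule.map_top, Submodule.range_mkQ]
    rw [Submodule.map_span, ← Set.range_comp] at h1
    rw [eq_top_iff, ← h1, Submodule.span_le]
    rintro _ ⟨i, rfl⟩
    refine Fin.cases ?_ (fun j => ?_) i
    · have hp0 : (Submodule.span A {g 0}).mkQ (g 0) = 0 := by
        simp [Submodule.mem_span_singleton_self]
      simp only [Function.comp_apply, hp0]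
      exact Submodule.zero_mem _
    · exact Submodule.subset_span ⟨j, rfl⟩

/-- A nowhere vanishing section is unimodular. -/
lemma exists_unimodular {A : Type*} [CommRing A] {P : Type*} [AddCommGroup P] [Module A P]
    [Module.Projective A P] (s : P)
    (h : ∀ q : PrimeSpectrum A, q.asIdeal.IsMaximal → ¬ FibZero q s) :
    ∃ φ : P →ₗ[A] A, φ s = 1 := by
  let O : Ideal A := LinearMap.range (LinearMap.applyₗ s : (P →ₗ[A] A) →ₗ[A] A)
  by_cases hO : O = ⊤
  · have : (1 : A) ∈ O := by rw [hO]; trivial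
    exact this
  · exfalso
    obtain ⟨m, hm, hle⟩ := Ideal.exists_le_maximal O hO
    refine h ⟨m, hm.isPrime⟩ hm ?_
    obtain ⟨t, ht⟩ := Module.projective_def.1 (inferInstance : Module.Projective A P)
    have h1 := ht s
    rw [Finsupp.linearCombination_apply, Finsupp.sum] at h1
    rw [← h1]
    unfold FibZero
    rw [TensorProduct.tmul_sum]
    refine Finset.sum_eq_zero fun i _ => ?_
    have hi : t s i ∈ m := hle ⟨Finsupp.lapply i ∘ₗ t, rfl⟩
    rw [← TensorProduct.smul_tmul, ← Algebra.algebraMap_eq_smul_one,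
      Ideal.algebraMap_residueField_eq_zero.2 hi, TensorProduct.zero_tmul]


/-- **Serre's splitting theorem.**  Let `A` be a commutative Noetherian ring with Jacobson
radical `𝒥(A)` and let `P` be a finitely generated projective `A`-module of constant
rank `n > dim (A/𝒥(A))`.  Then `P ≅ Q ⊕ A` for some `A`-module `Q`. -/
theorem serre_splitting {A : Type u} [CommRing A] [IsNoetherianRing A]
    {P : Type v} [AddCommGroup P] [Module A P] [Module.Finite A P] [Module.Projective A P]
    (n : ℕ) (hrank : ∀ p : PrimeSpectrum A, Module.rankAtStalk P p = n)
    (hdim : ringKrullDim (A ⧸ Ideal.jacobson (⊥ : Ideal A)) < (n : WithBot ℕ∞)) :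
    ∃ (Q : Type v) (_ : AddCommGroup Q) (_ : Module A Q),
      Nonempty (P ≃ₗ[A] Q × A) := by

  have hJ : ∀ q : PrimeSpectrum A, Ideal.jacobson (⊥ : Ideal A) ≤ q.asIdeal →
      Order.coheight q < (n : ℕ∞) := by
    intro q hq
    rw [ringKrullDim_quotient] at hdim
    let q' : PrimeSpectrum.zeroLocus (R := A) (Ideal.jacobson (⊥ : Ideal A)) := ⟨q, hq⟩
    have h1 := (Order.coheight_le_krullDim q').trans_lt hdim
    have h2 : Order.coheight q' < (n : ℕ∞) := by exact_mod_cast h1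
    refine lt_of_le_of_lt ?_ h2
    refine Order.coheight_le fun c hc => ?_
    let c' : LTSeries (PrimeSpectrum.zeroLocus (R := A) (Ideal.jacobson (⊥ : Ideal A))) :=
      { length := c.length
        toFun := fun i => ⟨c i, hq.trans (by
          have : c.head ≤ c i := c.monotone (Fin.zero_le i)
          rw [hc] at this
          exact this)⟩
        step := fun i => c.step i }
    exact Order.length_le_coheight (p := c') (x := q') (le_of_eq (Subtype.ext hc.symm))
  obtain ⟨m, g, hg⟩ := Module.Finite.exists_fin (R := A) (M := P)
  obtain ⟨s, hs⟩ := exists_goodSec _ n hJ m P g hg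
  obtain ⟨φ, hφ⟩ := exists_unimodular s (fun q hq hz => by
    have h1 := hs q (Ideal.jacobson_bot (R := A) ▸ Ring.jacobson_le_of_isMaximal q.asIdeal) hz
    have h2 : fibDim P q = n := by
      rw [← hrank q, Module.rankAtStalk_eq]; rfl
    rw [h2] at h1
    exact absurd h1 (not_lt.2 le_add_self))
  have hsurj : Function.Surjective φ := fun a => ⟨a • s, by simp [hφ]⟩
  refine ⟨LinearMap.ker φ, inferInstance, inferInstance, ?_⟩
  refine ⟨LinearEquiv.ofLinearMap
    (LinearMap.prod ((LinearMap.id - (LinearMap.toSpanSingleton A P s) ∘ₗ φ).codRestrict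
      (LinearMap.ker φ) (fun x => by simp [hφ])) φ)
    (LinearMap.coprod (LinearMap.ker φ).subtype (LinearMap.toSpanSingleton A P s)) ?_ ?_⟩
  · ext x <;> simp [hφ]
  · ext x; simp
end

section
/- Eisenbud–Evans theorem: Let A be a commutative Noetherian ring and P a finitely generated projective A-module of constant rank n. Let α : P → A be an A-linear map and a ∈ A. Then there exists an A-linear map β : P → A such that, setting I = (α + aβ)(P) (an ideal of A), the extension of I to the localization A_a has height at least n. In particular, if the ideal α(P) + (a) has height ≥ n and I is a proper ideal of A, then ht I = n. -/
open Submodule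

lemma ee_field {K V : Type*} [Field K] [AddCommGroup V] [Module K V] {k : ℕ}
    (x : Fin k → V) (y : V)
    (h : Module.finrank K (span K (insert y (Set.range x))) ≤ k) :
    ∃ e : Fin k → ℕ, ∀ b : K, b ≠ 0 →
      span K (Set.range fun i => x i + (b * (e i : K)) • y) = span K (insert y (Set.range x)) := by
  by_cases hy : y ∈ span K (Set.range x)
  · refine ⟨0, fun b hb => ?_⟩
    simp [span_insert_eq_span hy]
  · have hx : ¬ LinearIndependent K x := by
      intro hx
      have h2 : LinearIndependent K (Fin.cons y x : Fin (k+1) → V) :=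
        linearIndependent_finCons.2 ⟨hx, hy⟩
      have h3 := finrank_span_eq_card h2
      rw [Fin.range_cons] at h3
      simp at h3
      omega
    rw [linearIndependent_iff_notMem_span] at hx
    push Not at hx
    obtain ⟨j, hj⟩ := hx
    refine ⟨Pi.single j 1, fun b hb => ?_⟩
    set W := span K (Set.range fun i => x i + (b * ((Pi.single j 1 : Fin k → ℕ) i : K)) • y) with hW
    have hmem : ∀ i, x i + (b * ((Pi.single j 1 : Fin k → ℕ) i : K)) • y ∈ W := fun i =>
      subset_span ⟨i, rfl⟩
    have h1 : ∀ i, i ≠ j → x i ∈ W := fun i hi => by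
      simpa [Pi.single_apply, hi] using hmem i
    have h2 : x j ∈ W := by
      refine (span_le.2 ?_) hj
      rintro _ ⟨i, hi, rfl⟩
      exact h1 i (by simpa using hi)
    have h3 : y ∈ W := by
      have := W.sub_mem (hmem j) h2
      simp at this
      exact (W.smul_mem_iff hb).1 this
    apply le_antisymm
    · refine span_le.2 ?_
      rintro _ ⟨i, rfl⟩
      exact add_mem (subset_span (Or.inr ⟨i, rfl⟩)) (smul_mem _ _ (subset_span (Or.inl rfl)))
    · refine span_le.2 ?_
      rintro _ (rfl | ⟨i, rfl⟩)
      · exact h3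
      · by_cases hi : i = j
        · subst hi; exact h2
        · exact h1 i hi

lemma ee_span_add {K V ι : Type*} [Field K] [AddCommGroup V] [Module K V]
    (x : ι → V) (y : V) (c : ι → K) :
    span K (insert y (Set.range fun i => x i + c i • y)) = span K (insert y (Set.range x)) := by
  apply le_antisymm
  · refine span_le.2 ?_
    rintro _ (rfl | ⟨i, rfl⟩)
    · exact subset_span (Or.inl rfl)
    · exact add_mem (subset_span (Or.inr ⟨i, rfl⟩)) (smul_mem _ _ (subset_span (Or.inl rfl)))
  · refine span_le.2 ?_
    rintro _ (rfl | ⟨i, rfl⟩)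
    · exact subset_span (Or.inl rfl)
    · have : x i = (x i + c i • y) - c i • y := by simp
      rw [this]
      exact sub_mem (subset_span (Or.inr ⟨i, rfl⟩)) (smul_mem _ _ (subset_span (Or.inl rfl)))

/-- reduction of a vector modulo a prime -/
noncomputable def eeVec {A : Type*} [CommRing A] {N : ℕ} (p : PrimeSpectrum A) (v : Fin N → A) :
    Fin N → p.asIdeal.ResidueField := fun j => algebraMap A _ (v j)

section
variable {A : Type*} [CommRing A] {N : ℕ}

lemma eeVec_add_smul (p : PrimeSpectrum A) (v w : Fin N → A) (c : A) :
    eeVec p (v + c • w) = eeVec p v + (algebraMap A p.asIdeal.ResidueField c) • eeVec p w := by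
  ext j; simp [eeVec, Algebra.smul_def]

lemma ee_finite {k : ℕ} (S : Finset (PrimeSpectrum A)) : ∀ (x : Fin k → Fin N → A)
    (y : Fin N → A) (_ : ∀ p ∈ S, Module.finrank p.asIdeal.ResidueField
      (span p.asIdeal.ResidueField (insert (eeVec p y) (Set.range fun i => eeVec p (x i)))) ≤ k),
    ∃ c : Fin k → A, ∀ p ∈ S,
      span p.asIdeal.ResidueField (Set.range fun i => eeVec p (x i + c i • y)) =
      span p.asIdeal.ResidueField (insert (eeVec p y) (Set.range fun i => eeVec p (x i))) := by
  classical
  induction S using Finset.strongInduction with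
  | H S ih =>
    intro x y h
    rcases S.eq_empty_or_nonempty with rfl | hS
    · exact ⟨0, by simp⟩
    obtain ⟨p0, hp0⟩ := S.exists_minimal hS
    obtain ⟨c, hc⟩ := ih (S.erase p0) (Finset.erase_ssubset hp0.1) x y
      (fun p hp => h p (Finset.mem_of_mem_erase hp))
    have hb : ∃ b : A, b ∉ p0.asIdeal ∧ ∀ q ∈ S.erase p0, b ∈ q.asIdeal := by
      have : ¬ ((S.erase p0).inf fun q => q.asIdeal) ≤ p0.asIdeal := by
        intro hle
        obtain ⟨q, hq, hqp⟩ := (Ideal.IsPrime.inf_le' p0.2).1 hle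
        have h2 := Finset.mem_erase.1 hq
        exact h2.1 (le_antisymm hqp (hp0.2 h2.2 hqp))
      obtain ⟨b, hb, hb'⟩ := SetLike.not_le_iff_exists.1 this
      refine ⟨b, hb', fun q hq => ?_⟩
      exact (Finset.inf_le (f := fun q : PrimeSpectrum A => q.asIdeal) hq) hb
    obtain ⟨b, hb0, hb⟩ := hb
    have key : span p0.asIdeal.ResidueField
        (insert (eeVec p0 y) (Set.range fun i => eeVec p0 (x i + c i • y))) =
        span p0.asIdeal.ResidueField (insert (eeVec p0 y) (Set.range fun i => eeVec p0 (x i))) := by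
      simp_rw [eeVec_add_smul]
      exact ee_span_add _ _ _
    obtain ⟨e, he⟩ := ee_field (fun i => eeVec p0 (x i + c i • y)) (eeVec p0 y)
      (by rw [key]; exact h p0 hp0.1)
    have hx : ∀ i, x i + (c i + b * (e i : A)) • y = (x i + c i • y) + (b * (e i : A)) • y := by
      intro i; rw [add_smul, add_assoc]
    refine ⟨fun i => c i + b * (e i : A), fun p hp => ?_⟩
    simp_rw [hx]
    by_cases hpp : p = p0
    · subst hpp
      rw [← key, ← he (algebraMap A _ b) (by simpa using hb0)]
      congr 2
      ext1 i
      rw [eeVec_add_smul]; simp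
    · have hp' := Finset.mem_erase.2 ⟨hpp, hp⟩
      rw [← hc p hp']
      congr 2
      ext1 i
      rw [eeVec_add_smul]
      have : algebraMap A p.asIdeal.ResidueField b = 0 := by simpa using hb p hp'
      simp [this]

lemma ee_sub {K : Type*} [Field K] {ι κ : Type*} [Fintype ι] [Fintype κ] (B : Matrix ι κ K) (t : ℕ)
    (h : t ≤ B.rank) : ∃ e : Fin t → ι, (B.submatrix e id).rank = t := by
  obtain ⟨σ, a, ha, hs, hli⟩ := exists_linearIndependent' K B.row
  have : Fintype σ := Fintype.ofInjective a ha
  rw [B.rank_eq_finrank_span_row, ← hs, finrank_span_eq_card hli] at h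
  rw [← Fintype.card_fin t] at h
  obtain ⟨f⟩ := Function.Embedding.nonempty_of_card_le h
  refine ⟨a ∘ f, ?_⟩
  have h2 : LinearIndependent K (B.submatrix (a ∘ f) id).row := hli.comp f f.injective
  rw [Matrix.rank_eq_finrank_span_row, finrank_span_eq_card h2, Fintype.card_fin]

lemma ee_minor {K : Type*} [Field K] {ι κ : Type*} [Fintype ι] [Fintype κ] (B : Matrix ι κ K) (t : ℕ)
    (h : t ≤ B.rank) : ∃ (e : Fin t → ι) (f : Fin t → κ), (B.submatrix e f).det ≠ 0 := by
  obtain ⟨e, he⟩ := ee_sub B t h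
  obtain ⟨f, hf⟩ := ee_sub (B.submatrix e id).transpose t (by rw [Matrix.rank_transpose, he])
  refine ⟨e, f, ?_⟩
  rw [← Matrix.rank_transpose] at hf
  have : (((B.submatrix e id).transpose.submatrix f id).transpose) = B.submatrix e f := rfl
  rw [this] at hf
  rw [Matrix.rank_eq_finrank_span_row] at hf
  have h2 : LinearIndependent K (B.submatrix e f).row :=
    linearIndependent_iff_card_eq_finrank_span.2 (by rw [Fintype.card_fin]; exact hf.symm)
  rw [Matrix.linearIndependent_rows_iff_isUnit, Matrix.isUnit_iff_isUnit_det] at h2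
  exact h2.ne_zero

/-- rank modulo a prime -/
noncomputable def eeRank {k : ℕ} (p : PrimeSpectrum A) (x : Fin k → Fin N → A) : ℕ :=
  Module.finrank p.asIdeal.ResidueField
    (span p.asIdeal.ResidueField (Set.range fun i => eeVec p (x i)))

lemma eeRank_eq {k : ℕ} (p : PrimeSpectrum A) (x : Fin k → Fin N → A) :
    eeRank p x = ((Matrix.of x).map (algebraMap A p.asIdeal.ResidueField)).rank := by
  rw [Matrix.rank_eq_finrank_span_row]; rfl

lemma ee_closed {k : ℕ} (x : Fin k → Fin N → A) (t : ℕ) :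
    ∃ J : Ideal A, ∀ p : PrimeSpectrum A, J ≤ p.asIdeal ↔ eeRank p x ≤ t := by
  refine ⟨Ideal.span (Set.range fun ef : (Fin (t+1) → Fin k) × (Fin (t+1) → Fin N) =>
    ((Matrix.of x).submatrix ef.1 ef.2).det), fun p => ?_⟩
  have hdet : ∀ e f, (((Matrix.of x).map (algebraMap A p.asIdeal.ResidueField)).submatrix e f).det
      = algebraMap A p.asIdeal.ResidueField
        (((Matrix.of x).submatrix e f : Matrix (Fin (t+1)) (Fin (t+1)) A).det) := by
    intro e f
    rw [RingHom.map_det]; rfl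
  rw [eeRank_eq, Ideal.span_le]
  constructor
  · intro h
    by_contra! hlt
    obtain ⟨e, f, hef⟩ := ee_minor _ (t+1) hlt
    rw [hdet] at hef
    apply hef
    rw [Ideal.algebraMap_residueField_eq_zero]
    exact h ⟨(e, f), rfl⟩
  · rintro h _ ⟨⟨e, f⟩, rfl⟩
    by_contra hne
    have h1 : (((Matrix.of x).map (algebraMap A p.asIdeal.ResidueField)).submatrix e f).det ≠ 0 := by
      rw [hdet, Ne, Ideal.algebraMap_residueField_eq_zero]; exact hne
    have h2 := Matrix.rank_of_isUnit _ ((Matrix.isUnit_iff_isUnit_det _).2 h1.isUnit)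
    have h3 := Matrix.rank_submatrix_le
      ((Matrix.of x).map (algebraMap A p.asIdeal.ResidueField)) e f
    rw [h2, Fintype.card_fin] at h3
    omega

lemma ee_step [IsNoetherianRing A] (n k : ℕ) (X : Set (PrimeSpectrum A))
    (hX : ∀ p ∈ X, ∀ q ≤ p, q ∈ X) (x : Fin (k+1) → Fin N → A)
    (h : ∀ p ∈ X, k + 1 ≤ eeRank p x ∨ (n : ℕ∞) ≤ eeRank p x + Order.height p) :
    ∃ c : Fin k → A, ∀ p ∈ X,
      k ≤ eeRank p (fun i : Fin k => x i.castSucc + c i • x (Fin.last k)) ∨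
      (n : ℕ∞) ≤ eeRank p (fun i : Fin k => x i.castSucc + c i • x (Fin.last k))
        + Order.height p := by
  classical
  set B : Set (PrimeSpectrum A) :=
    {p | p ∈ X ∧ eeRank p x ≤ k ∧ (n : ℕ∞) = eeRank p x + Order.height p} with hB
  have hBfin : B.Finite := by
    choose J hJ using ee_closed x
    have hfin : (⋃ t ∈ Finset.range (k+1), (PrimeSpectrum.asIdeal ⁻¹' (J t).minimalPrimes)).Finite := by
      refine Set.Finite.biUnion (Finset.finite_toSet _) fun t _ => ?_
      exact Set.Finite.preimage (fun a _ b _ h => PrimeSpectrum.ext h)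
        ((J t).finite_minimalPrimes_of_isNoetherianRing)
    refine hfin.subset ?_
    rintro p ⟨hpX, hpk, hpn⟩
    simp only [Set.mem_iUnion, Set.mem_preimage]
    refine ⟨eeRank p x, by simp; omega, ⟨p.2, (hJ _ p).2 le_rfl⟩, ?_⟩
    rintro q ⟨hq, hJq⟩ hqp
    have hq1 := (hJ _ ⟨q, hq⟩).1 hJq
    have hle : (⟨q, hq⟩ : PrimeSpectrum A) ≤ p := hqp
    rcases hle.eq_or_lt with heq | hlt
    · rw [← heq]
    · exfalso
      have hqX := hX p hpX _ hle
      have hfinh : Order.height p ≠ ⊤ := by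
        intro htop; rw [htop] at hpn; simp at hpn
      have hlt' := Order.height_strictMono hlt
        (lt_of_le_of_lt (Order.height_mono hle) (lt_top_iff_ne_top.2 hfinh))
      rcases h _ hqX with h1 | h1
      · omega
      · lift Order.height p to ℕ using hfinh with hp
        lift Order.height (⟨q, hq⟩ : PrimeSpectrum A) to ℕ using (ne_top_of_lt hlt') with hq'
        norm_cast at *
        omega
  have hins : ∀ p : PrimeSpectrum A, insert (eeVec p (x (Fin.last k)))
      (Set.range fun i : Fin k => eeVec p (x i.castSucc)) = Set.range fun i => eeVec p (x i) := by
    intro p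
    ext v
    simp only [Set.mem_insert_iff, Set.mem_range]
    constructor
    · rintro (rfl | ⟨i, rfl⟩)
      exacts [⟨_, rfl⟩, ⟨_, rfl⟩]
    · rintro ⟨i, rfl⟩
      induction i using Fin.lastCases with
      | last => exact Or.inl rfl
      | cast i => exact Or.inr ⟨i, rfl⟩
  obtain ⟨c, hc⟩ := ee_finite hBfin.toFinset (fun i : Fin k => x i.castSucc) (x (Fin.last k)) (by
    intro p hp
    rw [hins]
    exact (hBfin.mem_toFinset.1 hp).2.1)
  refine ⟨c, fun p hp => ?_⟩
  set x' := (fun i : Fin k => x i.castSucc + c i • x (Fin.last k)) with hx'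
  have hge : eeRank p x ≤ eeRank p x' + 1 := by
    have h1 := ee_span_add (fun i : Fin k => eeVec p (x i.castSucc)) (eeVec p (x (Fin.last k)))
      (fun i => algebraMap A p.asIdeal.ResidueField (c i))
    rw [hins] at h1
    simp_rw [← eeVec_add_smul] at h1
    rw [eeRank, ← h1, eeRank, span_insert]
    refine (Submodule.finrank_add_le_finrank_add_finrank _ _).trans ?_
    have := finrank_span_le_card (R := p.asIdeal.ResidueField) {eeVec p (x (Fin.last k))}
    rw [add_comm]
    gcongr
    simpa using this
  by_cases hpB : p ∈ B
  · have h1 := hc p (hBfin.mem_toFinset.2 hpB)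
    rw [hins] at h1
    have h2 : eeRank p x' = eeRank p x := by
      rw [eeRank, h1]; rfl
    right
    rw [h2, ← hpB.2.2]
  · rcases h p hp with h1 | h1
    · left; omega
    · by_cases hk : k + 1 ≤ eeRank p x
      · left; omega
      right
      have hne : (n : ℕ∞) ≠ eeRank p x + Order.height p := fun he => hpB ⟨hp, by omega, he⟩
      by_cases htop : Order.height p = ⊤
      · simp [htop]
      · lift Order.height p to ℕ using htop with hh
        norm_cast at *
        omega

lemma ee_core [IsNoetherianRing A] (n : ℕ) (X : Set (PrimeSpectrum A))
    (hX : ∀ p ∈ X, ∀ q ≤ p, q ∈ X) (k : ℕ) : ∀ (x : Fin (k+1) → Fin N → A)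
    (_ : ∀ p ∈ X, k + 1 ≤ eeRank p x ∨ (n : ℕ∞) ≤ eeRank p x + Order.height p),
    ∃ u ∈ span A (Set.range fun i : Fin k => x i.succ), ∀ p ∈ X,
      (∀ j, (x 0 + u) j ∈ p.asIdeal) → (n : ℕ∞) ≤ Order.height p := by
  induction k with
  | zero =>
    intro x h
    refine ⟨0, zero_mem _, fun p hp hj => ?_⟩
    have h0 : eeRank p x = 0 := by
      have : (Set.range fun i => eeVec p (x i)) ⊆ {0} := by
        rintro _ ⟨i, rfl⟩
        obtain rfl : i = 0 := Fin.ext (by omega)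
        ext j
        have := hj j
        simpa [eeVec] using this
      rw [eeRank, span_eq_bot.2 (fun v hv => this hv), finrank_bot]
    simpa [h0] using h p hp
  | succ k ih =>
    intro x h
    obtain ⟨c, hc⟩ := ee_step n (k+1) X hX x h
    obtain ⟨u, hu, hu'⟩ := ih _ hc
    refine ⟨c 0 • x (Fin.last _) + u, add_mem (smul_mem _ _ (subset_span ⟨Fin.last _, rfl⟩)) ?_, ?_⟩
    · refine (span_le.2 ?_) hu
      rintro _ ⟨i, rfl⟩
      exact add_mem (subset_span ⟨i.castSucc, rfl⟩) (smul_mem _ _ (subset_span ⟨Fin.last _, rfl⟩))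
    · intro p hp hj
      refine hu' p hp ?_
      rw [← add_assoc] at hj
      exact hj
end

section
variable {A : Type*} [CommRing A]

open TensorProduct in
lemma ee_upper [IsNoetherianRing A]
    {P : Type*} [AddCommGroup P] [Module A P] [Module.Finite A P] [Module.Projective A P]
    (n : ℕ) (hrank : ∀ p : PrimeSpectrum A, Module.rankAtStalk P p = n)
    (γ : P →ₗ[A] A) (h : LinearMap.range γ ≠ ⊤) :
    ∃ q : PrimeSpectrum A, LinearMap.range γ ≤ q.asIdeal ∧ Order.height q ≤ n := by
  obtain ⟨m, hm, hIm⟩ := Ideal.exists_le_maximal _ h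
  let p : PrimeSpectrum A := ⟨m, hm.isPrime⟩
  let R := Localization.AtPrime p.asIdeal
  have hr := hrank p
  rw [Module.rankAtStalk_eq_finrank_tensorProduct] at hr
  have hfree : Module.Free R (R ⊗[A] P) := Module.free_of_flat_of_isLocalRing
  let b := Module.finBasisOfFinrankEq R (R ⊗[A] P) hr
  let γ' : R ⊗[A] P →ₗ[R] R := LinearMap.liftBaseChange R (Algebra.linearMap A R ∘ₗ γ)
  have hJ : LinearMap.range γ' = Ideal.span (Set.range fun i => γ' (b i)) := by
    have := Submodule.map_span γ' (Set.range b)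
    rw [b.span_eq, Submodule.map_top, ← Set.range_comp] at this
    exact this
  have hJ2 : LinearMap.range γ' = Ideal.map (algebraMap A R) (LinearMap.range γ) := by
    rw [LinearMap.range_liftBaseChange]
    rw [Ideal.map]
    congr 1
    ext z
    simp
  have hne : Ideal.map (algebraMap A R) (LinearMap.range γ) ≠ ⊤ := by
    intro htop
    have h1 : Ideal.map (algebraMap A R) (LinearMap.range γ) ≤ IsLocalRing.maximalIdeal R := by
      rw [← Localization.AtPrime.map_eq_maximalIdeal]
      exact Ideal.map_mono hIm
    rw [htop] at h1
    exact (IsLocalRing.maximalIdeal.isMaximal R).ne_top (top_le_iff.1 h1)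
  obtain ⟨Q, hQ⟩ := Ideal.nonempty_minimalPrimes hne
  have hQp := hQ.1.1
  have hQh : Q.height ≤ n := by
    rw [← hJ2, hJ] at hQ
    refine (Ideal.height_le_card_of_mem_minimalPrimes_span (Set.finite_range _) hQ).trans ?_
    rw [Nat.cast_le, ← Set.image_univ]
    refine (Set.ncard_image_le Set.finite_univ).trans ?_
    simp
  refine ⟨⟨Q.under A, inferInstance⟩, ?_, ?_⟩
  · exact Ideal.map_le_iff_le_comap.1 hQ.1.2
  · rw [← PrimeSpectrum.height_eq_orderHeight]
    rw [IsLocalization.height_under p.asIdeal.primeCompl]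
    exact hQh

open TensorProduct in
lemma ee_rank {N : ℕ} {P : Type*} [AddCommGroup P] [Module A P] [Module.Finite A P]
    [Module.Projective A P] (p : PrimeSpectrum A)
    (π : (Fin N → A) →ₗ[A] P) (s : P →ₗ[A] (Fin N → A)) (hs : π ∘ₗ s = LinearMap.id) :
    eeRank p (fun j i => s (π (Pi.single i 1)) j : Fin N → Fin N → A) = Module.rankAtStalk P p := by
  let K := p.asIdeal.ResidueField
  let f : (Fin N → A) →ₗ[A] (Fin N → K) := (Algebra.linearMap A K).compLeft (Fin N)
  let s' : K ⊗[A] P →ₗ[K] (Fin N → K) := LinearMap.liftBaseChange K (f ∘ₗ s)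
  let π' : (Fin N → K) →ₗ[K] K ⊗[A] P :=
    Fintype.linearCombination K (fun i => (1 : K) ⊗ₜ[A] π (Pi.single i 1))
  have hπs : π' ∘ₗ s' = LinearMap.id := by
    apply TensorProduct.AlgebraTensorModule.curry_injective
    ext x
    have h1 : π (s x) = x := LinearMap.congr_fun hs x
    have h2 : π (s x) = ∑ i, s x i • π (Pi.single i 1) := by
      conv_lhs => rw [pi_eq_sum_univ' (s x)]
      simp [map_sum]
    have h3 : π' (s' (1 ⊗ₜ x)) = 1 ⊗ₜ x := by
      conv_rhs => rw [← h1, h2, TensorProduct.tmul_sum]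
      simp only [π', s', f, Fintype.linearCombination_apply]
      refine Finset.sum_congr rfl fun i _ => ?_
      simp
    exact h3
  have hinj : Function.Injective s' :=
    Function.LeftInverse.injective (g := π') (fun x => LinearMap.congr_fun hπs x)
  have hsurj : Function.Surjective π :=
    Function.RightInverse.surjective (g := s) (fun x => LinearMap.congr_fun hs x)
  rw [eeRank_eq, Matrix.rank_eq_finrank_span_cols, Module.rankAtStalk_eq]
  have hcol : span K (Set.range ((Matrix.of
      (fun j i => s (π (Pi.single i 1)) j : Fin N → Fin N → A)).map (algebraMap A K)).col)
      = LinearMap.range s' := by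
    apply le_antisymm
    · refine span_le.2 ?_
      rintro _ ⟨i, rfl⟩
      refine ⟨1 ⊗ₜ π (Pi.single i 1), ?_⟩
      ext j
      simp [s', f]
    · rw [LinearMap.range_liftBaseChange]
      refine span_le.2 ?_
      rintro _ ⟨x, rfl⟩
      obtain ⟨z, rfl⟩ := hsurj x
      have hz : f (s (π z)) = ∑ i, algebraMap A K (z i) • f (s (π (Pi.single i 1))) := by
        conv_lhs => rw [pi_eq_sum_univ' z]
        simp [map_sum]
      have hz' : (f ∘ₗ s) (π z) = f (s (π z)) := rfl
      rw [hz', hz]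
      refine sum_mem fun i _ => smul_mem _ _ (subset_span ⟨i, ?_⟩)
      rfl
  rw [hcol, LinearMap.finrank_range_of_inj hinj]
end

/-- **Eisenbud–Evans theorem.**  Let `A` be a commutative Noetherian ring and `P` a
finitely generated projective `A`-module of constant rank `n`.  Given `α : P → A` linear
and `a ∈ A`, there is `β : P → A` such that, with `I = (α + aβ)(P)`, the extension of `I`
to `A_a` has height at least `n`.  In particular, if `ht (α(P) + (a)) ≥ n` and `I` is
proper, then `ht I = n`. -/
theorem eisenbud_evans {A : Type*} [CommRing A] [IsNoetherianRing A]
    {P : Type*} [AddCommGroup P] [Module A P] [Module.Finite A P] [Module.Projective A P]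
    (n : ℕ) (hrank : ∀ p : PrimeSpectrum A, Module.rankAtStalk P p = n)
    (α : P →ₗ[A] A) (a : A) :
    ∃ β : P →ₗ[A] A,
      (n : ℕ∞) ≤ idealHeight
        (Ideal.map (algebraMap A (Localization.Away a)) (LinearMap.range (α + a • β))) ∧
      ((n : ℕ∞) ≤ idealHeight (LinearMap.range α ⊔ Ideal.span {a}) →
        LinearMap.range (α + a • β) ≠ ⊤ →
        idealHeight (LinearMap.range (α + a • β)) = n) := by
  obtain ⟨N, π, hπ⟩ := Module.Finite.exists_fin' A P
  obtain ⟨s, hs⟩ := Module.projective_lifting_property π LinearMap.id hπ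
  set E : Fin N → Fin N → A := fun j i => s (π (Pi.single i 1)) j with hE
  set x : Fin (N+1) → Fin N → A := Fin.cons (fun i => α (π (Pi.single i 1))) (fun j => a • E j)
    with hx
  set X : Set (PrimeSpectrum A) := {p | a ∉ p.asIdeal} with hX
  obtain ⟨u, hu, hu'⟩ := ee_core n X (fun p hp q hqp ha => hp (hqp ha)) N x (by
    intro p hp
    right
    have h1 : n ≤ eeRank p x := by
      rw [← hrank p, ← ee_rank p π s hs]
      apply Submodule.finrank_mono
      refine Submodule.span_le.2 ?_
      rintro _ ⟨j, rfl⟩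
      have hne : algebraMap A p.asIdeal.ResidueField a ≠ 0 := by
        rw [Ne, Ideal.algebraMap_residueField_eq_zero]; exact hp
      refine (Submodule.smul_mem_iff _ hne).1 (Submodule.subset_span ⟨j.succ, ?_⟩)
      have := eeVec_add_smul p 0 (E j) a
      have h0 : eeVec p (0 : Fin N → A) = 0 := by ext; simp [eeVec]
      rw [h0, zero_add, zero_add] at this
      exact this
    exact (Nat.cast_le.2 h1).trans le_self_add)
  obtain ⟨c, rfl⟩ := (Submodule.mem_span_range_iff_exists_fun A).1 hu
  let β : P →ₗ[A] A := ∑ j, c j • (LinearMap.proj j ∘ₗ s)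
  have hval : ∀ i, (x 0 + ∑ j, c j • x j.succ) i = (α + a • β) (π (Pi.single i 1)) := by
    intro i
    simp [hx, β, hE, Finset.mul_sum, mul_left_comm]
  have hmain : ∀ p : PrimeSpectrum A, a ∉ p.asIdeal → LinearMap.range (α + a • β) ≤ p.asIdeal →
      (n : ℕ∞) ≤ Order.height p := by
    intro p hp hle
    refine hu' p hp fun j => ?_
    rw [hval]
    exact hle ⟨_, rfl⟩
  refine ⟨β, ?_, fun h1 h2 => le_antisymm ?_ ?_⟩
  · refine le_iInf₂ fun q hq => ?_
    have h1 := IsLocalization.height_under (Submonoid.powers a) q.asIdeal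
    rw [← PrimeSpectrum.height_eq_orderHeight, ← h1]
    have h2 := hmain ⟨q.asIdeal.under A, inferInstance⟩ (fun ha => ?_)
      (Ideal.map_le_iff_le_comap.1 hq)
    · rwa [← PrimeSpectrum.height_eq_orderHeight] at h2
    · exact q.2.ne_top (Ideal.eq_top_of_isUnit_mem _ ha
        (IsLocalization.Away.algebraMap_isUnit a))
  · obtain ⟨q, hq, hqn⟩ := ee_upper n hrank _ h2
    exact (iInf₂_le q hq).trans hqn
  · refine le_iInf₂ fun p hp => ?_
    by_cases ha : a ∈ p.asIdeal
    · have hsup : LinearMap.range α ⊔ Ideal.span {a} ≤ p.asIdeal := by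
        refine sup_le ?_ ?_
        · rintro _ ⟨y, rfl⟩
          have h3 := hp ⟨y, rfl⟩
          have h4 : α y = (α + a • β) y - a * β y := by simp
          rw [h4]
          exact sub_mem h3 (Ideal.mul_mem_right _ _ ha)
        · rwa [Ideal.span_singleton_le_iff_mem]
      exact h1.trans (iInf₂_le p hsup)
    · exact hmain p ha hp
end
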